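/- Any graph that contains k pairwise edge-disjoint double rays for every natural number k contains infinitely many pairwise edge-disjoint double rays. -/

import Mathlib

open SimpleGraph

variable {V : Type*}

/-- A ray in `G`: an injective sequence of vertices with consecutive vertices adjacent. -/
def IsRay (G : SimpleGraph V) (f : ℕ → V) : Prop :=
  Function.Injective f ∧ ∀ n, G.Adj (f n) (f (n + 1))

/-- A double ray in `G`: an injective two-way infinite sequence with consecutive
vertices adjacent. -/
def IsDoubleRay (G : SimpleGraph V) (f : ℤ → V) : Prop :=
  Function.Injective f ∧ ∀ n, G.Adj (f n) (f (n + 1))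

/-- The edges used by a ray. -/
def rayEdges (f : ℕ → V) : Set (Sym2 V) := {e | ∃ n, e = s(f n, f (n + 1))}

/-- The edges used by a double ray. -/
def drEdges (f : ℤ → V) : Set (Sym2 V) := {e | ∃ n : ℤ, e = s(f n, f (n + 1))}

/-- Two rays are equivalent (belong to the same end) iff no finite vertex set
separates them: for every finite `S` there are tails of both rays avoiding `S`
which are joined by a walk avoiding `S`. -/
def RayEquiv (G : SimpleGraph V) (f g : ℕ → V) : Prop :=
  ∀ S : Finset V, ∃ a b, (∀ i, a ≤ i → f i ∉ S) ∧ (∀ j, b ≤ j → g j ∉ S) ∧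
    ∃ w : G.Walk (f a) (g b), ∀ v ∈ w.support, v ∉ S

/-- The forward ray of a double ray. -/
def drFwd (f : ℤ → V) : ℕ → V := fun n => f n

/-- The backward ray of a double ray. -/
def drBwd (f : ℤ → V) : ℕ → V := fun n => f (-(n : ℤ) - 1)

/-- The end (represented by the ray `R`) has vertex-degree exactly `k`:
there are `k` pairwise vertex-disjoint rays equivalent to `R`, but not `k + 1`. -/
def EndVertexDegree (G : SimpleGraph V) (R : ℕ → V) (k : ℕ) : Prop :=
  (∃ F : Fin k → ℕ → V, (∀ i, IsRay G (F i) ∧ RayEquiv G R (F i)) ∧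
      Pairwise fun i j => Disjoint (Set.range (F i)) (Set.range (F j))) ∧
  ¬ ∃ F : Fin (k + 1) → ℕ → V, (∀ i, IsRay G (F i) ∧ RayEquiv G R (F i)) ∧
      Pairwise fun i j => Disjoint (Set.range (F i)) (Set.range (F j))

namespace DoubleRay

/-! ### Recursive choices -/

theorem exists_seq_of_step {σ : Type*} (P : ℕ → σ → Prop) (R : ℕ → σ → σ → Prop) {s₀ : σ}
    (h0 : P 0 s₀) (hs : ∀ n s, P n s → ∃ s', P (n + 1) s' ∧ R n s s') :
    ∃ s : ℕ → σ, s 0 = s₀ ∧ (∀ n, P n (s n)) ∧ ∀ n, R n (s n) (s (n + 1)) := by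
  choose! nx h1 h2 using hs
  let s : ℕ → σ := fun n => Nat.rec s₀ (fun n t => nx n t) n
  have hP : ∀ n, P n (s n) := by
    intro n
    induction n with
    | zero => exact h0
    | succ n ih => exact h1 n _ ih
  exact ⟨s, rfl, hP, fun n => h2 n _ (hP n)⟩

theorem exists_seq_of_history {α : Type*} (P : List α → α → Prop) (h : ∀ l, ∃ x, P l x) :
    ∃ f : ℕ → α, ∀ n, P ((List.range n).map f) (f n) := by
  choose c hc using h
  let L : ℕ → List α := fun n => Nat.rec [] (fun _ l => l ++ [c l]) n
  have hL : ∀ n, L n = (List.range n).map (fun n => c (L n)) := by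
    intro n
    induction n with
    | zero => rfl
    | succ n ih =>
      rw [List.range_succ, List.map_append, ← ih]
      rfl
  refine ⟨fun n => c (L n), fun n => ?_⟩
  rw [← hL]
  exact hc _

/-! ### Graph pieces -/

/-- The graph has infinitely many pairwise edge-disjoint double rays. -/
def HasInf (G : SimpleGraph V) : Prop :=
  ∃ F : ℕ → ℤ → V, (∀ i, IsDoubleRay G (F i)) ∧
    Pairwise fun i j => Disjoint (drEdges (F i)) (drEdges (F j))

/-- The graph with only the edges having both ends in `W`. -/
def restr (G : SimpleGraph V) (W : Set V) : SimpleGraph V where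
  Adj a b := G.Adj a b ∧ a ∈ W ∧ b ∈ W
  symm := ⟨fun _ _ h => ⟨h.1.symm, h.2.2, h.2.1⟩⟩
  loopless := ⟨fun _ h => h.1.ne rfl⟩

theorem restr_le (G : SimpleGraph V) (W : Set V) : restr G W ≤ G := fun _ _ h => h.1

theorem restr_mono {G G' : SimpleGraph V} {W W' : Set V} (h : G ≤ G') (hW : W ⊆ W') :
    restr G W ≤ restr G' W' := fun _ _ h' => ⟨h h'.1, hW h'.2.1, hW h'.2.2⟩

/-- The graph formed by the edges of a sequence of vertices. -/
def rayGraph (f : ℕ → V) : SimpleGraph V :=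
  SimpleGraph.fromRel fun a b => ∃ n, a = f n ∧ b = f (n + 1)

theorem rayGraph_le {G : SimpleGraph V} {f : ℕ → V} (hf : IsRay G f) : rayGraph f ≤ G := by
  rintro a b ⟨-, ⟨n, rfl, rfl⟩ | ⟨n, rfl, rfl⟩⟩
  · exact hf.2 n
  · exact (hf.2 n).symm

theorem rayGraph_adj {G : SimpleGraph V} {f : ℕ → V} (hf : IsRay G f) (n : ℕ) :
    (rayGraph f).Adj (f n) (f (n + 1)) :=
  ⟨(hf.2 n).ne, Or.inl ⟨n, rfl, rfl⟩⟩

theorem adj_of_rayGraph {f : ℕ → V} {a b : V} (h : (rayGraph f).Adj a b) :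
    ∃ n, (a = f n ∧ b = f (n + 1)) ∨ (b = f n ∧ a = f (n + 1)) := by
  obtain ⟨-, ⟨n, h⟩ | ⟨n, h⟩⟩ := h
  · exact ⟨n, Or.inl h⟩
  · exact ⟨n, Or.inr h⟩

theorem _root_.IsRay.mono {G H : SimpleGraph V} (h : G ≤ H) {f : ℕ → V} (hf : IsRay G f) : IsRay H f :=
  ⟨hf.1, fun n => h (hf.2 n)⟩

theorem _root_.IsRay.tail {G : SimpleGraph V} {f : ℕ → V} (hf : IsRay G f) (s : ℕ) :
    IsRay G (fun n => f (s + n)) :=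
  ⟨fun a b h => by have := hf.1 h; omega, fun n => hf.2 (s + n)⟩

theorem _root_.IsRay.cons {G : SimpleGraph V} {f : ℕ → V} (hf : IsRay G f) {u : V}
    (hu : G.Adj u (f 0)) (hn : ∀ n, f n ≠ u) :
    IsRay G (fun n => Nat.casesOn n u f) := by
  refine ⟨?_, ?_⟩
  · rintro (_ | a) (_ | b) h
    · rfl
    · exact absurd h.symm (hn b)
    · exact absurd h (hn a)
    · exact congrArg _ (hf.1 h)
  · rintro (_ | n)
    · exact hu
    · exact hf.2 n

/-- A path ending at the first vertex of a ray can be put in front of the ray. -/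
theorem _root_.IsRay.prepend {G : SimpleGraph V} {u v : V} (p : G.Walk u v) (hp : p.IsPath) {f : ℕ → V}
    (hf : IsRay G f) (h0 : f 0 = v) (hd : ∀ n, f n ∈ p.support → f n = v) :
    ∃ g : ℕ → V, IsRay G g ∧ g 0 = u ∧ (∀ n, g (p.length + n) = f n) ∧
      ∀ n, g n ∈ p.support ∨ ∃ m, g n = f m := by
  induction p with
  | nil => exact ⟨f, hf, h0, fun n => by simp, fun n => Or.inr ⟨n, rfl⟩⟩
  | @cons u x v h p ih =>
    rw [Walk.cons_isPath_iff] at hp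
    obtain ⟨g, hg, hg0, hgt, hgs⟩ := ih hp.1 h0 fun n hn => hd n (by simp [hn])
    have hne : ∀ n, g n ≠ u := by
      intro n hn
      rcases hgs n with h1 | ⟨m, h1⟩
      · exact hp.2 (hn ▸ h1)
      · have := hd m (by rw [← h1, hn]; simp)
        rw [← h1, hn] at this
        subst this
        exact hp.2 (by simp)
    refine ⟨_, hg.cons (hg0 ▸ h) hne, rfl, ?_, ?_⟩
    · intro n
      have : (Walk.cons h p).length + n = (p.length + n) + 1 := by simp; omega
      rw [this]
      exact hgt n
    · rintro (_ | n)
      · left; simp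
      · rcases hgs n with h1 | h1
        · left; simp [h1]
        · right; exact h1

theorem isDoubleRay_glue {G : SimpleGraph V} {f g : ℕ → V} (hf : IsRay G f) (hg : IsRay G g)
    (hd : ∀ m n, f m ≠ g n) (h : G.Adj (f 0) (g 0)) : ∃ d, IsDoubleRay G d := by
  refine ⟨fun n => Int.casesOn n (fun n => g n) (fun n => f n), ?_, ?_⟩
  · rintro (a | a) (b | b) h
    · exact congrArg _ (hg.1 h)
    · exact absurd h.symm (hd b a)
    · exact absurd h (hd a b)
    · exact congrArg _ (hf.1 h)
  · rintro (a | a)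
    · exact hg.2 a
    · rcases a with _ | a
      · exact h
      · exact (hf.2 a).symm

/-! ### Shortest walks between sets -/

theorem exists_path_between (H : SimpleGraph V) {A B : Set V} {a b : V} (ha : a ∈ A) (hb : b ∈ B)
    (h : H.Reachable a b) :
    ∃ a' ∈ A, ∃ b' ∈ B, ∃ p : H.Walk a' b', p.IsPath ∧ (∀ v ∈ p.support, v ∈ A → v = a') ∧
      ∀ v ∈ p.support, v ∈ B → v = b' := by
  classical
  have hex : ∃ n, ∃ a' ∈ A, ∃ b' ∈ B, ∃ p : H.Walk a' b', p.length = n := by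
    obtain ⟨p⟩ := h
    exact ⟨_, a, ha, b, hb, p, rfl⟩
  obtain ⟨a', ha', b', hb', p, hp⟩ := Nat.find_spec hex
  have hmin : ∀ x ∈ A, ∀ y ∈ B, ∀ q : H.Walk x y, p.length ≤ q.length := by
    intro x hx y hy q
    rw [hp]
    exact Nat.find_min' hex ⟨x, hx, y, hy, q, rfl⟩
  refine ⟨a', ha', b', hb', p.bypass, p.bypass_isPath, ?_, ?_⟩
  · intro v hv hvA
    have hv := p.support_bypass_subset_support hv
    have h1 := hmin v hvA b' hb' (p.dropUntil v hv)
    have h2 := congrArg Walk.length (p.take_spec hv)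
    rw [Walk.length_append] at h2
    exact (Walk.eq_of_length_eq_zero (p := p.takeUntil v hv) (by omega)).symm
  · intro v hv hvB
    have hv := p.support_bypass_subset_support hv
    have h1 := hmin a' ha' v hvB (p.takeUntil v hv)
    have h2 := congrArg Walk.length (p.take_spec hv)
    rw [Walk.length_append] at h2
    exact (Walk.eq_of_length_eq_zero (p := p.dropUntil v hv) (by omega))

theorem exists_doubleRay_of_rays {H : SimpleGraph V} {f g : ℕ → V} (hf : IsRay H f)
    (hg : IsRay H g) (hd : ∀ m n, f m ≠ g n) (h : H.Reachable (f 0) (g 0)) :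
    ∃ d, IsDoubleRay H d := by
  obtain ⟨a, ⟨s, rfl⟩, b, ⟨t, rfl⟩, p, hp, h1, h2⟩ :=
    exists_path_between H (A := Set.range f) (B := Set.range g) ⟨0, rfl⟩ ⟨0, rfl⟩ h
  generalize hx : f s = x at p h1 h2
  cases p with
  | nil => exact absurd hx (hd _ _)
  | @cons _ y _ hxy p =>
    rw [Walk.cons_isPath_iff] at hp
    obtain ⟨β, hβ, hβ0, -, hβs⟩ := (hg.tail t).prepend p hp.1 rfl fun n hn =>
      h2 _ (by simp [hn]) ⟨_, rfl⟩
    refine isDoubleRay_glue (hf.tail s) hβ ?_ (by simpa [hβ0, hx] using hxy)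
    intro m n hmn
    rcases hβs n with h3 | ⟨k, h3⟩
    · rw [← hmn] at h3
      have := h1 _ (List.mem_cons_of_mem _ h3) ⟨_, rfl⟩
      exact hp.2 (this ▸ h3)
    · exact hd _ _ (hmn.trans h3)

theorem hasInf_of_disjoint {G : SimpleGraph V} (H : ℕ → SimpleGraph V) (hle : ∀ i, H i ≤ G)
    (hd : Pairwise fun i j => Disjoint (H i) (H j)) (hr : ∀ i, ∃ d, IsDoubleRay (H i) d) :
    HasInf G := by
  choose F hF using hr
  refine ⟨F, fun i => ⟨(hF i).1, fun n => hle i ((hF i).2 n)⟩, fun i j hij => ?_⟩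
  have hsub : ∀ i, drEdges (F i) ⊆ (H i).edgeSet := by
    rintro i e ⟨n, rfl⟩
    exact (hF i).2 n
  exact ((disjoint_edgeSet).2 (hd hij)).mono (hsub i) (hsub j)

/-! ### Rays in locally finite graphs -/

theorem exists_ray_of_locallyFinite (H : SimpleGraph V) (hlf : ∀ v, {w | H.Adj v w}.Finite) (z : V)
    (hz : {v | H.Reachable z v}.Infinite) : ∃ f, IsRay H f ∧ f 0 = z := by
  let Desc : V → Set V := fun v => {w | H.Reachable v w ∧ H.dist z w = H.dist z v + H.dist v w}
  have step : ∀ v, (H.Reachable z v ∧ (Desc v).Infinite) →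
      ∃ w, (H.Reachable z w ∧ (Desc w).Infinite) ∧ H.Adj v w ∧ H.dist z w = H.dist z v + 1 := by
    rintro v ⟨hzv, hv⟩
    by_contra! hcon
    apply hv
    let N : Set V := {x | H.Adj v x ∧ H.dist z x = H.dist z v + 1}
    have hN : N.Finite := (hlf v).subset fun x hx => hx.1
    have hfin : ∀ x ∈ N, (Desc x).Finite := by
      intro x hx
      by_contra h
      exact hcon x ⟨hzv.trans hx.1.reachable, h⟩ hx.1 hx.2
    refine ((hN.biUnion hfin).union (Set.finite_singleton v)).subset ?_
    rintro w ⟨hw, hdw⟩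
    obtain ⟨p, hp⟩ := hw.exists_walk_length_eq_dist
    cases p with
    | nil => right; rfl
    | @cons _ x _ hvx q =>
      left
      have h1 : H.dist x w ≤ q.length := dist_le q
      have h2 : H.dist z x ≤ H.dist z v + 1 := by
        obtain ⟨p', hp'⟩ := hzv.exists_walk_length_eq_dist
        have := dist_le (p'.concat hvx)
        rw [Walk.length_concat] at this
        omega
      have h3 : H.dist z w ≤ H.dist z x + H.dist x w := by
        obtain ⟨p', hp'⟩ := (hzv.trans hvx.reachable).exists_walk_length_eq_dist
        obtain ⟨q', hq'⟩ := (q.reachable).exists_walk_length_eq_dist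
        have := dist_le (p'.append q')
        rw [Walk.length_append] at this
        omega
      rw [Walk.length_cons] at hp
      simp only [Set.mem_iUnion]
      exact ⟨x, ⟨hvx, by omega⟩, q.reachable, by omega⟩
  have h0 : H.Reachable z z ∧ (Desc z).Infinite := by
    refine ⟨Reachable.refl _, hz.mono fun w hw => ⟨hw, ?_⟩⟩
    simp
  obtain ⟨f, hf0, -, hf⟩ := exists_seq_of_step (fun _ v => H.Reachable z v ∧ (Desc v).Infinite)
    (fun _ v w => H.Adj v w ∧ H.dist z w = H.dist z v + 1) h0 (fun _ => step)
  have hdist : ∀ n, H.dist z (f n) = n := by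
    intro n
    induction n with
    | zero => rw [hf0]; simp
    | succ n ih => rw [(hf n).2, ih]
  exact ⟨f, ⟨fun a b h => by rw [← hdist a, ← hdist b, h], fun n => (hf n).1⟩, hf0⟩

theorem exists_ray_iSup (C : ℕ → SimpleGraph V) (hfin : ∀ i, (C i).edgeSet.Finite)
    (hv : ∀ v, {i | ∃ w, (C i).Adj v w}.Finite) {z : V}
    (hz : {v | (⨆ i, C i).Reachable z v}.Infinite) :
    ∃ f, IsRay (⨆ i, C i) f ∧ f 0 = z ∧ ∀ I, ∃ N, ∀ n ≥ N, ∃ i ≥ I, (C i).Adj (f n) (f (n + 1)) := by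
  have hnb : ∀ i v, {w | (C i).Adj v w}.Finite := by
    intro i v
    refine Set.Finite.of_finite_image (f := fun w => s(v, w)) ((hfin i).subset ?_) ?_
    · rintro e ⟨w, hw, rfl⟩
      exact hw
    · intro a _ b _ h
      exact Sym2.congr_right.1 h
  obtain ⟨f, hf, hf0⟩ := exists_ray_of_locallyFinite (⨆ i, C i) (fun v => by
    refine ((hv v).biUnion fun i _ => hnb i v).subset ?_
    intro w hw
    simp only [Set.mem_ofPred_eq, iSup_adj] at hw
    obtain ⟨i, hi⟩ := hw
    simp only [Set.mem_iUnion]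
    exact ⟨i, ⟨w, hi⟩, hi⟩) z hz
  refine ⟨f, hf, hf0, fun I => ?_⟩
  have hfinI : {n | ∃ i < I, (C i).Adj (f n) (f (n + 1))}.Finite := by
    have h1 : (⋃ i ∈ Set.Iio I, (C i).edgeSet).Finite :=
      (Set.finite_Iio I).biUnion fun i _ => hfin i
    refine Set.Finite.of_finite_image (f := fun n => s(f n, f (n + 1))) (h1.subset ?_) ?_
    · rintro e ⟨n, ⟨i, hi, h⟩, rfl⟩
      simp only [Set.mem_iUnion]
      exact ⟨i, hi, h⟩
    · intro a _ b _ h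
      simp only [Sym2.eq_iff] at h
      rcases h with h | h
      · exact hf.1 h.1
      · have h1 := hf.1 h.1
        have h2 := hf.1 h.2
        omega
  obtain ⟨N, hN⟩ := hfinI.bddAbove
  refine ⟨N + 1, fun n hn => ?_⟩
  have := hf.2 n
  rw [iSup_adj] at this
  obtain ⟨i, hi⟩ := this
  refine ⟨i, ?_, hi⟩
  by_contra hlt
  have := hN ⟨i, not_le.1 hlt, hi⟩
  omega

theorem exists_ray_of_chain (C : ℕ → SimpleGraph V) (hfin : ∀ i, (C i).edgeSet.Finite)
    (hv : ∀ v, {i | ∃ w, (C i).Adj v w}.Finite) (u : ℕ → V)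
    (hu : ∀ i, (C i).Reachable (u i) (u (i + 1))) (hinf : (Set.range u).Infinite) :
    ∃ f, IsRay (⨆ i, C i) f ∧ f 0 = u 0 ∧
      ∀ I, ∃ N, ∀ n ≥ N, ∃ i ≥ I, (C i).Adj (f n) (f (n + 1)) := by
  refine exists_ray_iSup C hfin hv (hinf.mono ?_)
  rintro _ ⟨n, rfl⟩
  induction n with
  | zero => exact Reachable.refl _
  | succ n ih => exact ih.trans ((hu n).mono (le_iSup C n))

/-! ### Greedy choice of edge-disjoint finite graphs -/

theorem exists_disjoint_seq (Task : ℕ → SimpleGraph V → Prop)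
    (h : ∀ n, ∀ F : Set (Sym2 V), F.Finite →
      ∃ C, Task n C ∧ C.edgeSet.Finite ∧ Disjoint C.edgeSet F) :
    ∃ C : ℕ → SimpleGraph V, (∀ n, Task n (C n)) ∧ (∀ n, (C n).edgeSet.Finite) ∧
      Pairwise fun i j => Disjoint (C i) (C j) := by
  obtain ⟨C, hC⟩ := exists_seq_of_history (fun (l : List (SimpleGraph V)) C =>
    (∀ D ∈ l, D.edgeSet.Finite) → Task l.length C ∧ C.edgeSet.Finite ∧ ∀ D ∈ l, Disjoint C D) (by
    intro l
    by_cases hl : ∀ D ∈ l, D.edgeSet.Finite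
    · obtain ⟨C, h1, h2, h3⟩ := h l.length (⋃ D ∈ {D | D ∈ l}, D.edgeSet)
        (l.finite_toSet.biUnion hl)
      refine ⟨C, fun _ => ⟨h1, h2, fun D hD => ?_⟩⟩
      rw [← disjoint_edgeSet]
      exact h3.mono_right (Set.subset_biUnion_of_mem (u := fun D : SimpleGraph V => D.edgeSet) hD)
    · exact ⟨⊥, fun h => absurd h hl⟩)
  have hfin : ∀ n, (C n).edgeSet.Finite := by
    intro n
    induction n using Nat.strong_induction_on with
    | _ n ih =>
      refine (hC n ?_).2.1
      intro D hD
      simp only [List.mem_map, List.mem_range] at hD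
      obtain ⟨m, hm, rfl⟩ := hD
      exact ih m hm
  have hC' := fun n => hC n (by
    intro D hD
    simp only [List.mem_map, List.mem_range] at hD
    obtain ⟨m, hm, rfl⟩ := hD
    exact hfin m)
  refine ⟨C, fun n => by simpa using (hC' n).1, hfin, ?_⟩
  intro i j hij
  rcases lt_or_gt_of_ne hij with hlt | hlt
  · exact ((hC' j).2.2 (C i) (List.mem_map.2 ⟨i, List.mem_range.2 hlt, rfl⟩)).symm
  · exact ((hC' i).2.2 (C j) (List.mem_map.2 ⟨j, List.mem_range.2 hlt, rfl⟩))

theorem exists_disjoint_family {ι : Type*} [Encodable ι] (Task : ι → SimpleGraph V → Prop)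
    (h : ∀ t, ∀ F : Set (Sym2 V), F.Finite →
      ∃ C, Task t C ∧ C.edgeSet.Finite ∧ Disjoint C.edgeSet F) :
    ∃ C : ι → SimpleGraph V, (∀ t, Task t (C t)) ∧ (∀ t, (C t).edgeSet.Finite) ∧
      Pairwise fun i j => Disjoint (C i) (C j) := by
  obtain ⟨C, h1, h2, h3⟩ := exists_disjoint_seq
    (fun n C => ∀ t : ι, Encodable.encode t = n → Task t C) (by
    intro n F hF
    by_cases hn : ∃ t : ι, Encodable.encode t = n
    · obtain ⟨t, rfl⟩ := hn
      obtain ⟨C, hC⟩ := h t F hF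
      refine ⟨C, ?_, hC.2⟩
      intro t' ht'
      rw [Encodable.encode_injective ht']
      exact hC.1
    · refine ⟨⊥, fun t ht => absurd ⟨t, ht⟩ hn, by simp, by simp⟩)
  exact ⟨fun t => C (Encodable.encode t), fun t => h1 _ t rfl, fun t => h2 _,
    fun i j hij => h3 (Encodable.encode_injective.ne hij)⟩

/-! ### Walks inside vertex sets -/

theorem reachable_induct {H : SimpleGraph V} {P : V → Prop} {a b : V} (h : H.Reachable a b)
    (ha : P a) (hs : ∀ x y, H.Adj x y → P x → P y) : P b := by
  obtain ⟨p⟩ := h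
  induction p with
  | nil => exact ha
  | cons h p ih => exact ih (hs _ _ h ha)

theorem reachable_restr_of_walk {H : SimpleGraph V} {a b : V} (p : H.Walk a b) {X : Set V}
    (hX : ∀ v ∈ p.support, v ∈ X) : (restr H X).Reachable a b := by
  induction p with
  | nil => exact Reachable.refl _
  | @cons a c b h p ih =>
    have : (restr H X).Adj a c := ⟨h, hX _ (by simp), hX _ (by simp)⟩
    exact this.reachable.trans (ih fun v hv => hX v (by simp [hv]))

theorem reachable_restr_support {H : SimpleGraph V} {a b : V} (p : H.Walk a b) {X : Set V}
    (hX : ∀ v ∈ p.support, v ∈ X) {v : V} (hv : v ∈ p.support) : (restr H X).Reachable a v := by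
  classical
  exact reachable_restr_of_walk (p.takeUntil v hv)
    fun w hw => hX w (p.support_takeUntil_subset_support hv hw)

theorem mem_of_reachable_restr {H : SimpleGraph V} {X : Set V} {a b : V}
    (h : (restr H X).Reachable a b) (ha : a ∈ X) : b ∈ X :=
  reachable_induct h ha fun _ _ h _ => h.2.2

theorem support_subset_restr {H : SimpleGraph V} {X : Set V} {a b : V}
    (p : (restr H X).Walk a b) (ha : a ∈ X) : ∀ v ∈ p.support, v ∈ X := by
  classical
  exact fun v hv => mem_of_reachable_restr (p.takeUntil v hv).reachable ha

theorem ray_reachable {G : SimpleGraph V} {f : ℕ → V} (hf : IsRay G f) {X : Set V} {s t : ℕ}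
    (hst : s ≤ t) (hX : ∀ n, s ≤ n → n ≤ t → f n ∈ X) : (restr G X).Reachable (f s) (f t) := by
  induction t, hst using Nat.le_induction with
  | base => exact Reachable.refl _
  | succ t hst ih =>
    have : (restr G X).Adj (f t) (f (t + 1)) :=
      ⟨hf.2 t, hX _ hst (by omega), hX _ (by omega) le_rfl⟩
    exact (ih fun n h1 h2 => hX n h1 (by omega)).trans this.reachable

theorem _root_.IsRay.restr {G : SimpleGraph V} {f : ℕ → V} (hf : IsRay G f) {X : Set V}
    (hX : ∀ n, f n ∈ X) : IsRay (restr G X) f :=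
  ⟨hf.1, fun n => ⟨hf.2 n, hX _, hX _⟩⟩

theorem _root_.IsRay.eventually_notMem {G : SimpleGraph V} {f : ℕ → V} (hf : IsRay G f) {S : Set V}
    (hS : S.Finite) : ∃ N, ∀ n ≥ N, f n ∉ S := by
  have : {n | f n ∈ S}.Finite := hS.preimage hf.1.injOn
  obtain ⟨N, hN⟩ := this.bddAbove
  refine ⟨N + 1, fun n hn h => ?_⟩
  have := hN (show n ∈ {n | f n ∈ S} from h)
  omega

theorem disjoint_restr {G : SimpleGraph V} {X Y : Set V} (h : Disjoint X Y) :
    Disjoint (restr G X) (restr G Y) := by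
  rw [SimpleGraph.disjoint_left]
  exact fun a b h1 h2 => Set.disjoint_left.1 h h1.2.1 h2.2.1

/-! ### Directions -/

/-- A direction chooses, for every finite vertex set, a component of its complement, in a
consistent way. -/
structure Dir (G : SimpleGraph V) where
  /-- the chosen component -/
  ω : Set V → Set V
  disj : ∀ {S v}, v ∈ ω S → v ∉ S
  closed : ∀ {S v w}, v ∈ ω S → G.Adj v w → w ∉ S → w ∈ ω S
  conn : ∀ {S v w}, v ∈ ω S → w ∈ ω S → (restr G (ω S)).Reachable v w
  anti : ∀ {S T}, S ⊆ T → ω T ⊆ ω S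
  nonempty : ∀ {S}, S.Finite → (ω S).Nonempty

variable {G : SimpleGraph V}

namespace Dir

variable (d : Dir G)

/-- A sequence converges to a direction if it is eventually in each of its components. -/
def Conv (f : ℕ → V) : Prop := ∀ S : Set V, S.Finite → ∃ N, ∀ n ≥ N, f n ∈ d.ω S

/-- The vertices dominating a direction. -/
def Δ : Set V := {v | ∀ S : Set V, S.Finite → v ∉ S → v ∈ d.ω S}

variable {d}

theorem Conv.tail {f : ℕ → V} (hf : d.Conv f) (s : ℕ) : d.Conv fun n => f (s + n) := by
  intro S hS
  obtain ⟨N, hN⟩ := hf S hS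
  exact ⟨N, fun n hn => hN _ (by omega)⟩

theorem sub {S S' : Set V} (hS : S.Finite) (hS' : S'.Finite) (h : ∀ v ∈ d.ω S, v ∉ S') :
    d.ω S ⊆ d.ω S' := by
  obtain ⟨x, hx⟩ := d.nonempty (hS.union hS')
  intro y hy
  exact reachable_induct (d.conn (d.anti Set.subset_union_left hx) hy)
    (d.anti Set.subset_union_right hx) fun a b hab ha => d.closed ha hab.1 (h _ hab.2.2)

theorem exists_adj {S : Set V} (hS : S.Finite) {v : V} (hvω : v ∈ d.ω (S \ {v})) :
    ∃ w ∈ d.ω S, G.Adj v w := by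
  by_contra! hcon
  obtain ⟨x, hx⟩ := d.nonempty (hS.union (Set.finite_singleton v))
  have : v ∈ d.ω (S ∪ {v}) := by
    refine reachable_induct (d.conn (d.anti (by intro y hy; exact Or.inl hy.1) hx) hvω) hx ?_
    intro a b hab ha
    by_cases hb : b = v
    · subst hb
      exact absurd hab.1.symm (hcon a (d.anti Set.subset_union_left ha))
    · refine d.closed ha hab.1 ?_
      rintro (h | h)
      · exact d.disj hab.2.2 ⟨h, hb⟩
      · exact hb h
  exact d.disj this (Or.inr rfl)

theorem mem_of_reachable {S L : Set V} {v w : V} (hv : v ∈ d.ω S) (hL : Disjoint L S)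
    (h : (restr G L).Reachable v w) : w ∈ d.ω S :=
  reachable_induct h hv fun _ _ hab ha => d.closed ha hab.1 (Set.disjoint_left.1 hL hab.2.2)

theorem ray_dichotomy {f : ℕ → V} (hf : IsRay G f) {S : Set V} (hS : S.Finite) :
    (∃ N, ∀ n ≥ N, f n ∈ d.ω S) ∨ ∃ N, ∀ n ≥ N, f n ∉ d.ω S := by
  obtain ⟨N, hN⟩ := hf.eventually_notMem hS
  by_cases h : ∃ n ≥ N, f n ∈ d.ω S
  · obtain ⟨n, hn, hfn⟩ := h
    refine Or.inl ⟨n, fun m hm => ?_⟩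
    induction m, hm using Nat.le_induction with
    | base => exact hfn
    | succ m hm ih => exact d.closed ih (hf.2 m) (hN _ (by omega))
  · push Not at h
    exact Or.inr ⟨N, h⟩

/-- In a direction all of whose components contain a ray of another end there are infinitely
many disjoint double rays. -/
theorem hasInf_of_not_conv
    (h : ∀ S : Set V, S.Finite → ∃ f, IsRay G f ∧ (∀ n, f n ∈ d.ω S) ∧ ¬ d.Conv f) :
    HasInf G := by
  have key : ∀ S : Set V, S.Finite → ∃ f T, IsRay G f ∧ (∀ n, f n ∈ d.ω S) ∧ T.Finite ∧
      ∀ n, f n ∉ d.ω T := by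
    intro S hS
    obtain ⟨f, hf, hfS, hc⟩ := h S hS
    simp only [Conv, not_forall] at hc
    obtain ⟨T, hT, hc⟩ := hc
    rcases ray_dichotomy (d := d) hf hT with h1 | ⟨N, hN⟩
    · exact absurd h1 hc
    · exact ⟨_, T, hf.tail N, fun n => hfS _, hT, fun n => hN _ (by omega)⟩
  have step : ∀ S : Set V, S.Finite → ∃ T : Set V, T.Finite ∧
      (S ⊆ T ∧ ∃ f, IsDoubleRay (restr G (d.ω S \ d.ω T)) f) := by
    intro S hS
    obtain ⟨f, A, hf, hfS, hA, hfA⟩ := key S hS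
    obtain ⟨g, B, hg, hgS, hB, hgB⟩ := key (S ∪ A) (hS.union hA)
    have hgS' : ∀ n, g n ∈ d.ω S := fun n => d.anti Set.subset_union_left (hgS n)
    obtain ⟨p⟩ := d.conn (hfS 0) (hgS' 0)
    let T : Set V := S ∪ A ∪ B ∪ {v | v ∈ p.support}
    refine ⟨T, ((hS.union hA).union hB).union p.support.finite_toSet,
      fun v hv => Or.inl (Or.inl (Or.inl hv)), ?_⟩
    have hf' : ∀ n, f n ∈ d.ω S \ d.ω T := fun n =>
      ⟨hfS n, fun h => hfA n (d.anti (fun v hv => Or.inl (Or.inl (Or.inr hv))) h)⟩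
    have hg' : ∀ n, g n ∈ d.ω S \ d.ω T := fun n =>
      ⟨hgS' n, fun h => hgB n (d.anti (fun v hv => Or.inl (Or.inr hv)) h)⟩
    refine exists_doubleRay_of_rays (hf.restr hf') (hg.restr hg') ?_ ?_
    · intro m n hmn
      exact hfA m (hmn ▸ d.anti Set.subset_union_right (hgS n))
    · refine (reachable_restr_of_walk p (X := d.ω S \ d.ω T) fun v hv =>
        ⟨support_subset_restr p (hfS 0) v hv, fun h => d.disj h (Or.inr hv)⟩).mono ?_
      exact restr_mono (restr_le _ _) le_rfl
  obtain ⟨S, -, -, hS⟩ := exists_seq_of_step (fun _ (S : Set V) => S.Finite)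
    (fun _ S T => S ⊆ T ∧ ∃ f, IsDoubleRay (restr G (d.ω S \ d.ω T)) f)
    (Set.finite_empty (α := V)) fun _ => step
  have hmono : Monotone S := monotone_nat_of_le_succ fun n => (hS n).1
  refine hasInf_of_disjoint (fun n => restr G (d.ω (S n) \ d.ω (S (n + 1))))
    (fun n => restr_le _ _) ?_ fun n => (hS n).2
  have hlt : ∀ m n, m < n → Disjoint (d.ω (S m) \ d.ω (S (m + 1)))
      (d.ω (S n) \ d.ω (S (n + 1))) := by
    intro m n hmn
    rw [Set.disjoint_left]
    exact fun v hv hv' => hv.2 (d.anti (hmono hmn) hv'.1)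
  intro m n hmn
  rcases lt_or_gt_of_ne hmn with h | h
  · exact disjoint_restr (hlt m n h)
  · exact disjoint_restr (hlt n m h).symm

/-! ### Infinitely many disjoint rays of one end -/

theorem hasInf_of_pairing {Q : ℕ → ℕ → V} (hQ : ∀ i, IsRay G (Q i))
    (hd : ∀ i j m n, i ≠ j → Q i m ≠ Q j n) (I : Set ℕ)
    (h : ∀ (M : Set ℕ) (F : Set V), M.Finite → F.Finite → ∃ (n n' : ℕ) (Z : Set V), n ≠ n' ∧
      n ∉ M ∧ n' ∉ M ∧ n ∉ I ∧ n' ∉ I ∧ Z.Finite ∧ Disjoint Z F ∧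
      (∀ m, m ∉ I → m ≠ n → m ≠ n' → ∀ t, Q m t ∉ Z) ∧
      (restr G (Set.range (Q n) ∪ Set.range (Q n') ∪ Z)).Reachable (Q n 0) (Q n' 0)) :
    HasInf G := by
  let X : ℕ × ℕ × Set V → Set V := fun x => Set.range (Q x.1) ∪ Set.range (Q x.2.1) ∪ x.2.2
  let P : ℕ × ℕ × Set V → Prop := fun x => x.1 ≠ x.2.1 ∧ x.1 ∉ I ∧ x.2.1 ∉ I ∧ x.2.2.Finite ∧
    (∀ m, m ∉ I → m ≠ x.1 → m ≠ x.2.1 → ∀ t, Q m t ∉ x.2.2) ∧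
    (restr G (X x)).Reachable (Q x.1 0) (Q x.2.1 0)
  let r : ℕ × ℕ × Set V → ℕ × ℕ × Set V → Prop := fun x y =>
    y.1 ≠ x.1 ∧ y.1 ≠ x.2.1 ∧ y.2.1 ≠ x.1 ∧ y.2.1 ≠ x.2.1 ∧ Disjoint y.2.2 x.2.2
  obtain ⟨f, hP, hr⟩ := exists_seq_of_forall_finset_exists P r (by
    intro s hs
    obtain ⟨n, n', Z, h1, h2, h2', h3, h3', h4, h5, h6, h7⟩ :=
      h (⋃ x ∈ (s : Set (ℕ × ℕ × Set V)), {x.1, x.2.1}) (⋃ x ∈ (s : Set (ℕ × ℕ × Set V)), x.2.2)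
        (s.finite_toSet.biUnion fun x _ => by simp)
        (s.finite_toSet.biUnion fun x hx => (hs x hx).2.2.2.1)
    simp only [Set.mem_iUnion, not_exists, Set.mem_insert_iff, Set.mem_singleton_iff, not_or]
      at h2 h2'
    refine ⟨(n, n', Z), ⟨h1, h3, h3', h4, h6, h7⟩, fun x hx => ⟨(h2 x hx).1, (h2 x hx).2,
      (h2' x hx).1, (h2' x hx).2, h5.mono_right ?_⟩⟩
    exact Set.subset_biUnion_of_mem (u := fun x : ℕ × ℕ × Set V => x.2.2) hx)
  have hX : ∀ x y, P x → P y → r x y → Disjoint (X x) (X y) := by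
    rintro ⟨n, n', Z⟩ ⟨m, m', Z'⟩ ⟨-, a2, a3, -, a5, -⟩ ⟨-, b2, b3, -, b5, -⟩ ⟨r1, r2, r3, r4, r5⟩
    dsimp only at *
    rw [Set.disjoint_left]
    rintro v ((⟨t, rfl⟩ | ⟨t, rfl⟩) | hv) ((⟨t', ht⟩ | ⟨t', ht⟩) | hv')
    · exact hd _ _ _ _ r1 ht
    · exact hd _ _ _ _ r3 ht
    · exact b5 n a2 r1.symm r3.symm t hv'
    · exact hd _ _ _ _ r2 ht
    · exact hd _ _ _ _ r4 ht
    · exact b5 n' a3 r2.symm r4.symm t hv'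
    · exact a5 m b2 r1 r2 t' (ht ▸ hv)
    · exact a5 m' b3 r3 r4 t' (ht ▸ hv)
    · exact Set.disjoint_left.1 r5 hv' hv
  refine hasInf_of_disjoint (fun k => restr G (X (f k))) (fun _ => restr_le _ _) ?_ ?_
  · intro a b hab
    rcases lt_or_gt_of_ne hab with hlt | hlt
    · exact disjoint_restr (hX _ _ (hP _) (hP _) (hr _ _ hlt))
    · exact disjoint_restr (hX _ _ (hP _) (hP _) (hr _ _ hlt)).symm
  · intro k
    refine exists_doubleRay_of_rays ((hQ (f k).1).restr fun n => Or.inl (Or.inl ⟨n, rfl⟩))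
      ((hQ (f k).2.1).restr fun n => Or.inl (Or.inr ⟨n, rfl⟩))
      (fun m n => hd _ _ _ _ (hP k).1) (hP k).2.2.2.2.2

/-- Two members of a family of rays are linked outside `F`. -/
def Link (G : SimpleGraph V) (Q : ℕ → ℕ → V) (i n : ℕ) (F : Set V) : Prop :=
  ∃ L : Set V, L.Finite ∧ Disjoint L F ∧ (∀ m, m ≠ i → m ≠ n → ∀ t, Q m t ∉ L) ∧
    ∃ a b, Q i a ∈ L ∧ Q n b ∈ L ∧ (restr G L).Reachable (Q i a) (Q n b)

theorem Link.symm {Q : ℕ → ℕ → V} {i n : ℕ} {F : Set V} (h : Link G Q i n F) : Link G Q n i F := by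
  obtain ⟨L, h1, h2, h3, a, b, h4, h5, h6⟩ := h
  exact ⟨L, h1, h2, fun m hm hm' => h3 m hm' hm, b, a, h5, h4, h6.symm⟩

theorem Link.anti {Q : ℕ → ℕ → V} {i n : ℕ} {F F' : Set V} (hF : F ⊆ F') (h : Link G Q i n F') :
    Link G Q i n F := by
  obtain ⟨L, h1, h2, h3⟩ := h
  exact ⟨L, h1, h2.mono_right hF, h3⟩

theorem exists_link {Q : ℕ → ℕ → V} (hd : ∀ i j m n, i ≠ j → Q i m ≠ Q j n)
    (hc : ∀ i, d.Conv (Q i)) (i : ℕ) {F : Set V} (hF : F.Finite) :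
    ∃ n, n ≠ i ∧ Link G Q i n F := by
  obtain ⟨s, hs⟩ := hc i F hF
  obtain ⟨t, ht⟩ := hc (i + 1) F hF
  obtain ⟨a, ⟨⟨a', rfl⟩, ha⟩, b, ⟨⟨n, b'⟩, hn, rfl⟩, p, -, -, h2⟩ :=
    exists_path_between (restr G (d.ω F)) (A := Set.range (Q i) ∩ d.ω F)
      (B := (fun x : ℕ × ℕ => Q x.1 x.2) '' {x | x.1 ≠ i})
      ⟨⟨s, rfl⟩, hs s le_rfl⟩ ⟨(i + 1, t), by simp, rfl⟩ (d.conn (hs s le_rfl) (ht t le_rfl))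
  rw [Set.mem_ofPred_eq] at hn
  dsimp only at hn p h2
  refine ⟨n, hn, {v | v ∈ p.support}, p.support.finite_toSet, ?_, ?_, a', b', by simp,
    by simp, (reachable_restr_of_walk p fun v hv => hv).mono (restr_mono (restr_le _ _) le_rfl)⟩
  · rw [Set.disjoint_left]
    exact fun v hv => d.disj (support_subset_restr p ha v hv)
  · intro m hm hm' t' hmt
    exact hd _ _ _ _ hm' (h2 _ hmt ⟨(m, t'), hm, rfl⟩)

/-- Infinitely many disjoint rays of one end yield infinitely many disjoint double rays. -/
theorem hasInf_of_disjoint_rays {Q : ℕ → ℕ → V} (hQ : ∀ i, IsRay G (Q i))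
    (hd : ∀ i j m n, i ≠ j → Q i m ≠ Q j n) (hc : ∀ i, d.Conv (Q i)) : HasInf G := by
  by_cases hA : ∃ i, ∀ F : Set V, F.Finite → {n | n ≠ i ∧ Link G Q i n F}.Infinite
  · obtain ⟨i, hi⟩ := hA
    refine hasInf_of_pairing hQ hd {i} fun M F hM hF => ?_
    obtain ⟨T, hT⟩ := (hQ i).eventually_notMem hF
    have hF' : (F ∪ Q i '' Set.Iio T).Finite := hF.union ((Set.finite_Iio T).image _)
    obtain ⟨n, ⟨hni, L, hL, hLF, hLQ, a, b, ha, hb, hab⟩, hnM⟩ := (hi _ hF').exists_notMem_finite hM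
    obtain ⟨n', ⟨hni', L', hL', hLF', hLQ', a', b', ha', hb', hab'⟩, hnM'⟩ :=
      (hi _ hF').exists_notMem_finite (hM.union (Set.finite_singleton n))
    rw [Set.mem_union, not_or] at hnM'
    have hT1 : ∀ a L, Disjoint L (F ∪ Q i '' Set.Iio T) → Q i a ∈ L → T ≤ a := by
      intro a L hL ha
      by_contra hlt
      exact Set.disjoint_left.1 hL ha (Or.inr ⟨a, not_le.1 hlt, rfl⟩)
    have haT := hT1 _ _ hLF ha
    have haT' := hT1 _ _ hLF' ha'
    let Sg : Set V := Q i '' Set.Icc T (max a a')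
    refine ⟨n, n', L ∪ L' ∪ Sg, fun h => hnM'.2 h.symm, hnM, hnM'.1, hni, hni',
      (hL.union hL').union ((Set.finite_Icc _ _).image _), ?_, ?_, ?_⟩
    · rw [Set.disjoint_left]
      rintro v ((hv | hv) | ⟨t, ht, rfl⟩) hvF
      · exact Set.disjoint_left.1 hLF hv (Or.inl hvF)
      · exact Set.disjoint_left.1 hLF' hv (Or.inl hvF)
      · exact hT t ht.1 hvF
    · rintro m hmi hmn hmn' t ((hv | hv) | ⟨t, ht, h⟩)
      · exact hLQ m hmi hmn t hv
      · exact hLQ' m hmi hmn' t hv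
      · exact hd _ _ _ _ (fun h => hmi h.symm) h
    · have r1 := ray_reachable (hQ n) (X := Set.range (Q n) ∪ Set.range (Q n') ∪ (L ∪ L' ∪ Sg))
        (Nat.zero_le b) fun k _ _ => Or.inl (Or.inl ⟨k, rfl⟩)
      have r2 := ray_reachable (hQ n') (X := Set.range (Q n) ∪ Set.range (Q n') ∪ (L ∪ L' ∪ Sg))
        (Nat.zero_le b') fun k _ _ => Or.inl (Or.inr ⟨k, rfl⟩)
      have hseg : ∀ x, T ≤ x → x ≤ max a a' →
          (restr G (Set.range (Q n) ∪ Set.range (Q n') ∪ (L ∪ L' ∪ Sg))).Reachable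
            (Q i T) (Q i x) := fun x h1 h2 =>
        ray_reachable (hQ i) h1 fun k h3 h4 => Or.inr (Or.inr ⟨k, ⟨h3, h4.trans h2⟩, rfl⟩)
      have l1 := hab.mono (restr_mono (le_refl G) (W' := Set.range (Q n) ∪ Set.range (Q n') ∪
        (L ∪ L' ∪ Sg)) fun v hv => Or.inr (Or.inl (Or.inl hv)))
      have l2 := hab'.mono (restr_mono (le_refl G) (W' := Set.range (Q n) ∪ Set.range (Q n') ∪
        (L ∪ L' ∪ Sg)) fun v hv => Or.inr (Or.inl (Or.inr hv)))
      exact ((((r1.trans l1.symm).trans (hseg a haT (le_max_left _ _)).symm).trans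
        (hseg a' haT' (le_max_right _ _))).trans l2).trans r2.symm
  · push Not at hA
    choose F hF hN using hA
    let nb : ℕ → ℕ → Prop := fun i n => n ≠ i ∧ ∀ F : Set V, F.Finite → Link G Q i n F
    have hsymm : ∀ {i n}, nb i n → nb n i := fun h => ⟨h.1.symm, fun F hF => (h.2 F hF).symm⟩
    have hnbfin : ∀ i, {n | nb i n}.Finite := fun i =>
      (hN i).subset fun n hn => ⟨hn.1, hn.2 _ (hF i)⟩
    have hex : ∀ i, ∃ n, nb i n := by
      intro i
      by_contra! hcon
      have : ∀ n, ∃ F' : Set V, F'.Finite ∧ (n ≠ i → ¬ Link G Q i n F') := by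
        intro n
        by_cases hni : n = i
        · exact ⟨∅, Set.finite_empty, fun h => absurd hni h⟩
        · have := hcon n
          simp only [nb, not_and, not_forall] at this
          obtain ⟨F', h1, h2⟩ := this hni
          exact ⟨F', h1, fun _ => h2⟩
      choose F' hF' hF'' using this
      obtain ⟨n, hn, hl⟩ := exists_link hd hc i ((hF i).union ((hN i).biUnion fun n _ => hF' n))
      refine hF'' n hn (hl.anti fun v hv => Or.inr ?_)
      exact Set.mem_biUnion (show n ∈ {n | n ≠ i ∧ Link G Q i n (F i)} from
        ⟨hn, hl.anti Set.subset_union_left⟩) hv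
    refine hasInf_of_pairing hQ hd ∅ fun M F' hM hF' => ?_
    obtain ⟨i, hi⟩ := (hM.union (hM.biUnion fun m _ => hnbfin m)).exists_notMem
    rw [Set.mem_union, not_or] at hi
    obtain ⟨n, hn⟩ := hex i
    obtain ⟨L, hL, hLF, hLQ, a, b, ha, hb, hab⟩ := hn.2 F' hF'
    refine ⟨i, n, L, hn.1.symm, hi.1, ?_, by simp, by simp, hL, hLF, fun m _ => hLQ m, ?_⟩
    · exact fun hnM => hi.2 (Set.mem_biUnion hnM (hsymm hn))
    · have r1 := ray_reachable (hQ i) (X := Set.range (Q i) ∪ Set.range (Q n) ∪ L)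
        (Nat.zero_le a) fun k _ _ => Or.inl (Or.inl ⟨k, rfl⟩)
      have r2 := ray_reachable (hQ n) (X := Set.range (Q i) ∪ Set.range (Q n) ∪ L)
        (Nat.zero_le b) fun k _ _ => Or.inl (Or.inr ⟨k, rfl⟩)
      exact (r1.trans (hab.mono (restr_mono le_rfl Set.subset_union_right))).trans r2.symm

/-! ### Infinitely many dominating vertices -/

theorem exists_conv_ray_of_chain (L : ℕ → Set V) (hL : ∀ i, (L i).Finite)
    (hω : ∀ S : Set V, S.Finite → ∃ I, ∀ i ≥ I, L i ⊆ d.ω S) (u : ℕ → V)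
    (hu : ∀ i, (restr G (L i)).Reachable (u i) (u (i + 1))) (hinf : (Set.range u).Infinite) :
    ∃ f, IsRay G f ∧ f 0 = u 0 ∧ d.Conv f ∧ ∀ n, ∃ i, f n ∈ L i := by
  have hfin : ∀ i, (restr G (L i)).edgeSet.Finite := by
    intro i
    refine (((hL i).prod (hL i)).image fun x => s(x.1, x.2)).subset ?_
    intro e
    induction e with
    | _ a b => exact fun h => ⟨(a, b), ⟨h.2.1, h.2.2⟩, rfl⟩
  obtain ⟨f, hf, hf0, hfi⟩ := exists_ray_of_chain (fun i => restr G (L i)) hfin (by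
    intro v
    obtain ⟨I, hI⟩ := hω {v} (Set.finite_singleton v)
    refine (Set.finite_Iio I).subset ?_
    rintro i ⟨w, hw⟩
    by_contra h
    exact d.disj (hI i (not_lt.1 h) hw.2.1) rfl) u hu hinf
  refine ⟨f, hf.mono (iSup_le fun i => restr_le _ _), hf0, ?_, ?_⟩
  · intro S hS
    obtain ⟨I, hI⟩ := hω S hS
    obtain ⟨N, hN⟩ := hfi I
    refine ⟨N, fun n hn => ?_⟩
    obtain ⟨i, hi, h⟩ := hN n hn
    exact hI i hi h.2.1
  · intro n
    have := hf.2 n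
    rw [iSup_adj] at this
    obtain ⟨i, hi⟩ := this
    exact ⟨i, hi.2.1⟩

theorem exists_extension (hΔ : d.Δ.Infinite) {U : Set V} (hU : U.Finite) {x : V} (hx : x ∈ d.Δ) :
    ∃ y ∈ d.Δ, y ∉ U ∧ ∃ L : Set V, L.Finite ∧ y ∈ L ∧ (∀ v ∈ L, v ∈ U → v = x) ∧
      ∀ v ∈ L, (restr G L).Reachable x v := by
  obtain ⟨y, hy, hyU⟩ := hΔ.exists_notMem_finite hU
  have hU' : (U \ {x}).Finite := hU.sdiff
  have hxω := hx (U \ {x}) hU' (by simp)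
  obtain ⟨p⟩ := d.conn hxω (hy (U \ {x}) hU' (fun h => hyU h.1))
  refine ⟨y, hy, hyU, {v | v ∈ p.support}, p.support.finite_toSet, by simp, ?_, ?_⟩
  · intro v hv hvU
    by_contra hne
    exact d.disj (support_subset_restr p hxω v hv) ⟨hvU, hne⟩
  · intro v hv
    exact (reachable_restr_support p (fun v hv => hv) hv).mono (restr_mono (restr_le _ _) le_rfl)

theorem exists_growing_chains (hΔ : d.Δ.Infinite) :
    ∃ (X : ℕ → ℕ → Set V) (e : ℕ → ℕ → V),
      (∀ t j, (X t j).Finite) ∧ (∀ t j, j < t → e t j ∈ X t j ∧ e t j ∈ d.Δ) ∧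
      (∀ t i j, i ≠ j → Disjoint (X t i) (X t j)) ∧ (∀ t j, X t j ⊆ X (t + 1) j) ∧
      (∀ t j, j < t → (Nat.unpair t).1 = j → e (t + 1) j ∉ X t j) ∧
      ∀ t j, j < t → ∃ L : Set V, L.Finite ∧ L ⊆ X (t + 1) j ∧ (∀ v ∈ L, v ∈ X t j → v = e t j) ∧
        (∀ v ∈ L, (restr G L).Reachable (e t j) v) ∧
        (restr G L).Reachable (e t j) (e (t + 1) j) ∧
        (e (t + 1) j = e t j ∨ e (t + 1) j ∉ X t j) := by
  classical
  let P : ℕ → (ℕ → Set V) × (ℕ → V) → Prop := fun t s => (∀ j, (s.1 j).Finite) ∧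
    (∀ j, t ≤ j → s.1 j = ∅) ∧ (∀ j, j < t → s.2 j ∈ s.1 j ∧ s.2 j ∈ d.Δ) ∧
    ∀ i j, i ≠ j → Disjoint (s.1 i) (s.1 j)
  let R : ℕ → (ℕ → Set V) × (ℕ → V) → (ℕ → Set V) × (ℕ → V) → Prop := fun t s s' =>
    (∀ j, s.1 j ⊆ s'.1 j) ∧ (∀ j, j < t → (Nat.unpair t).1 = j → s'.2 j ∉ s.1 j) ∧
    ∀ j, j < t → ∃ L : Set V, L.Finite ∧ L ⊆ s'.1 j ∧ (∀ v ∈ L, v ∈ s.1 j → v = s.2 j) ∧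
        (∀ v ∈ L, (restr G L).Reachable (s.2 j) v) ∧ (restr G L).Reachable (s.2 j) (s'.2 j) ∧
        (s'.2 j = s.2 j ∨ s'.2 j ∉ s.1 j)
  obtain ⟨x₀, hx₀⟩ := hΔ.nonempty
  obtain ⟨s, -, hP, hR⟩ := exists_seq_of_step P R (s₀ := (fun _ => ∅, fun _ => x₀))
    ⟨by simp, by simp, by simp, by simp⟩ (by
    rintro t ⟨X, e⟩ ⟨h1, h2, h3, h4⟩
    dsimp only at h1 h2 h3 h4
    have hU : (⋃ j ∈ Set.Iio t, X j).Finite := (Set.finite_Iio t).biUnion fun j _ => h1 j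
    have hXU : ∀ j v, v ∈ X j → v ∈ ⋃ j ∈ Set.Iio t, X j := by
      intro j v hv
      by_cases hj : j < t
      · exact Set.mem_biUnion (show j ∈ Set.Iio t from hj) hv
      · rw [h2 j (not_lt.1 hj)] at hv
        exact absurd hv (Set.notMem_empty v)
    obtain ⟨z, hz, hzU⟩ := hΔ.exists_notMem_finite hU
    set j₀ := (Nat.unpair t).1 with hj₀
    have hj₀t : j₀ ≤ t := Nat.unpair_left_le t
    obtain ⟨y, L, hL, hy⟩ : ∃ (y : V) (L : Set V), L.Finite ∧ (j₀ < t → y ∈ d.Δ ∧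
        y ∉ (⋃ j ∈ Set.Iio t, X j) ∪ {z} ∧ y ∈ L ∧
        (∀ v ∈ L, v ∈ (⋃ j ∈ Set.Iio t, X j) ∪ {z} → v = e j₀) ∧
        ∀ v ∈ L, (restr G L).Reachable (e j₀) v) := by
      by_cases hj : j₀ < t
      · obtain ⟨y, hy, hyU, L, hL, hyL, hLU, hLr⟩ :=
          exists_extension hΔ (hU.union (Set.finite_singleton z)) (h3 j₀ hj).2
        exact ⟨y, L, hL, fun _ => ⟨hy, hyU, hyL, hLU, hLr⟩⟩
      · exact ⟨x₀, ∅, Set.finite_empty, fun h => absurd h hj⟩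
    have hz' : ∀ j, z ∉ X j := fun j h => hzU (hXU j z h)
    have hdis : ∀ j, j ≠ j₀ → j₀ < t → ∀ v ∈ L, v ∉ X j := by
      intro j hj hlt v hv hvX
      have := (hy hlt).2.2.2.1 v hv (Or.inl (hXU j v hvX))
      subst this
      exact Set.disjoint_left.1 (h4 j j₀ hj) hvX (h3 j₀ hlt).1
    have hzL : j₀ < t → z ∉ L := by
      intro hlt hzL
      have := (hy hlt).2.2.2.1 z hzL (Or.inr rfl)
      exact hz' j₀ (this ▸ (h3 j₀ hlt).1)
    let X' : ℕ → Set V := fun j => if j = t then {z} else if j = j₀ then X j ∪ L else X j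
    let e' : ℕ → V := fun j => if j = t then z else if j = j₀ then y else e j
    have hX't : X' t = {z} := by simp [X']
    have he't : e' t = z := by simp [e']
    have hX'j : j₀ ≠ t → X' j₀ = X j₀ ∪ L := fun h => by simp [X', h]
    have he'j : j₀ ≠ t → e' j₀ = y := fun h => by simp [e', h]
    have hX'o : ∀ j, j ≠ t → j ≠ j₀ → X' j = X j := fun j h h' => by simp [X', h, h']
    have he'o : ∀ j, j ≠ t → j ≠ j₀ → e' j = e j := fun j h h' => by simp [e', h, h']
    have hdisj : ∀ i j, i < j → Disjoint (X' i) (X' j) := by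
      intro i j hij
      rw [Set.disjoint_left]
      intro v hvi hvj
      by_cases hjt : j = t
      · rw [hjt, hX't] at hvj
        rw [Set.mem_singleton_iff] at hvj
        subst hvj
        by_cases hi : i = j₀
        · rw [hi, hX'j (by omega)] at hvi
          exact hvi.elim (hz' _) (hzL (by omega))
        · rw [hX'o i (by omega) hi] at hvi
          exact hz' _ hvi
      · by_cases hit : i = t
        · rw [hX'o j (by omega) (by omega), h2 j (by omega)] at hvj
          exact hvj
        · by_cases hi : i = j₀
          · rw [hi, hX'j (by omega)] at hvi
            rw [hX'o j (by omega) (by omega)] at hvj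
            rcases hvi with hvi | hvi
            · exact Set.disjoint_left.1 (h4 j₀ j (by omega)) hvi hvj
            · exact hdis j (by omega) (by omega) v hvi hvj
          · rw [hX'o i hit hi] at hvi
            by_cases hj : j = j₀
            · rw [hj, hX'j (by omega)] at hvj
              rcases hvj with hvj | hvj
              · exact Set.disjoint_left.1 (h4 i j₀ (by omega)) hvi hvj
              · exact hdis i (by omega) (by omega) v hvj hvi
            · rw [hX'o j hjt hj] at hvj
              exact Set.disjoint_left.1 (h4 i j (by omega)) hvi hvj
    refine ⟨(X', e'), ⟨?_, ?_, ?_, ?_⟩, ?_, ?_, ?_⟩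
    · intro j
      simp only [X']
      split_ifs
      · exact Set.finite_singleton z
      · exact (h1 j).union hL
      · exact h1 j
    · intro j hj
      exact (hX'o j (by omega) (by omega)).trans (h2 j (by omega))
    · intro j hj
      dsimp only
      by_cases hjt : j = t
      · rw [hjt, hX't, he't]
        exact ⟨rfl, hz⟩
      · by_cases hj' : j = j₀
        · rw [hj', hX'j (by omega), he'j (by omega)]
          have := hy (by omega)
          exact ⟨Or.inr this.2.2.1, this.1⟩
        · rw [hX'o j hjt hj', he'o j hjt hj']
          exact h3 j (by omega)
    · intro i j hij
      rcases lt_or_gt_of_ne hij with h | h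
      · exact hdisj i j h
      · exact (hdisj j i h).symm
    · intro j v hv
      dsimp only at hv ⊢
      by_cases hjt : j = t
      · rw [h2 j (by omega)] at hv
        exact absurd hv (Set.notMem_empty v)
      · by_cases hj' : j = j₀
        · rw [hj', hX'j (by omega)]
          exact Or.inl (hj' ▸ hv)
        · rwa [hX'o j hjt hj']
    · intro j hj hj'
      dsimp only
      rw [← hj', he'j (by omega)]
      exact fun h => (hy (by omega)).2.1 (Or.inl (hXU _ _ h))
    · intro j hj
      dsimp only
      by_cases hj' : j = j₀
      · have := hy (by omega)
        rw [hj', he'j (by omega), hX'j (by omega)]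
        refine ⟨L, hL, Set.subset_union_right, fun v hv hvX => ?_, this.2.2.2.2,
          this.2.2.2.2 y this.2.2.1, Or.inr fun h => this.2.1 (Or.inl (hXU _ _ h))⟩
        exact this.2.2.2.1 v hv (Or.inl (hXU _ _ hvX))
      · rw [he'o j (by omega) hj']
        exact ⟨∅, Set.finite_empty, by simp, by simp, by simp, Reachable.refl _, Or.inl rfl⟩)
  exact ⟨fun t => (s t).1, fun t => (s t).2, fun t => (hP t).1, fun t => (hP t).2.2.1,
    fun t => (hP t).2.2.2, fun t => (hR t).1, fun t => (hR t).2.1, fun t => (hR t).2.2⟩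

theorem hasInf_of_infinite_dominating (hΔ : d.Δ.Infinite) : HasInf G := by
  obtain ⟨X, e, hX, he, hdis, hmono, hnew, hL⟩ := exists_growing_chains hΔ
  choose! L hLfin hLX hLe hLr hLe' hor using hL
  have hmono' : ∀ j, Monotone fun t => X t j := fun j => monotone_nat_of_le_succ fun t => hmono t j
  have hray : ∀ j, ∃ f, IsRay G f ∧ d.Conv f ∧ ∀ n, ∃ t, f n ∈ X t j := by
    intro j
    have hev : ∀ S : Set V, S.Finite → ∃ I, ∀ t, j < t → I ≤ t →
        e t j ∉ S ∧ L t j ⊆ d.ω S := by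
      intro S hS
      obtain ⟨s, hs⟩ : ∃ s, ∀ t, ∀ v ∈ S, v ∈ X t j → v ∈ X s j := by
        induction S, hS using Set.Finite.induction_on with
        | empty => exact ⟨0, by simp⟩
        | @insert a S _ _ ih =>
          obtain ⟨s, hs⟩ := ih
          by_cases ha : ∃ t, a ∈ X t j
          · obtain ⟨t, ht⟩ := ha
            refine ⟨max s t, fun r v hv hvr => ?_⟩
            rcases hv with rfl | hv
            · exact hmono' j (le_max_right s t) ht
            · exact hmono' j (le_max_left s t) (hs r v hv hvr)
          · refine ⟨s, fun r v hv hvr => ?_⟩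
            rcases hv with rfl | hv
            · exact absurd ⟨r, hvr⟩ ha
            · exact hs r v hv hvr
      let T := Nat.pair j (max s (j + 1))
      have hT1 : max s (j + 1) ≤ T := Nat.right_le_pair _ _
      have hT2 : (Nat.unpair T).1 = j := by simp [T]
      have hnot : ∀ r, T + 1 ≤ r → e r j ∉ X T j := by
        intro r hr
        induction r, hr using Nat.le_induction with
        | base => exact hnew T j (by omega) hT2
        | succ r hr ih =>
          rcases hor r j (by omega) with h | h
          · rwa [h]
          · exact fun h' => h (hmono' j (by omega) h')
      refine ⟨T + 1, fun t hjt hTt => ?_⟩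
      have heS : e t j ∉ S := by
        intro h
        have := hs t _ h (he t j hjt).1
        exact hnot t hTt (hmono' j (by omega : s ≤ T) this)
      refine ⟨heS, fun v hv => ?_⟩
      refine mem_of_reachable ((he t j hjt).2 S hS heS) ?_ (hLr t j hjt v hv)
      rw [Set.disjoint_left]
      intro w hw hwS
      have := hs _ _ hwS (hLX t j hjt hw)
      have := hLe t j hjt w hw (hmono' j (by omega : s ≤ t) this)
      exact heS (this ▸ hwS)
    obtain ⟨f, hf, -, hc, hfX⟩ := exists_conv_ray_of_chain (d := d) (fun r => L (j + 1 + r) j)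
      (fun r => hLfin _ _ (by omega)) (by
        intro S hS
        obtain ⟨I, hI⟩ := hev S hS
        exact ⟨I, fun r hr => (hI _ (by omega) (by omega)).2⟩)
      (fun r => e (j + 1 + r) j) (fun r => hLe' _ _ (by omega)) (by
        intro hfin
        obtain ⟨I, hI⟩ := hev _ hfin
        exact (hI (j + 1 + I) (by omega) (by omega)).1 ⟨I, rfl⟩)
    refine ⟨f, hf, hc, fun n => ?_⟩
    obtain ⟨r, hr⟩ := hfX n
    exact ⟨_, hLX _ _ (by omega) hr⟩
  choose Q hQ hc hQX using hray
  refine hasInf_of_disjoint_rays hQ ?_ hc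
  intro i j m n hij h
  obtain ⟨t, ht⟩ := hQX i m
  obtain ⟨t', ht'⟩ := hQX j n
  exact Set.disjoint_left.1 (hdis (max t t') i j hij) (hmono' i (le_max_left _ _) ht)
    (hmono' j (le_max_right _ _) (h ▸ ht'))

end Dir

/-! ### Menger's theorem for finitely many disjoint paths in infinite graphs -/

/-- `X` is the vertex set of a path from `s` to `t`. -/
def PathSet (H : SimpleGraph V) (s t : V) (X : Finset V) : Prop :=
  ∃ p : H.Walk s t, p.IsPath ∧ ∀ v, v ∈ X ↔ v ∈ p.support

theorem PathSet.start_mem {H : SimpleGraph V} {s t : V} {X : Finset V} (h : PathSet H s t X) :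
    s ∈ X := by
  obtain ⟨p, -, h⟩ := h
  simp [h]

theorem PathSet.end_mem {H : SimpleGraph V} {s t : V} {X : Finset V} (h : PathSet H s t X) :
    t ∈ X := by
  obtain ⟨p, -, h⟩ := h
  simp [h]

theorem PathSet.of_walk {H : SimpleGraph V} {s t : V} (p : H.Walk s t) (hp : p.IsPath) :
    ∃ X : Finset V, PathSet H s t X ∧ ∀ v, v ∈ X ↔ v ∈ p.support := by
  classical
  exact ⟨p.support.toFinset, ⟨p, hp, by simp⟩, by simp⟩

theorem PathSet.split {H : SimpleGraph V} {s t x : V} {X : Finset V} (h : PathSet H s t X)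
    (hx : x ∈ X) : ∃ Y W : Finset V, PathSet H s x Y ∧ PathSet H x t W ∧
      (∀ v, v ∈ X ↔ v ∈ Y ∨ v ∈ W) ∧ ∀ v ∈ Y, v ∈ W → v = x := by
  classical
  obtain ⟨p, hp, hX⟩ := h
  have hx := (hX x).1 hx
  refine ⟨(p.takeUntil x hx).support.toFinset, (p.dropUntil x hx).support.toFinset,
    ⟨_, hp.takeUntil hx, by simp⟩, ⟨_, hp.dropUntil hx, by simp⟩, ?_, ?_⟩
  · intro v
    rw [hX, List.mem_toFinset, List.mem_toFinset, ← Walk.mem_support_append_iff, p.take_spec hx]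
  · intro v hv hv'
    rw [List.mem_toFinset] at hv hv'
    by_contra hne
    have h1 : (p.takeUntil x hx).support.Nodup ∧ (p.dropUntil x hx).support.tail.Nodup ∧
      List.Disjoint (p.takeUntil x hx).support (p.dropUntil x hx).support.tail := by
      rw [← List.nodup_append', ← Walk.support_append, p.take_spec hx]
      exact hp.support_nodup
    refine h1.2.2 hv ?_
    rw [Walk.mem_support_iff] at hv'
    exact hv'.resolve_left hne

theorem PathSet.append {H : SimpleGraph V} {s t x : V} {X Y Z : Finset V} (hX : PathSet H s x X)
    (hY : PathSet H x t Y) (hd : ∀ v ∈ X, v ∈ Y → v = x) (hZ : ∀ v, v ∈ Z ↔ v ∈ X ∨ v ∈ Y) :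
    PathSet H s t Z := by
  obtain ⟨p, hp, hX⟩ := hX
  obtain ⟨q, hq, hY⟩ := hY
  refine ⟨p.append q, ?_, fun v => ?_⟩
  · refine Walk.IsPath.mk' ?_
    rw [Walk.support_append, List.nodup_append']
    refine ⟨hp.support_nodup, hq.support_nodup.sublist (List.tail_sublist _), ?_⟩
    intro v hv hv'
    have := hd v ((hX v).2 hv) ((hY v).2 (List.mem_of_mem_tail hv'))
    subst this
    have h1 := hq.support_nodup
    rw [← Walk.cons_tail_support] at h1
    exact (List.nodup_cons.1 h1).1 hv'
  · rw [hZ, hX, hY, Walk.mem_support_append_iff]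

/-- A family of disjoint paths from `A` to `B`, indexed by their ends. -/
structure Linkage (H : SimpleGraph V) (A B : Set V) (Z : Finset V) (X : V → Finset V) : Prop where
  mem : ∀ z ∈ Z, z ∈ B
  path : ∀ z ∈ Z, ∃ s ∈ A, PathSet H s z (X z)
  only : ∀ z ∈ Z, ∀ v ∈ X z, v ∈ B → v = z
  disj : ∀ z ∈ Z, ∀ z' ∈ Z, ∀ v, v ∈ X z → v ∈ X z' → z = z'

theorem Linkage.add_path [DecidableEq V] {H : SimpleGraph V} {A B : Set V} {Z : Finset V}
    {X : V → Finset V} (h : Linkage H A B Z X) {s y : V} {Y : Finset V} (hy : y ∉ Z) (hyB : y ∈ B)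
    (hs : s ∈ A) (hY : PathSet H s y Y) (hYB : ∀ v ∈ Y, v ∈ B → v = y)
    (hd : ∀ z ∈ Z, ∀ v ∈ X z, v ∉ Y) :
    Linkage H A B (insert y Z) (Function.update X y Y) := by
  have hne : ∀ z ∈ Z, z ≠ y := fun z hz h => hy (h ▸ hz)
  refine ⟨?_, ?_, ?_, ?_⟩
  · intro z hz
    rcases Finset.mem_insert.1 hz with rfl | hz
    · exact hyB
    · exact h.mem z hz
  · intro z hz
    rcases Finset.mem_insert.1 hz with rfl | hz
    · exact ⟨s, hs, by simpa using hY⟩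
    · rw [Function.update_of_ne (hne z hz)]
      exact h.path z hz
  · intro z hz
    rcases Finset.mem_insert.1 hz with rfl | hz
    · simpa using hYB
    · rw [Function.update_of_ne (hne z hz)]
      exact h.only z hz
  · intro z hz z' hz' v hv hv'
    rcases Finset.mem_insert.1 hz with hzy | hz <;> rcases Finset.mem_insert.1 hz' with hzy' | hz'
    · rw [hzy, hzy']
    · rw [Function.update_of_ne (hne z' hz')] at hv'
      rw [hzy, Function.update_self] at hv
      exact absurd hv (hd z' hz' v hv')
    · rw [Function.update_of_ne (hne z hz)] at hv
      rw [hzy', Function.update_self] at hv'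
      exact absurd hv' (hd z hz v hv)
    · rw [Function.update_of_ne (hne z hz)] at hv
      rw [Function.update_of_ne (hne z' hz')] at hv'
      exact h.disj z hz z' hz' v hv hv'

theorem Linkage.subset {H : SimpleGraph V} {A B B' : Set V} {Z Z' : Finset V}
    {X : V → Finset V} (h : Linkage H A B Z X) (hZ : Z' ⊆ Z) (hB : B' ⊆ B) (hm : ∀ z ∈ Z', z ∈ B') :
    Linkage H A B' Z' X :=
  ⟨hm, fun z hz => h.path z (hZ hz), fun z hz v hv hvB => h.only z (hZ hz) v hv (hB hvB),
    fun z hz z' hz' => h.disj z (hZ hz) z' (hZ hz')⟩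

theorem Linkage.congr {H : SimpleGraph V} {A B : Set V} {Z : Finset V}
    {X X' : V → Finset V} (h : Linkage H A B Z X) (hX : ∀ z ∈ Z, X z = X' z) :
    Linkage H A B Z X' :=
  ⟨h.mem, fun z hz => hX z hz ▸ h.path z hz, fun z hz => hX z hz ▸ h.only z hz,
    fun z hz z' hz' => hX z hz ▸ hX z' hz' ▸ h.disj z hz z' hz'⟩

theorem Linkage.exists_succ (H : SimpleGraph V) (A : Set V) (k : ℕ) (N : ℕ) :
    ∀ (B : Set V) (Z : Finset V) (X : V → Finset V), ∑ z ∈ Z, (X z).card ≤ N →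
      Linkage H A B Z X → Z.card < k →
      (∀ T : Finset V, T.card < k → ∃ a ∈ A, ∃ b ∈ B, ∃ p : H.Walk a b, ∀ v ∈ p.support, v ∉ T) →
      ∃ Z' X', Linkage H A B Z' X' ∧ Z ⊆ Z' ∧ Z'.card = Z.card + 1 := by
  classical
  induction N using Nat.strong_induction_on with
  | _ N ih =>
  intro B Z X hN hL hk hsep
  obtain ⟨a, ha, b, hb, p, hp⟩ := hsep Z hk
  obtain ⟨x, ⟨hx, hxZ⟩, r, ⟨hr, hrZ⟩, q, hq, hq1, hq2⟩ :=
    exists_path_between (restr H {v | v ∉ Z}) (A := (A ∪ {v | ∃ z ∈ Z, v ∈ X z}) \ {v | v ∈ Z})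
      (B := B \ {v | v ∈ Z}) ⟨Or.inl ha, hp a (by simp)⟩ ⟨hb, hp b (by simp)⟩
      (reachable_restr_of_walk p hp)
  have hqZ := support_subset_restr q (X := {v | v ∉ Z}) hxZ
  obtain ⟨R, hR, hRq⟩ := PathSet.of_walk (q.mapLe (restr_le _ _)) (by simpa using hq)
  simp only [Walk.support_mapLe_eq_support] at hRq
  have hRZ : ∀ v ∈ R, v ∉ Z := fun v hv => hqZ v ((hRq v).1 hv)
  have hRX : ∀ v ∈ R, ∀ z ∈ Z, v ∈ X z → v = x := fun v hv z hz hvz =>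
    hq1 v ((hRq v).1 hv) ⟨Or.inr ⟨z, hz, hvz⟩, hRZ v hv⟩
  have hRB : ∀ v ∈ R, v ∈ B → v = r := fun v hv hvB =>
    hq2 v ((hRq v).1 hv) ⟨hvB, hRZ v hv⟩
  have hrZ : r ∉ Z := hrZ
  have hxZ : x ∉ Z := hxZ
  by_cases hxX : ∃ z ∈ Z, x ∈ X z
  swap
  · refine ⟨insert r Z, _, hL.add_path hrZ hr ?_ hR hRB ?_, Finset.subset_insert _ _,
      Finset.card_insert_of_notMem hrZ⟩
    · exact hx.resolve_right hxX
    · intro z hz v hv hvR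
      have := hRX v hvR z hz hv
      subst this
      exact hxX ⟨z, hz, hv⟩
  obtain ⟨z₀, hz₀, hxz₀⟩ := hxX
  obtain ⟨s, hs, hPz₀⟩ := hL.path z₀ hz₀
  obtain ⟨Y, W, hY, hW, hYW, hYWx⟩ := hPz₀.split hxz₀
  have hxz : x ≠ z₀ := fun h => hxZ (h ▸ hz₀)
  have hz₀W : z₀ ∈ W := hW.end_mem
  have hz₀Y : z₀ ∉ Y := fun h => hxz (hYWx _ h hz₀W).symm
  have hYX : Y ⊆ X z₀ := fun v hv => (hYW v).2 (Or.inl hv)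
  have hWX : W ⊆ X z₀ := fun v hv => (hYW v).2 (Or.inr hv)
  have hRW : ∀ v ∈ R, v ∈ W → v = x := fun v hv hvW => hRX v hv z₀ hz₀ (hWX hvW)
  let B' : Set V := B ∪ {v | v ∈ W ∨ v ∈ R}
  let Z₁ := Z.erase z₀
  have hWRZ : ∀ z ∈ Z₁, ∀ v ∈ X z, ¬ (v ∈ W ∨ v ∈ R) := by
    intro z hz v hv hvWR
    have hz' := Finset.mem_of_mem_erase hz
    rcases hvWR with h | h
    · exact Finset.ne_of_mem_erase hz (hL.disj z hz' z₀ hz₀ v hv (hWX h))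
    · have := hRX v h z hz' hv
      subst this
      exact Finset.ne_of_mem_erase hz (hL.disj z hz' z₀ hz₀ v hv hxz₀)
  have hL₁ : Linkage H A B' Z₁ X := by
    refine ⟨fun z hz => Or.inl (hL.mem z (Finset.mem_of_mem_erase hz)),
      fun z hz => hL.path z (Finset.mem_of_mem_erase hz), ?_,
      fun z hz z' hz' => hL.disj z (Finset.mem_of_mem_erase hz) z' (Finset.mem_of_mem_erase hz')⟩
    rintro z hz v hv (h | h)
    · exact hL.only z (Finset.mem_of_mem_erase hz) v hv h
    · exact absurd h (hWRZ z hz v hv)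
  have hxZ₁ : x ∉ Z₁ := fun h => hxZ (Finset.mem_of_mem_erase h)
  have hL₂ : Linkage H A B' (insert x Z₁) (Function.update X x Y) := by
    refine hL₁.add_path hxZ₁ (Or.inr (Or.inl hW.start_mem)) hs hY ?_ ?_
    · rintro v hv (h | h | h)
      · have := hL.only z₀ hz₀ v (hYX hv) h
        exact absurd (this ▸ hv) hz₀Y
      · exact hYWx v hv h
      · exact hRX v h z₀ hz₀ (hYX hv)
    · intro z hz v hv hvY
      exact Finset.ne_of_mem_erase hz
        (hL.disj z (Finset.mem_of_mem_erase hz) z₀ hz₀ v hv (hYX hvY))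
  have hcardZ : Z₁.card + 1 = Z.card := Finset.card_erase_add_one hz₀
  have hcard : (insert x Z₁).card = Z.card := by
    rw [Finset.card_insert_of_notMem hxZ₁, hcardZ]
  have hlt : ∑ z ∈ insert x Z₁, (Function.update X x Y z).card < N := by
    rw [Finset.sum_insert hxZ₁]
    have h1 : ∑ z ∈ Z₁, (Function.update X x Y z).card = ∑ z ∈ Z₁, (X z).card := by
      refine Finset.sum_congr rfl fun z hz => ?_
      rw [Function.update_of_ne]
      rintro rfl
      exact hxZ₁ hz
    have h2 : Y.card < (X z₀).card :=
      Finset.card_lt_card ⟨hYX, fun h => hz₀Y (h (hWX hz₀W))⟩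
    have h3 := Finset.add_sum_erase Z (fun z => (X z).card) hz₀
    rw [h1, Function.update_self]
    change _ + ∑ z ∈ Z.erase z₀, _ < N
    omega
  obtain ⟨Z₂, X₂, hL₃, hsub, hcard₂⟩ := ih _ hlt B' _ _ le_rfl hL₂ (by omega) (by
    intro T hT
    obtain ⟨a, ha, b, hb, p, hp⟩ := hsep T hT
    exact ⟨a, ha, b, Or.inl hb, p, hp⟩)
  obtain ⟨y, hyZ₂, hy⟩ : ∃ y ∈ Z₂, y ∉ insert x Z₁ :=
    Finset.exists_mem_notMem_of_card_lt_card (by omega)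
  rw [Finset.mem_insert, not_or] at hy
  have hxZ₂ : x ∈ Z₂ := hsub (Finset.mem_insert_self _ _)
  have hZ₁₂ : Z₁ ⊆ Z₂ := fun z hz => hsub (Finset.mem_insert_of_mem hz)
  have hL₄ : Linkage H A B Z₁ X₂ :=
    hL₃.subset hZ₁₂ Set.subset_union_left fun z hz => hL.mem z (Finset.mem_of_mem_erase hz)
  have hfree : ∀ z ∈ Z₁, ∀ v ∈ X₂ z, ¬ (v ∈ W ∨ v ∈ R) := by
    intro z hz v hv hvWR
    have := hL₃.only z (hZ₁₂ hz) v hv (Or.inr hvWR)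
    subst this
    obtain ⟨_, _, h⟩ := hL₁.path v hz
    exact hWRZ v hz v h.end_mem hvWR
  have finish : ∀ (y' q₁ q₂ s₁ s₂ : V) (P₁ P₂ : Finset V), y' ∉ Z → y' ∈ B → q₁ ∈ Z₂ → q₂ ∈ Z₂ →
      q₁ ∉ Z₁ → q₂ ∉ Z₁ → s₁ ∈ A → s₂ ∈ A → PathSet H s₁ z₀ P₁ → PathSet H s₂ y' P₂ →
      (∀ v ∈ P₁, v ∈ X₂ q₁ ∨ v ∈ W ∨ v ∈ R) → (∀ v ∈ P₂, v ∈ X₂ q₂ ∨ v ∈ W ∨ v ∈ R) →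
      (∀ v ∈ P₁, v ∈ B → v = z₀) → (∀ v ∈ P₂, v ∈ B → v = y') → (∀ v ∈ P₁, v ∉ P₂) →
      ∃ Z' X', Linkage H A B Z' X' ∧ Z ⊆ Z' ∧ Z'.card = Z.card + 1 := by
    intro y' q₁ q₂ s₁ s₂ P₁ P₂ hy'Z hy'B hq₁ hq₂ hq₁' hq₂' hs₁ hs₂ hP₁ hP₂ hP₁X hP₂X hP₁B hP₂B h12
    have hz₀Z₁ : z₀ ∉ Z₁ := Finset.notMem_erase _ _
    have e1 := hL₄.add_path hz₀Z₁ (hL.mem z₀ hz₀) hs₁ hP₁ hP₁B (by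
      intro z hz v hv hvP
      rcases hP₁X v hvP with h | h
      · exact hq₁' (hL₃.disj z (hZ₁₂ hz) q₁ hq₁ v hv h ▸ hz)
      · exact hfree z hz v hv h)
    have hins : insert z₀ Z₁ = Z := Finset.insert_erase hz₀
    rw [hins] at e1
    refine ⟨_, _, e1.add_path hy'Z hy'B hs₂ hP₂ hP₂B ?_, Finset.subset_insert _ _,
      Finset.card_insert_of_notMem hy'Z⟩
    intro z hz v hv hvP
    by_cases hzz : z = z₀
    · subst hzz
      rw [Function.update_self] at hv
      exact h12 v hv hvP
    · rw [Function.update_of_ne hzz] at hv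
      have hz := Finset.mem_erase.2 ⟨hzz, hz⟩
      rcases hP₂X v hvP with h | h
      · exact hq₂' (hL₃.disj z (hZ₁₂ hz) q₂ hq₂ v hv h ▸ hz)
      · exact hfree z hz v hv h
  obtain ⟨sx, hsx, hPx⟩ := hL₃.path x hxZ₂
  obtain ⟨sy, hsy, hPy⟩ := hL₃.path y hyZ₂
  have hxy : ∀ v ∈ X₂ x, v ∉ X₂ y := fun v hv hv' =>
    hy.1 (hL₃.disj x hxZ₂ y hyZ₂ v hv hv').symm
  have hxo : ∀ v ∈ X₂ x, (v ∈ B ∨ v ∈ W ∨ v ∈ R) → v = x := hL₃.only x hxZ₂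
  have hyo : ∀ v ∈ X₂ y, (v ∈ B ∨ v ∈ W ∨ v ∈ R) → v = y := hL₃.only y hyZ₂
  have hxB : x ∉ B := fun h => hxz (hL.only z₀ hz₀ x hxz₀ h)
  have hWB : ∀ v ∈ W, v ∈ B → v = z₀ := fun v hv => hL.only z₀ hz₀ v (hWX hv)
  by_cases hyW : y ∈ W
  · obtain ⟨W₁, W₂, hW₁, hW₂, hW12, hWy⟩ := hW.split hyW
    have hW₂W : W₂ ⊆ W := fun v hv => (hW12 v).2 (Or.inr hv)
    have hyR : y ∉ R := fun h => hy.1 (hRW y h hyW)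
    have hxW₂ : x ∉ W₂ := fun h => hy.1 (hWy x hW₁.start_mem h).symm
    refine finish r y x sy sx (X₂ y ∪ W₂) (X₂ x ∪ R) hrZ hr hyZ₂ hxZ₂ hy.2 hxZ₁ hsy hsx
      (hPy.append hW₂ (fun v hv hv' => hyo v hv (Or.inr (Or.inl (hW₂W hv')))) (by simp))
      (hPx.append hR (fun v hv hv' => hxo v hv (Or.inr (Or.inr hv'))) (by simp)) ?_ ?_ ?_ ?_ ?_
    · intro v hv
      rcases Finset.mem_union.1 hv with h | h
      · exact Or.inl h
      · exact Or.inr (Or.inl (hW₂W h))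
    · intro v hv
      rcases Finset.mem_union.1 hv with h | h
      · exact Or.inl h
      · exact Or.inr (Or.inr h)
    · intro v hv hvB
      rcases Finset.mem_union.1 hv with h | h
      · have := hyo v h (Or.inl hvB)
        subst this
        exact hWB v hyW hvB
      · exact hWB v (hW₂W h) hvB
    · intro v hv hvB
      rcases Finset.mem_union.1 hv with h | h
      · have := hxo v h (Or.inl hvB)
        exact absurd (this ▸ hvB) hxB
      · exact hRB v h hvB
    · intro v hv hv'
      rcases Finset.mem_union.1 hv with h | h <;> rcases Finset.mem_union.1 hv' with h' | h'
      · exact hxy v h' h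
      · exact hyR (hyo v h (Or.inr (Or.inr h')) ▸ h')
      · exact hxW₂ (hxo v h' (Or.inr (Or.inl (hW₂W h))) ▸ h)
      · exact hxW₂ (hRW v h' (hW₂W h) ▸ h)
  · have hPxW := hPx.append hW (Z := X₂ x ∪ W) (fun v hv hv' => hxo v hv (Or.inr (Or.inl hv')))
      (by simp)
    have hPxWB : ∀ v ∈ X₂ x ∪ W, v ∈ B → v = z₀ := by
      intro v hv hvB
      rcases Finset.mem_union.1 hv with h | h
      · have := hxo v h (Or.inl hvB)
        exact absurd (this ▸ hvB) hxB
      · exact hWB v h hvB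
    have hPxWX : ∀ v ∈ X₂ x ∪ W, v ∈ X₂ x ∨ v ∈ W ∨ v ∈ R := by
      intro v hv
      rcases Finset.mem_union.1 hv with h | h
      · exact Or.inl h
      · exact Or.inr (Or.inl h)
    by_cases hyR : y ∈ R
    · obtain ⟨R₁, R₂, hR₁, hR₂, hR12, hRy⟩ := hR.split hyR
      have hR₂R : R₂ ⊆ R := fun v hv => (hR12 v).2 (Or.inr hv)
      have hxR₂ : x ∉ R₂ := fun h => hy.1 (hRy x hR₁.start_mem h).symm
      refine finish r x y sx sy (X₂ x ∪ W) (X₂ y ∪ R₂) hrZ hr hxZ₂ hyZ₂ hxZ₁ hy.2 hsx hsy hPxW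
        (hPy.append hR₂ (fun v hv hv' => hyo v hv (Or.inr (Or.inr (hR₂R hv')))) (by simp))
        hPxWX ?_ hPxWB ?_ ?_
      · intro v hv
        rcases Finset.mem_union.1 hv with h | h
        · exact Or.inl h
        · exact Or.inr (Or.inr (hR₂R h))
      · intro v hv hvB
        rcases Finset.mem_union.1 hv with h | h
        · have := hyo v h (Or.inl hvB)
          subst this
          exact hRB v hyR hvB
        · exact hRB v (hR₂R h) hvB
      · intro v hv hv'
        rcases Finset.mem_union.1 hv with h | h <;> rcases Finset.mem_union.1 hv' with h' | h'
        · exact hxy v h h'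
        · exact hxR₂ (hxo v h (Or.inr (Or.inr (hR₂R h'))) ▸ h')
        · exact hyW (hyo v h' (Or.inr (Or.inl h)) ▸ h)
        · exact hxR₂ (hRW v (hR₂R h') h ▸ h')
    · have hyB : y ∈ B := by
        rcases hL₃.mem y hyZ₂ with h | h | h
        · exact h
        · exact absurd h hyW
        · exact absurd h hyR
      have hyZ : y ∉ Z := by
        intro h
        by_cases hyz : y = z₀
        · exact hyW (hyz ▸ hz₀W)
        · exact hy.2 (Finset.mem_erase.2 ⟨hyz, h⟩)
      refine finish y x y sx sy (X₂ x ∪ W) (X₂ y) hyZ hyB hxZ₂ hyZ₂ hxZ₁ hy.2 hsx hsy hPxW hPy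
        hPxWX (fun v hv => Or.inl hv) hPxWB (fun v hv hvB => hyo v hv (Or.inl hvB)) ?_
      intro v hv hv'
      rcases Finset.mem_union.1 hv with h | h
      · exact hxy v h hv'
      · exact hyW (hyo v hv' (Or.inr (Or.inl h)) ▸ h)

theorem menger (H : SimpleGraph V) (A : Finset V) (B : Set V)
    (hsep : ∀ T : Finset V, T.card < A.card →
      ∃ a ∈ A, ∃ b ∈ B, ∃ p : H.Walk a b, ∀ v ∈ p.support, v ∉ T) :
    ∃ (φ : V → V) (X : V → Finset V), ∀ a ∈ A, φ a ∈ B ∧ PathSet H a (φ a) (X a) ∧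
      (∀ v ∈ X a, v ∈ B → v = φ a) ∧ (∀ v ∈ X a, v ∈ A → v = a) ∧
      ∀ a' ∈ A, ∀ v, v ∈ X a → v ∈ X a' → a = a' := by
  classical
  have hn : ∀ n ≤ A.card, ∃ Z X, Linkage H {v | v ∈ A} B Z X ∧ Z.card = n := by
    intro n
    induction n with
    | zero => exact fun _ => ⟨∅, fun _ => ∅, ⟨by simp, by simp, by simp, by simp⟩, by simp⟩
    | succ n ih =>
      intro hn
      obtain ⟨Z, X, hL, hZ⟩ := ih (by omega)
      obtain ⟨Z', X', hL', -, hZ'⟩ :=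
        Linkage.exists_succ H {v | v ∈ A} A.card _ B Z X le_rfl hL (by omega) hsep
      exact ⟨Z', X', hL', by omega⟩
  obtain ⟨Z, X, hL, hZ⟩ := hn _ le_rfl
  have hpath := hL.path
  choose! s hsA hs using hpath
  have hinj : Set.InjOn s Z := by
    intro z hz z' hz' h
    exact hL.disj z hz z' hz' (s z) (hs z hz).start_mem (h ▸ (hs z' hz').start_mem)
  have himg : Z.image s = A := by
    refine Finset.eq_of_subset_of_card_le ?_ ?_
    · intro v hv
      obtain ⟨z, hz, rfl⟩ := Finset.mem_image.1 hv
      exact hsA z hz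
    · rw [Finset.card_image_of_injOn hinj, hZ]
  have hsurj : ∀ a ∈ A, ∃ z ∈ Z, s z = a := by
    intro a ha
    rw [← himg] at ha
    exact Finset.mem_image.1 ha
  choose! φ hφZ hφ using hsurj
  refine ⟨φ, fun a => X (φ a), fun a ha => ⟨hL.mem _ (hφZ a ha), ?_, hL.only _ (hφZ a ha), ?_, ?_⟩⟩
  · have := hs _ (hφZ a ha)
    rwa [hφ a ha] at this
  · intro v hv hvA
    have h1 := (hs _ (hφZ v hvA)).start_mem
    rw [hφ v hvA] at h1
    have := hL.disj _ (hφZ a ha) _ (hφZ v hvA) v hv h1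
    rw [← hφ a ha, ← hφ v hvA, this]
  · intro a' ha' v hv hv'
    rw [← hφ a ha, ← hφ a' ha', hL.disj _ (hφZ a ha) _ (hφZ a' ha') v hv hv']

namespace Dir

variable {G : SimpleGraph V} {d : Dir G}

/-! ### Directions with finitely many dominating vertices -/

/-- The component beyond a finite set together with all dominating vertices. -/
def beyond (d : Dir G) (A : Finset V) : Set V := d.ω (d.Δ ∪ {v | v ∈ A})

/-- A finite set which is a smallest separator between itself and the direction. -/
def SelfMin (d : Dir G) (A : Finset V) : Prop :=
  ∀ A' : Finset V, (∀ x ∈ A, x ∉ d.beyond A') → A.card ≤ A'.card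

theorem exists_isolating (A : Finset V) : ∃ X : Finset V, A ⊆ X ∧
    ∀ x ∈ A, x ∉ d.Δ → ∀ w ∈ d.beyond X, ¬ G.Adj x w := by
  classical
  have : ∀ x, ∃ T : Set V, T.Finite ∧ (x ∉ d.Δ → x ∉ T ∧ x ∉ d.ω T) := by
    intro x
    by_cases hx : x ∈ d.Δ
    · exact ⟨∅, Set.finite_empty, fun h => absurd hx h⟩
    · simp only [Δ, Set.mem_ofPred_eq, not_forall] at hx
      obtain ⟨T, hT, h1, h2⟩ := hx
      exact ⟨T, hT, fun _ => ⟨h1, h2⟩⟩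
  choose T hT hx using this
  refine ⟨A ∪ A.biUnion fun x => (hT x).toFinset, Finset.subset_union_left, ?_⟩
  intro x hxA hxΔ w hw hadj
  refine (hx x hxΔ).2 (d.closed (d.anti ?_ hw) hadj.symm (hx x hxΔ).1)
  intro v hv
  refine Or.inr (Finset.mem_union_right _ (Finset.mem_biUnion.2 ⟨x, hxA, ?_⟩))
  simpa using hv

variable (hΔ : d.Δ.Finite)
include hΔ

theorem finite_dominating_union (A : Finset V) : (d.Δ ∪ {v | v ∈ A}).Finite :=
  hΔ.union A.finite_toSet

theorem beyond_subset_ω {A : Finset V} {S : Set V} (hS : S.Finite)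
    (h : ∀ x ∈ S, x ∉ d.beyond A) : d.beyond A ⊆ d.ω S :=
  sub (finite_dominating_union hΔ A) hS fun v hv hvS => h v hvS hv

theorem beyond_subset {A A' : Finset V} (h : ∀ x ∈ A', x ∉ d.beyond A) :
    d.beyond A ⊆ d.beyond A' := by
  refine beyond_subset_ω hΔ (finite_dominating_union hΔ A') ?_
  rintro x (hx | hx) hx'
  · exact d.disj hx' (Or.inl hx)
  · exact h x hx hx'

theorem exists_selfMin (X : Finset V) (m : ℕ)
    (hm : ∃ A : Finset V, A.card ≤ m ∧ ∀ x ∈ X, x ∉ d.beyond A) :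
    ∃ A, d.SelfMin A ∧ A.card ≤ m ∧ ∀ x ∈ X, x ∉ d.beyond A := by
  classical
  have hex : ∃ n, ∃ A : Finset V, A.card = n ∧ ∀ x ∈ X, x ∉ d.beyond A := by
    obtain ⟨A, -, hA⟩ := hm
    exact ⟨_, A, rfl, hA⟩
  obtain ⟨A, hAc, hA⟩ := Nat.find_spec hex
  refine ⟨A, fun A' hA' => ?_, ?_, hA⟩
  · rw [hAc]
    exact Nat.find_min' hex ⟨A', rfl, fun x hx h => hA x hx (beyond_subset hΔ hA' h)⟩
  · obtain ⟨A', hA'm, hA'⟩ := hm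
    rw [hAc]
    exact (Nat.find_min' hex ⟨A', rfl, hA'⟩).trans hA'm

theorem SelfMin.adj {A : Finset V} (hA : d.SelfMin A) {s : V} (hs : s ∈ A) :
    s ∉ d.Δ ∧ ∃ w ∈ d.beyond A, G.Adj s w := by
  classical
  have h1 : ∃ x ∈ A, x ∈ d.beyond (A.erase s) := by
    by_contra! hcon
    have := hA _ hcon
    have := Finset.card_erase_lt_of_mem hs
    omega
  obtain ⟨x, hx, hx'⟩ := h1
  have hxs : x = s := by
    by_contra hne
    exact d.disj hx' (Or.inr (Finset.mem_erase.2 ⟨hne, hx⟩))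
  subst hxs
  have hxΔ : x ∉ d.Δ := fun h => d.disj hx' (Or.inl h)
  refine ⟨hxΔ, exists_adj (finite_dominating_union hΔ A) (d.anti ?_ hx')⟩
  rintro v ⟨hv | hv, hne⟩
  · exact Or.inl hv
  · exact Or.inr (Finset.mem_erase.2 ⟨hne, hv⟩)

theorem exists_next (A Y : Finset V) (m : Finset V → ℕ)
    (hm : ∀ X : Finset V, ∃ A : Finset V, A.card ≤ m X ∧ ∀ x ∈ X, x ∉ d.beyond A) :
    ∃ A', d.SelfMin A' ∧ (∃ X, A'.card ≤ m X) ∧ (∀ y ∈ Y, y ∉ d.beyond A') ∧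
      d.beyond A' ⊆ d.beyond A ∧ ∀ x ∈ A', x ∈ d.beyond A := by
  classical
  obtain ⟨X, hAX, hX⟩ := exists_isolating (d := d) A
  obtain ⟨A', h1, h2, h3⟩ := exists_selfMin hΔ (X ∪ Y) (m (X ∪ Y)) (hm _)
  have h4 : ∀ x ∈ X, x ∉ d.beyond A' := fun x hx => h3 x (Finset.mem_union_left _ hx)
  have h5 : d.beyond A' ⊆ d.beyond X := beyond_subset hΔ h4
  have h6 : d.beyond A' ⊆ d.beyond A := beyond_subset hΔ fun x hx => h4 x (hAX hx)
  refine ⟨A', h1, ⟨_, h2⟩, fun y hy => h3 y (Finset.mem_union_right _ hy), h6, fun x hx => ?_⟩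
  obtain ⟨hxΔ, w, hw, hxw⟩ := h1.adj hΔ hx
  refine d.closed (h6 hw) hxw.symm ?_
  rintro (h | h)
  · exact hxΔ h
  · exact hX x h hxΔ w (h5 hw) hxw

end Dir

theorem PathSet.reachable {H G : SimpleGraph V} {s t : V} {X : Finset V} (h : PathSet H s t X)
    (hHG : H ≤ G) : (restr G {v | v ∈ X}).Reachable s t := by
  obtain ⟨p, -, hX⟩ := h
  exact (reachable_restr_of_walk p (X := {v | v ∈ X}) fun v hv => (hX v).2 hv).mono
    (restr_mono hHG le_rfl)

namespace Dir

variable {G : SimpleGraph V} {d : Dir G}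

/-- A nested sequence of finite self-minimal separators converging to the direction `d`. -/
structure Nested (d : Dir G) (A : ℕ → Finset V) : Prop where
  min : ∀ n, d.SelfMin (A n)
  anti : Antitone fun n => d.beyond (A n)
  mem : ∀ i j, i < j → ∀ x ∈ A j, x ∈ d.beyond (A i)
  notMem : ∀ S : Set V, S.Finite → ∃ N, ∀ n ≥ N, ∀ x ∈ S, x ∉ d.beyond (A n)

theorem exists_nested [Countable V] (P : Finset V → Finset V → Prop)
    (h : ∀ A Y : Finset V, d.SelfMin A → ∃ A' : Finset V, d.SelfMin A' ∧ (∀ y ∈ Y, y ∉ d.beyond A') ∧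
      d.beyond A' ⊆ d.beyond A ∧ (∀ x ∈ A', x ∈ d.beyond A) ∧ P A A') :
    ∃ A, d.Nested A ∧ A 0 = ∅ ∧ ∀ n, P (A n) (A (n + 1)) := by
  obtain ⟨f, hf⟩ := exists_injective_nat V
  have hfin : ∀ n, {v | f v ≤ n}.Finite := fun n => (Set.finite_Iic n).preimage hf.injOn
  obtain ⟨A, h0, h1, h2⟩ := exists_seq_of_step (fun _ A => d.SelfMin A)
    (fun n A A' => (∀ y, f y ≤ n → y ∉ d.beyond A') ∧
      d.beyond A' ⊆ d.beyond A ∧ (∀ x ∈ A', x ∈ d.beyond A) ∧ P A A') (s₀ := ∅)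
    (fun _ _ => by simp) (fun n A hA => by
      obtain ⟨A', h1, h2, h3⟩ := h A (hfin n).toFinset hA
      exact ⟨A', h1, fun y hy => h2 y (by simpa using hy), h3⟩)
  have hanti : Antitone fun n => d.beyond (A n) := antitone_nat_of_succ_le fun n => (h2 n).2.1
  refine ⟨A, ⟨h1, hanti, ?_, ?_⟩, h0, fun n => (h2 n).2.2.2⟩
  · intro i j hij x hx
    obtain ⟨j, rfl⟩ : ∃ j', j = j' + 1 := ⟨j - 1, by omega⟩
    exact hanti (by omega : i ≤ j) ((h2 j).2.2.1 x hx)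
  · intro S hS
    obtain ⟨N, hN⟩ := (hS.image f).bddAbove
    refine ⟨N + 1, fun n hn x hx hxn => ?_⟩
    exact (h2 N).1 x (hN ⟨x, hx, rfl⟩) (hanti hn hxn)

theorem Nested.ω_sub {A : ℕ → Finset V} (hA : d.Nested A) (hΔ : d.Δ.Finite) {S : Set V}
    (hS : S.Finite) : ∃ N, ∀ n ≥ N, d.beyond (A n) ⊆ d.ω S := by
  obtain ⟨N, hN⟩ := hA.notMem S hS
  exact ⟨N, fun n hn => beyond_subset_ω hΔ hS (hN n hn)⟩

/-- Disjoint paths between consecutive separators. -/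
theorem Nested.exists_paths {A : ℕ → Finset V} (hA : d.Nested A) {n : ℕ}
    (hn : (A n).card < (A (n + 1)).card) :
    ∃ (φ : V → V) (X : V → Finset V), ∀ a ∈ A n, φ a ∈ A (n + 1) ∧
      (restr G {v | v ∈ X a}).Reachable a (φ a) ∧ φ a ∈ X a ∧ a ∈ X a ∧
      (∀ v ∈ X a, v ∈ A (n + 1) → v = φ a) ∧ (∀ v ∈ X a, v ∈ A n → v = a) ∧
      (∀ v ∈ X a, v ∈ A n ∨ v ∈ d.beyond (A n)) ∧ (∀ v ∈ X a, v ∉ d.beyond (A (n + 1))) ∧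
      ∀ a' ∈ A n, ∀ v, v ∈ X a → v ∈ X a' → a = a' := by
  obtain ⟨φ, X, h⟩ := menger (restr G d.Δᶜ) (A n) {v | v ∈ A (n + 1)} (by
    intro T hT
    have h1 : ∃ x ∈ A n, x ∈ d.beyond T := by
      by_contra! hcon
      exact absurd (hA.min n T hcon) (by omega)
    have h2 : ∃ x ∈ A (n + 1), x ∈ d.beyond T := by
      by_contra! hcon
      exact absurd (hA.min (n + 1) T hcon) (by omega)
    obtain ⟨a, ha, haT⟩ := h1
    obtain ⟨b, hb, hbT⟩ := h2
    obtain ⟨p⟩ := d.conn haT hbT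
    have hp := support_subset_restr p haT
    have hp' : ∀ v ∈ p.support, v ∉ d.Δ ∧ v ∉ T := fun v hv =>
      ⟨fun h => d.disj (hp v hv) (Or.inl h), fun h => d.disj (hp v hv) (Or.inr h)⟩
    have hle : restr G (d.beyond T) ≤ restr G d.Δᶜ :=
      restr_mono le_rfl fun v hv h => d.disj hv (Or.inl h)
    refine ⟨a, ha, b, hb, p.mapLe hle, fun v hv => (hp' v ?_).2⟩
    exact (Walk.support_mapLe_eq_support hle p) ▸ hv)
  refine ⟨φ, X, fun a ha => ?_⟩
  obtain ⟨h1, h2, h3, h4, h5⟩ := h a ha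
  have hb : φ a ∈ d.beyond (A n) := hA.mem n (n + 1) (by omega) _ h1
  have haΔ : ∀ v ∈ X a, v ∉ d.Δ := by
    classical
    obtain ⟨p, hp, hpX⟩ := id h2
    intro v hv hvΔ
    have : ∀ {s t : V}, (restr G d.Δᶜ).Reachable s t → t ∉ d.Δ → s ∉ d.Δ := fun h ht =>
      mem_of_reachable_restr h.symm ht
    refine this ⟨p.dropUntil v ((hpX v).1 hv)⟩ (fun h => d.disj hb (Or.inl h)) hvΔ
  refine ⟨h1, h2.reachable (restr_le _ _), h2.end_mem, h2.start_mem, h3, h4, ?_, ?_, h5⟩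
  · intro v hv
    by_cases hva : v = a
    · exact Or.inl (hva ▸ ha)
    right
    obtain ⟨Y, W, hY, hW, hYW, hd⟩ := h2.split hv
    refine mem_of_reachable hb ?_ (hW.reachable (restr_le _ _)).symm
    rw [Set.disjoint_left]
    rintro x hx (hx' | hx')
    · exact haΔ x ((hYW x).2 (Or.inr hx)) hx'
    · have := h4 x ((hYW x).2 (Or.inr hx)) hx'
      subst this
      exact hva (hd x hY.start_mem hx).symm
  · intro v hv hvb
    have hvφ : v ≠ φ a := fun h => d.disj hvb (Or.inr (h ▸ h1))
    obtain ⟨Y, W, hY, hW, hYW, hd⟩ := h2.split hv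
    have : a ∈ d.beyond (A (n + 1)) := by
      refine mem_of_reachable hvb ?_ (hY.reachable (restr_le _ _)).symm
      rw [Set.disjoint_left]
      rintro x hx (hx' | hx')
      · exact haΔ x ((hYW x).2 (Or.inl hx)) hx'
      · have := h3 x ((hYW x).2 (Or.inl hx)) hx'
        subst this
        exact hvφ (hd _ hx hW.end_mem).symm
    exact d.disj (hA.anti (Nat.le_succ n) this) (Or.inr ha)

theorem hasInf_of_growing {A : ℕ → Finset V} (hΔ : d.Δ.Finite) (hA : d.Nested A)
    (hlt : ∀ n, (A n).card < (A (n + 1)).card) : HasInf G := by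
  classical
  choose φ X h using fun n => hA.exists_paths (hlt n)
  have hs : ∀ n, ∃ s ∈ A (n + 1), s ∉ (A n).image (φ n) := by
    intro n
    by_contra! hcon
    have := (Finset.card_le_card (s := A (n + 1)) hcon).trans Finset.card_image_le
    exact absurd (hlt n) (by omega)
  choose s hs hs' using hs
  obtain ⟨w, hw⟩ : ∃ w : ℕ → ℕ → V, ∀ N n, w (N + 1) n = if n < N then φ N (w N n) else s n :=
    ⟨fun N => Nat.rec s (fun N g n => if n < N then φ N (g n) else s n) N, fun N n => rfl⟩
  have hwA : ∀ N n, n < N → w N n ∈ A N := by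
    intro N
    induction N with
    | zero => simp
    | succ N ih =>
      intro n hn
      rw [hw]
      split_ifs with hnN
      · exact (h N _ (ih n hnN)).1
      · obtain rfl : n = N := by omega
        exact hs n
  have hstep : ∀ N n, n < N → w (N + 1) n = φ N (w N n) := fun N n hn => by rw [hw, if_pos hn]
  have hinj : ∀ N n n', n < n' → n' < N → w N n ≠ w N n' := by
    intro N
    induction N with
    | zero => simp
    | succ N ih =>
      intro n n' hn hn' heq
      rw [hstep N n (by omega)] at heq
      by_cases hnN : n' < N
      · rw [hstep N n' hnN] at heq
        refine ih n n' hn hnN ((h N _ (hwA N n (by omega))).2.2.2.2.2.2.2.2 _ (hwA N n' hnN)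
          (φ N (w N n)) (h N _ (hwA N n (by omega))).2.2.1 ?_)
        rw [heq]
        exact (h N _ (hwA N n' hnN)).2.2.1
      · obtain rfl : n' = N := by omega
        rw [hw, if_neg (lt_irrefl _)] at heq
        refine hs' n' (heq ▸ Finset.mem_image_of_mem _ (hwA _ _ hn))
  have hinj' : ∀ N n n', n ≠ n' → n < N → n' < N → w N n ≠ w N n' := by
    intro N n n' hne hn hn'
    rcases lt_or_gt_of_ne hne with h | h
    · exact hinj N n n' h hn'
    · exact (hinj N n' n h hn).symm
  have hdis' : ∀ N N' n n', n ≠ n' → n < N → n' < N' → N ≤ N' →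
      ∀ v ∈ X N (w N n), v ∉ X N' (w N' n') := by
    intro N N' n n' hne hn hn' hNN' v hv hv'
    have h1 := h N _ (hwA N n hn)
    have h2 := h N' _ (hwA N' n' hn')
    rcases hNN'.eq_or_lt with rfl | hlt
    · exact hinj' N n n' hne hn hn' (h1.2.2.2.2.2.2.2.2 _ (hwA N n' hn') v hv hv')
    have h3 := h2.2.2.2.2.2.2.1 v hv'
    have h4 := h1.2.2.2.2.2.2.2.1 v hv
    rcases (Nat.succ_le_of_lt hlt).eq_or_lt with rfl | hlt'
    · have h5 := h3.resolve_right h4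
      have h6 := h1.2.2.2.2.1 v hv h5
      have h7 := h2.2.2.2.2.2.1 v hv' h5
      rw [← hstep N n hn] at h6
      exact hinj' (N + 1) n n' hne (by omega) hn' (h6 ▸ h7)
    · rcases h3 with h3 | h3
      · exact h4 (hA.mem _ _ hlt' v h3)
      · exact h4 (hA.anti hlt'.le h3)
  have hdis : ∀ N N' n n', n ≠ n' → n < N → n' < N' → ∀ v ∈ X N (w N n), v ∉ X N' (w N' n') := by
    intro N N' n n' hne hn hn' v hv hv'
    rcases le_total N N' with hle | hle
    · exact hdis' N N' n n' hne hn hn' hle v hv hv'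
    · exact hdis' N' N n' n hne.symm hn' hn hle v hv' hv
  have hray : ∀ n, ∃ f, IsRay G f ∧ d.Conv f ∧ ∀ t, ∃ i, f t ∈ X (n + 1 + i) (w (n + 1 + i) n) := by
    intro n
    obtain ⟨f, hf, -, hc, hX⟩ := d.exists_conv_ray_of_chain
      (fun i => {v | v ∈ X (n + 1 + i) (w (n + 1 + i) n)}) (fun i => Finset.finite_toSet _)
      (by
        intro S hS
        obtain ⟨N, hN⟩ := hA.ω_sub hΔ hS
        refine ⟨N, fun i hi v hv => ?_⟩
        have hi' := hwA (n + 1 + i) n (by omega)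
        rcases (h _ _ hi').2.2.2.2.2.2.1 v hv with h' | h'
        · exact hN (n + i) (by omega) (hA.mem _ _ (by omega) v h')
        · exact hN (n + 1 + i) (by omega) h')
      (fun i => w (n + 1 + i) n)
      (by
        intro i
        have := (h _ _ (hwA (n + 1 + i) n (by omega))).2.1
        rwa [← hstep _ _ (by omega)] at this)
      (by
        refine Set.infinite_range_of_injective fun i j hij => ?_
        have key : ∀ i j, i < j → w (n + 1 + i) n ≠ w (n + 1 + j) n := by
          intro i j hij heq
          have h1 := hA.mem (n + 1 + i) (n + 1 + j) (by omega) _ (hwA (n + 1 + j) n (by omega))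
          exact d.disj h1 (Or.inr (heq ▸ hwA (n + 1 + i) n (by omega)))
        by_contra hne
        rcases lt_or_gt_of_ne hne with h | h
        · exact key _ _ h hij
        · exact key _ _ h hij.symm)
    exact ⟨f, hf, hc, hX⟩
  choose Q hQ hc hQX using hray
  refine hasInf_of_disjoint_rays hQ (fun n n' t t' hne heq => ?_) hc
  obtain ⟨i, hi⟩ := hQX n t
  obtain ⟨i', hi'⟩ := hQX n' t'
  exact hdis _ _ n n' hne (by omega) (by omega) _ hi (heq ▸ hi')

/-- A sequence of neighbourhoods of a direction with boundaries of bounded size. -/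
structure System (d : Dir G) (k : ℕ) (W : ℕ → Set V) (lab : ℕ → Fin k → V) : Prop where
  anti : Antitone W
  bdry : ∀ j v w, v ∉ W j → v ∉ d.Δ → w ∈ W j → G.Adj v w → ∃ a, lab j a = v
  far : ∀ i j v w, i < j → v ∉ W i → v ∉ d.Δ → w ∈ W j → ¬ G.Adj v w
  sub : ∀ S : Set V, S.Finite → ∃ J, ∀ j ≥ J, W j ⊆ d.ω S
  eq : ∀ j, ∃ T : Set V, T.Finite ∧ d.Δ ⊆ T ∧ W j = d.ω T

theorem exists_system [Countable V] (hΔ : d.Δ.Finite) (hG : ¬ HasInf G) :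
    ∃ k W lab, d.System k W lab := by
  classical
  by_cases hthick : ∀ k : ℕ, ∃ X : Finset V, ∀ A : Finset V, A.card ≤ k → ∃ x ∈ X, x ∈ d.beyond A
  · obtain ⟨A, hA, -, hlt⟩ := exists_nested (fun A A' => A.card < A'.card) (fun A Y _ => by
      obtain ⟨X, hX⟩ := hthick A.card
      obtain ⟨A', h1, -, h2, h3, h4⟩ := exists_next hΔ A (Y ∪ X) Finset.card
        (fun X => ⟨X, le_rfl, fun x hx h => d.disj h (Or.inr hx)⟩)
      refine ⟨A', h1, fun y hy => h2 y (Finset.mem_union_left _ hy), h3, h4, ?_⟩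
      by_contra! hle
      obtain ⟨x, hx, hx'⟩ := hX A' hle
      exact h2 x (Finset.mem_union_right _ hx) hx')
    exact absurd (hasInf_of_growing hΔ hA hlt) hG
  push Not at hthick
  obtain ⟨k, hk⟩ := hthick
  obtain ⟨A, hA, h0, hle⟩ := exists_nested (fun _ A' => A'.card ≤ k) (fun A Y _ => by
    obtain ⟨A', h1, ⟨-, h2⟩, h3, h4, h5⟩ := exists_next hΔ A Y (fun _ => k) hk
    exact ⟨A', h1, h3, h4, h5, h2⟩)
  have hcard : ∀ n, (A n).card ≤ k := by
    intro n
    cases n with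
    | zero => simp [h0]
    | succ n => exact hle n
  obtain ⟨z, -⟩ := d.nonempty Set.finite_empty
  have hlab : ∀ n, ∃ lab : Fin k → V, ∀ v ∈ A n, ∃ a, lab a = v := by
    intro n
    refine ⟨fun a => if h : (a : ℕ) < (A n).card then (A n).equivFin.symm ⟨a, h⟩ else z, ?_⟩
    intro v hv
    have hlt := ((A n).equivFin ⟨v, hv⟩).2
    refine ⟨⟨(A n).equivFin ⟨v, hv⟩, hlt.trans_le (hcard n)⟩, ?_⟩
    simp
  choose lab hlab using hlab
  refine ⟨k, fun n => d.beyond (A n), lab, hA.anti, ?_, ?_, fun S hS => hA.ω_sub hΔ hS,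
    fun j => ⟨_, finite_dominating_union hΔ (A j), Set.subset_union_left, rfl⟩⟩
  · intro j v w hv hvΔ hw hvw
    refine hlab j v ?_
    by_contra hvA
    exact hv (d.closed hw hvw.symm (by rintro (h | h) <;> contradiction))
  · intro i j v w hij hv hvΔ hw hvw
    by_cases hvA : v ∈ A j
    · exact hv (hA.mem i j hij v hvA)
    · exact hv (hA.anti hij.le (d.closed hw hvw.symm (by rintro (h | h) <;> contradiction)))

end Dir

namespace Dir

variable {G : SimpleGraph V} {d : Dir G} {k : ℕ} {W : ℕ → Set V} {lab : ℕ → Fin k → V}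
  {ι : Type*}

/-! ### Rerouting along rays with equal patterns -/

/-- The edges of the ray `f` touching `W j` but not `W j'`. -/
def segGraph (W : ℕ → Set V) (f : ℕ → V) (j j' : ℕ) : SimpleGraph V where
  Adj u v := (rayGraph f).Adj u v ∧ (u ∈ W j ∨ v ∈ W j) ∧ u ∉ W j' ∧ v ∉ W j'
  symm := ⟨fun _ _ h => ⟨h.1.symm, h.2.1.symm, h.2.2.2, h.2.2.1⟩⟩
  loopless := ⟨fun _ h => h.1.ne rfl⟩

/-- The boundary labels of the region between `W j` and `W j'`. -/
def bd (lab : ℕ → Fin k → V) (j j' : ℕ) (x : Bool × Fin k) : V := lab (if x.1 then j' else j) x.2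

/-- The trace of a family of rays on the region between `W j` and `W j'`. -/
def pat (W : ℕ → Set V) (lab : ℕ → Fin k → V) (e : ι → ℕ → V) (j j' : ℕ) :
    (ι → Fin k → Prop) × (ι → Bool × Fin k → Bool × Fin k → Prop) :=
  (fun c a => lab j a ∈ Set.range (e c),
    fun c x y => (segGraph W (e c) j j').Reachable (bd lab j j' x) (bd lab j j' y))

/-- A family of disjoint rays converging to `d` and avoiding the dominating vertices. -/
structure Bundle (d : Dir G) (e : ι → ℕ → V) : Prop where
  ray : ∀ c, IsRay G (e c)
  conv : ∀ c, d.Conv (e c)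
  notMem : ∀ c n, e c n ∉ d.Δ
  disj : ∀ c c' m n, c ≠ c' → e c m ≠ e c' n

theorem segGraph_le {f : ℕ → V} {j j' : ℕ} : segGraph W f j j' ≤ rayGraph f := fun _ _ h => h.1

theorem segGraph_disjoint (hW : Antitone W) {f g : ℕ → V} {a b : ℕ} (hab : a ≠ b) :
    Disjoint (segGraph W f a (a + 1)) (segGraph W g b (b + 1)) := by
  rw [SimpleGraph.disjoint_left]
  rintro u v ⟨-, h1, h2, h3⟩ ⟨-, h4, h5, h6⟩
  rcases lt_or_gt_of_ne hab with h | h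
  · have := hW (Nat.succ_le_of_lt h)
    exact h4.elim (fun h => h2 (this h)) fun h => h3 (this h)
  · have := hW (Nat.succ_le_of_lt h)
    exact h1.elim (fun h => h5 (this h)) fun h => h6 (this h)

theorem System.conv_mem (hS : d.System k W lab) {f : ℕ → V} (hf : d.Conv f) (j : ℕ) :
    ∃ N, ∀ n ≥ N, f n ∈ W j := by
  obtain ⟨T, hT, -, h⟩ := hS.eq j
  rw [h]
  exact hf T hT

theorem System.notMem (hS : d.System k W lab) (v : V) : ∃ J, ∀ j ≥ J, v ∉ W j := by
  obtain ⟨J, hJ⟩ := hS.sub {v} (Set.finite_singleton v)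
  exact ⟨J, fun j hj h => d.disj (hJ j hj h) rfl⟩

theorem System.comp (hS : d.System k W lab) {φ : ℕ → ℕ} (hφ : StrictMono φ) :
    d.System k (W ∘ φ) (lab ∘ φ) where
  anti _ _ h := hS.anti (hφ.monotone h)
  bdry j := hS.bdry (φ j)
  far i j v w hij := hS.far (φ i) (φ j) v w (hφ hij)
  sub S hS' := by
    obtain ⟨J, hJ⟩ := hS.sub S hS'
    exact ⟨J, fun j hj => hJ _ (hj.trans (hφ.id_le j))⟩
  eq j := hS.eq (φ j)

/-- Data for rerouting: at each stage a family of edge-disjoint bundles with the same patterns,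
and a finite graph attaching a root to tails of rays of members of the family. -/
structure Stages (d : Dir G) (W : ℕ → Set V) (lab : ℕ → Fin k → V) (ι : Type*) [Fintype ι]
    (Rt : V → Prop) where
  τ : (ι → Fin k → Prop) × (ι → Bool × Fin k → Bool × Fin k → Prop)
  E : ∀ a : ℕ, Fin (a + Fintype.card ι) → ι → ℕ → V
  bundle : ∀ a i, d.Bundle (E a i)
  disj : ∀ a i i' c c', i ≠ i' → Disjoint (rayGraph (E a i c)) (rayGraph (E a i' c'))
  pat_eq : ∀ a b i, a ≤ b → pat W lab (E a i) b (b + 1) = τ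
  K : ℕ → SimpleGraph V
  p : ∀ a : ℕ, ι → Fin (a + Fintype.card ι)
  t : ℕ → ι → ℕ
  root : ℕ → V
  root_spec : ∀ a, Rt (root a)
  K_le : ∀ a, K a ≤ G
  K_adj : ∀ a u v, (K a).Adj u v → (u ∈ W a ∨ v ∈ W a) ∧ u ∉ W (a + 1) ∧ v ∉ W (a + 1)
  K_disj : ∀ a i c, Disjoint (K a) (rayGraph (E a i c))
  reach : ∀ a c, (K a).Reachable (root a) (E a (p a c) c (t a c))
  tail_mem : ∀ a c, ∀ n ≥ t a c, E a (p a c) c n ∈ W a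
  start : ∀ a c, E a (p a c) c (t a c) ∉ W (a + 1) ∧ E a (p a c) c (t a c + 1) ∉ W (a + 1)

theorem exists_fin_avoiding (a : ℕ) [Fintype ι] (p : ι → Fin (a + Fintype.card ι)) :
    ∃ q : Fin a → Fin (a + Fintype.card ι), Function.Injective q ∧ ∀ x c, q x ≠ p c := by
  classical
  have h : a ≤ ((Finset.univ.image p)ᶜ).card := by
    rw [Finset.card_compl, Fintype.card_fin]
    have := (Finset.card_image_le (s := Finset.univ) (f := p))
    rw [Finset.card_univ] at this
    omega
  obtain ⟨s, hs, hsc⟩ := Finset.exists_subset_card_eq h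
  refine ⟨fun x => (s.equivFinOfCardEq hsc).symm x, fun x y hxy => ?_, fun x c hx => ?_⟩
  · exact (s.equivFinOfCardEq hsc).symm.injective (Subtype.ext hxy)
  · have := hs ((s.equivFinOfCardEq hsc).symm x).2
    simp only at hx
    rw [hx] at this
    simp at this

/-- Every edge of a ray inside `W m` lies in some region. -/
theorem System.exists_region (hS : d.System k W lab) {m u v} (hu : u ∈ W m) :
    ∃ a ≥ m, (u ∈ W a ∨ v ∈ W a) ∧ u ∉ W (a + 1) ∧ v ∉ W (a + 1) := by
  classical
  have hex : ∃ a, m ≤ a ∧ u ∉ W (a + 1) ∧ v ∉ W (a + 1) := by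
    obtain ⟨J, hJ⟩ := hS.notMem u
    obtain ⟨J', hJ'⟩ := hS.notMem v
    exact ⟨m + J + J', by omega, hJ _ (by omega), hJ' _ (by omega)⟩
  obtain ⟨h1, h2, h3⟩ := Nat.find_spec hex
  refine ⟨_, h1, ?_, h2, h3⟩
  by_contra! hcon
  have h4 : Nat.find hex ≠ m := by
    intro h
    rw [h] at hcon
    exact hcon.1 hu
  obtain ⟨b, hb⟩ : ∃ b, Nat.find hex = b + 1 := ⟨Nat.find hex - 1, by omega⟩
  refine Nat.find_min hex (m := b) (by omega) ⟨by omega, ?_⟩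
  rwa [hb] at hcon

/-- Where two edges from different regions meet, there is a boundary label. -/
theorem System.meet (hS : d.System k W lab) {v w : V} {a b : ℕ} (hv : v ∉ d.Δ)
    (hvw : G.Adj v w) (h3 : v ∉ W (a + 1)) (h4 : v ∈ W b ∨ w ∈ W b) (hab : a < b) : b = a + 1 ∧ ∃ i, lab b i = v := by
  have hb : b = a + 1 := by
    by_contra hne
    refine hS.far (a + 1) b v w (by omega) h3 hv ?_ hvw
    exact h4.resolve_left fun h => h3 (hS.anti hab h)
  subst hb
  exact ⟨rfl, hS.bdry _ v w h3 hv (h4.resolve_left h3) hvw⟩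

theorem System.meet_bd (hS : d.System k W lab) {u v w : V} {a b : ℕ} (hv : v ∉ d.Δ)
    (huv : G.Adj u v) (hvw : G.Adj v w) (h1 : u ∈ W a ∨ v ∈ W a) (h2 : u ∉ W (a + 1))
    (h3 : v ∉ W (a + 1)) (h4 : v ∈ W b ∨ w ∈ W b) (h5 : v ∉ W (b + 1)) (h6 : w ∉ W (b + 1))
    (hab : a ≠ b) :
    (∃ x, bd lab a (a + 1) x = v) ∧ ∃ y, bd lab b (b + 1) y = v := by
  rcases lt_or_gt_of_ne hab with h | h
  · obtain ⟨rfl, i, hi⟩ := hS.meet hv hvw h3 h4 h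
    exact ⟨⟨(true, i), by simpa [bd] using hi⟩, ⟨(false, i), by simpa [bd] using hi⟩⟩
  · obtain ⟨rfl, i, hi⟩ := hS.meet hv huv.symm h5 h1.symm h
    exact ⟨⟨(false, i), by simpa [bd] using hi⟩, ⟨(true, i), by simpa [bd] using hi⟩⟩

namespace Stages

variable [Fintype ι] {Rt : V → Prop} (s : Stages d W lab ι Rt)

/-- The member of the family at stage `a` used by the `m`th fan member. -/
noncomputable def idx (m a : ℕ) (c : ι) : Fin (a + Fintype.card ι) :=
  if h : m < a then (exists_fin_avoiding a (s.p a)).choose ⟨m, h⟩ else s.p a c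

theorem idx_self (m : ℕ) (c : ι) : s.idx m m c = s.p m c := by simp [idx]

theorem idx_of_lt {m a : ℕ} (h : m < a) (c c' : ι) : s.idx m a c = s.idx m a c' := by
  simp [idx, h]

theorem idx_ne {m m' a : ℕ} (hm : m ≤ a) (hm' : m' ≤ a) (h : m ≠ m') (c c' : ι) :
    s.idx m a c ≠ s.idx m' a c' := by
  have hq := (exists_fin_avoiding a (s.p a)).choose_spec
  rcases hm.eq_or_lt with rfl | hm
  · have hm' : m' < m := by omega
    simpa [idx, hm'] using (hq.2 _ c).symm
  · rcases hm'.eq_or_lt with rfl | hm'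
    · simpa [idx, hm] using hq.2 ⟨m, hm⟩ c'
    · simp only [idx, hm, hm', dite_true]
      intro heq
      have := hq.1 heq
      simp at this
      exact h this

/-- The part of the `m`th fan member in the region `m + i` of colour `c`. -/
noncomputable def part (m : ℕ) (c : ι) (i : ℕ) : SimpleGraph V :=
  segGraph W (s.E (m + i) (s.idx m (m + i) c) c) (m + i) (m + i + 1)

theorem part_zero (m : ℕ) (c : ι) :
    s.part m c 0 = segGraph W (s.E m (s.p m c) c) m (m + 1) := by
  simp [part, idx_self]

theorem part_le {m : ℕ} {c : ι} {i : ℕ} : s.part m c i ≤ G :=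
  segGraph_le.trans (rayGraph_le ((s.bundle _ _).ray c))

theorem segGraph_le_iSup {m a : ℕ} (hma : m ≤ a) (c : ι) :
    segGraph W (s.E a (s.idx m a c) c) a (a + 1) ≤ ⨆ i, s.part m c i := by
  obtain ⟨i, rfl⟩ := Nat.exists_eq_add_of_le hma
  exact le_iSup (s.part m c) i

theorem transfer {m a : ℕ} (hma : m ≤ a) (i : Fin (m + Fintype.card ι))
    (i' : Fin (a + Fintype.card ι)) (c : ι) {x y : Bool × Fin k}
    (h : (segGraph W (s.E m i c) a (a + 1)).Reachable (bd lab a (a + 1) x) (bd lab a (a + 1) y)) :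
    (segGraph W (s.E a i' c) a (a + 1)).Reachable (bd lab a (a + 1) x) (bd lab a (a + 1) y) := by
  have := (s.pat_eq m a i hma).trans (s.pat_eq a a i' le_rfl).symm
  have := congrFun (congrFun (congrFun (congrArg Prod.snd this) c) x) y
  exact this.mp h

theorem infinite_component (hS : d.System k W lab) (m : ℕ) (c : ι) :
    {v | (⨆ i, s.part m c i).Reachable (s.E m (s.p m c) c (s.t m c)) v}.Infinite := by
  set f := s.E m (s.p m c) c with hf
  set t₀ := s.t m c with ht₀
  set H := ⨆ i, s.part m c i with hH
  have hB := s.bundle m (s.p m c)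
  have hfr : IsRay G f := hB.ray c
  have hfW : ∀ n ≥ t₀, f n ∈ W m := s.tail_mem m c
  have hseg : segGraph W f m (m + 1) ≤ H := by
    rw [hf, ← s.part_zero]
    exact le_iSup (s.part m c) 0
  have hreg : ∀ n, ∃ a, n ≥ t₀ → a ≥ m ∧ (f n ∈ W a ∨ f (n + 1) ∈ W a) ∧ f n ∉ W (a + 1) ∧
      f (n + 1) ∉ W (a + 1) := by
    intro n
    by_cases hn : n ≥ t₀
    · obtain ⟨a, ha⟩ := hS.exists_region (v := f (n + 1)) (hfW n hn)
      exact ⟨a, fun _ => ha⟩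
    · exact ⟨0, fun h => absurd h hn⟩
  choose r hr using hreg
  have hadj : ∀ n ≥ t₀, (segGraph W f (r n) (r n + 1)).Adj (f n) (f (n + 1)) := fun n hn =>
    ⟨rayGraph_adj hfr n, (hr n hn).2⟩
  have hchange : ∀ n ≥ t₀, r n ≠ r (n + 1) → (∃ x, bd lab (r n) (r n + 1) x = f (n + 1)) ∧
      ∃ x, bd lab (r (n + 1)) (r (n + 1) + 1) x = f (n + 1) := by
    intro n hn hne
    have h1 := hr n hn
    have h2 := hr (n + 1) (by omega)
    exact hS.meet_bd (hB.notMem c (n + 1)) (hfr.2 n)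
      (hfr.2 (n + 1)) h1.2.1 h1.2.2.1 h1.2.2.2 h2.2.1 h2.2.2.1 h2.2.2.2 hne
  have hstep : ∀ n ≥ t₀, r n ≠ r (n + 1) → ((r n = m ∧ H.Reachable (f t₀) (f n)) ∨
      ∃ x, H.Reachable (f t₀) (bd lab (r n) (r n + 1) x) ∧
        (segGraph W f (r n) (r n + 1)).Reachable (bd lab (r n) (r n + 1) x) (f n)) →
      H.Reachable (f t₀) (f (n + 1)) := by
    rintro n hn hne (⟨h1, h2⟩ | ⟨x, h1, h2⟩)
    · refine h2.trans (Adj.reachable (hseg ?_))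
      have := hadj n hn
      rwa [h1] at this
    · obtain ⟨⟨y, hy⟩, -⟩ := hchange n hn hne
      have h3 := h2.trans (hadj n hn).reachable
      rw [← hy] at h3 ⊢
      have hmr := (hr n hn).1
      exact h1.trans ((s.transfer hmr _ (s.idx m (r n) c) c h3).mono (s.segGraph_le_iSup hmr c))
  have hinv : ∀ n ≥ t₀, (r n = m ∧ H.Reachable (f t₀) (f n)) ∨
      ∃ x, H.Reachable (f t₀) (bd lab (r n) (r n + 1) x) ∧
        (segGraph W f (r n) (r n + 1)).Reachable (bd lab (r n) (r n + 1) x) (f n) := by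
    intro n hn
    induction n, hn using Nat.le_induction with
    | base =>
      refine Or.inl ⟨?_, Reachable.refl _⟩
      have h1 := hr t₀ le_rfl
      by_contra hne
      have h2 := hS.anti (show m + 1 ≤ r t₀ by omega)
      exact h1.2.1.elim (fun h => (s.start m c).1 (h2 h)) fun h => (s.start m c).2 (h2 h)
    | succ n hn ih =>
      by_cases hne : r n = r (n + 1)
      · rw [← hne]
        rcases ih with ⟨h1, h2⟩ | ⟨x, h1, h2⟩
        · refine Or.inl ⟨h1, h2.trans (Adj.reachable (hseg ?_))⟩
          have := hadj n hn
          rwa [h1] at this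
        · exact Or.inr ⟨x, h1, h2.trans (hadj n hn).reachable⟩
      · have h1 := hstep n hn hne ih
        obtain ⟨-, y, hy⟩ := hchange n hn hne
        exact Or.inr ⟨y, hy ▸ h1, hy ▸ Reachable.refl _⟩
  have hunb : ∀ T ≥ t₀, ∃ n ≥ T, r n ≠ r (n + 1) := by
    intro T hT
    by_contra! hcon
    have hconst : ∀ n ≥ T, r n = r T := by
      intro n hn
      induction n, hn using Nat.le_induction with
      | base => rfl
      | succ n hn ih => rw [← hcon n hn, ih]
    obtain ⟨N, hN⟩ := hS.conv_mem (hB.conv c) (r T + 1)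
    have := (hr (N + T) (by omega)).2.2.1
    rw [hconst _ (by omega)] at this
    exact this (hN _ (by omega))
  have hinf : {n | H.Reachable (f t₀) (f n)}.Infinite := by
    refine Set.infinite_of_not_bddAbove ?_
    rintro ⟨N, hN⟩
    obtain ⟨n, hn, hne⟩ := hunb (N + t₀) (by omega)
    have := hN (hstep n (by omega) hne (hinv n (by omega)))
    omega
  refine (hinf.image (f := f) hfr.1.injOn).mono ?_
  rintro _ ⟨n, hn, rfl⟩
  exact hn

theorem notMem_of_part {m : ℕ} {c : ι} {i : ℕ} {u v : V} (h : (s.part m c i).Adj u v) :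
    u ∈ Set.range (s.E (m + i) (s.idx m (m + i) c) c) ∧ u ∉ d.Δ := by
  obtain ⟨n, ⟨rfl, -⟩ | ⟨-, rfl⟩⟩ := adj_of_rayGraph h.1
  · exact ⟨⟨_, rfl⟩, (s.bundle _ _).notMem _ _⟩
  · exact ⟨⟨_, rfl⟩, (s.bundle _ _).notMem _ _⟩

theorem mem_of_part (hS : d.System k W lab) {m : ℕ} {c : ι} {i j : ℕ} {u v : V}
    (h : (s.part m c i).Adj u v) (hj : j < m + i) : u ∈ W j := by
  by_contra hu
  have h1 := h.2.1.resolve_left fun h => hu (hS.anti hj.le h)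
  exact hS.far _ _ _ _ hj hu (s.notMem_of_part h).2 h1 (s.part_le h)

theorem exists_ray (hS : d.System k W lab) (m : ℕ) (c : ι) :
    ∃ f, IsRay (⨆ i, s.part m c i) f ∧ d.Conv f ∧
      (⨆ i, s.part m c i).Reachable (s.E m (s.p m c) c (s.t m c)) (f 0) ∧
      ∀ n, ∃ i ≥ 1, (s.part m c i).Adj (f n) (f (n + 1)) := by
  obtain ⟨f, hf, hf0, hI⟩ := exists_ray_iSup (s.part m c) (by
    intro i
    set g := s.E (m + i) (s.idx m (m + i) c) c
    have hB := s.bundle (m + i) (s.idx m (m + i) c)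
    obtain ⟨N, hN⟩ := hS.conv_mem (hB.conv c) (m + i + 1)
    refine ((Set.finite_Iio N).image fun n => s(g n, g (n + 1))).subset ?_
    intro e
    induction e with
    | h u v =>
      rintro ⟨h1, -, h2, h3⟩
      obtain ⟨n, ⟨rfl, rfl⟩ | ⟨rfl, rfl⟩⟩ := adj_of_rayGraph h1
      · exact ⟨n, not_le.1 fun h => h2 (hN _ h), rfl⟩
      · exact ⟨n, not_le.1 fun h => h3 (hN _ h), Sym2.eq_swap⟩) (by
    intro v
    obtain ⟨J, hJ⟩ := hS.notMem v
    refine (Set.finite_Iic J).subset ?_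
    rintro i ⟨w, hw⟩
    by_contra hi
    simp only [Set.mem_Iic, not_le] at hi
    exact hJ J le_rfl (s.mem_of_part hS hw (by omega))) (s.infinite_component hS m c)
  obtain ⟨N, hN⟩ := hI 1
  refine ⟨_, hf.tail N, ?_, ?_, fun n => hN (N + n) (by omega)⟩
  · intro S hS'
    obtain ⟨J, hJ⟩ := hS.sub S hS'
    obtain ⟨M, hM⟩ := hI (J + 1)
    refine ⟨M, fun n hn => ?_⟩
    obtain ⟨i, hi, h⟩ := hM (N + n) (by omega)
    exact hJ J le_rfl (s.mem_of_part hS h (by omega))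
  · have := ray_reachable hf (X := Set.univ) (Nat.zero_le N) (by simp)
    rw [hf0] at this
    exact this.mono (restr_le _ _)

theorem part_disjoint (hS : d.System k W lab) {m : ℕ} {c c' : ι} (hcc : c ≠ c') {i i' : ℕ}
    (hi : i ≥ 1) (hii : i ≤ i') {u v w : V} (h : (s.part m c i).Adj v u)
    (h' : (s.part m c' i').Adj v w) : False := by
  obtain ⟨⟨n, hn⟩, hv⟩ := s.notMem_of_part h
  obtain ⟨⟨n', hn'⟩, -⟩ := s.notMem_of_part h'
  rcases hii.eq_or_lt with rfl | hlt
  · rw [s.idx_of_lt (by omega) c' c] at hn'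
    exact (s.bundle _ _).disj c c' n n' hcc (hn.trans hn'.symm)
  · obtain ⟨h1, a, ha⟩ := hS.meet hv (s.part_le h') h.2.2.1 h'.2.1 (by omega)
    obtain rfl : i' = i + 1 := by omega
    have hc := (s.pat_eq (m + i) (m + (i + 1)) (s.idx m (m + i) c) (by omega)).trans
      (s.pat_eq _ _ (s.idx m (m + (i + 1)) c') le_rfl).symm
    have hc := congrFun (congrFun (congrArg Prod.fst hc) c) a
    obtain ⟨n'', hn''⟩ := hc.mp ⟨n, by rw [ha, hn]⟩
    exact (s.bundle _ _).disj c c' n'' n' hcc (by rw [hn'', hn', ha])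

/-- The fan members produced by the stages. -/
theorem exists_fan (s : Stages d W lab ι Rt) (hS : d.System k W lab) : ∃ H : ℕ → SimpleGraph V, (∀ m, H m ≤ G) ∧
    (Pairwise fun i j => Disjoint (H i) (H j)) ∧
    (∀ m u v, (H m).Adj u v → u ∈ W 0 ∨ v ∈ W 0) ∧
    ∀ m, ∃ r, Rt r ∧ ∃ R : ι → ℕ → V, ∀ c, IsRay (H m) (R c) ∧ d.Conv (R c) ∧
      (H m).Reachable r (R c 0) ∧ ∀ c' n n', c ≠ c' → R c n ≠ R c' n' := by
  let H : ℕ → SimpleGraph V := fun m => s.K m ⊔ ⨆ c, ⨆ i, s.part m c i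
  have hadj : ∀ m u v, (H m).Adj u v → (s.K m).Adj u v ∨ ∃ c i, (s.part m c i).Adj u v := by
    intro m u v h
    rcases h with h | h
    · exact Or.inl h
    · simp only [iSup_adj] at h
      exact Or.inr h
  have hsub : ∀ m c, ⨆ i, s.part m c i ≤ H m := fun m c =>
    (le_iSup (fun c => ⨆ i, s.part m c i) c).trans le_sup_right
  have hKseg : ∀ a b (f : ℕ → V), a ≠ b → Disjoint (s.K a) (segGraph W f b (b + 1)) := by
    intro a b f hab
    rw [SimpleGraph.disjoint_left]
    rintro u v h ⟨-, h4, h5, h6⟩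
    obtain ⟨h1, h2, h3⟩ := s.K_adj a u v h
    rcases lt_or_gt_of_ne hab with h | h
    · have := hS.anti (Nat.succ_le_of_lt h)
      exact h4.elim (fun h => h2 (this h)) fun h => h3 (this h)
    · have := hS.anti (Nat.succ_le_of_lt h)
      exact h1.elim (fun h => h5 (this h)) fun h => h6 (this h)
  have hKK : ∀ a b, a < b → Disjoint (s.K a) (s.K b) := by
    intro a b hab
    rw [SimpleGraph.disjoint_left]
    intro u v h h'
    obtain ⟨h1, h2, h3⟩ := s.K_adj a u v h
    have := hS.anti (Nat.succ_le_of_lt hab)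
    exact (s.K_adj b u v h').1.elim (fun h => h2 (this h)) fun h => h3 (this h)
  have hKpart : ∀ a m c i, a ≠ m → Disjoint (s.K a) (s.part m c i) := by
    intro a m c i ham
    by_cases h : a = m + i
    · subst h
      exact (s.K_disj _ _ c).mono_right segGraph_le
    · exact hKseg _ _ _ h
  have hpp : ∀ m m' c c' i i', m ≠ m' → Disjoint (s.part m c i) (s.part m' c' i') := by
    intro m m' c c' i i' hmm
    by_cases h : m + i = m' + i'
    · have h1 : s.part m' c' i' = segGraph W (s.E (m + i) (s.idx m' (m + i) c') c') (m + i)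
          (m + i + 1) := by rw [part, h]
      rw [h1]
      exact (s.disj (m + i) _ _ _ _ (s.idx_ne (by omega) (by omega) hmm _ _)).mono segGraph_le
        segGraph_le
    · exact segGraph_disjoint hS.anti h
  refine ⟨H, ?_, ?_, ?_, ?_⟩
  · exact fun m => sup_le (s.K_le m) (iSup_le fun c => iSup_le fun i => s.part_le)
  · intro m m' hmm
    rw [SimpleGraph.disjoint_left]
    intro u v h h'
    rcases hadj m u v h with h | ⟨c, i, h⟩ <;> rcases hadj m' u v h' with h' | ⟨c', i', h'⟩
    · rcases lt_or_gt_of_ne hmm with hlt | hlt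
      · exact SimpleGraph.disjoint_left.1 (hKK _ _ hlt) _ _ h h'
      · exact SimpleGraph.disjoint_left.1 (hKK _ _ hlt) _ _ h' h
    · exact SimpleGraph.disjoint_left.1 (hKpart _ _ _ _ hmm) _ _ h h'
    · exact SimpleGraph.disjoint_left.1 (hKpart _ _ _ _ hmm.symm) _ _ h' h
    · exact SimpleGraph.disjoint_left.1 (hpp _ _ _ _ _ _ hmm) _ _ h h'
  · intro m u v h
    rcases hadj m u v h with h | ⟨c, i, h⟩
    · exact (s.K_adj m u v h).1.imp (fun h => hS.anti (Nat.zero_le _) h)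
        fun h => hS.anti (Nat.zero_le _) h
    · exact h.2.1.imp (fun h => hS.anti (Nat.zero_le _) h) fun h => hS.anti (Nat.zero_le _) h
  · intro m
    choose R hR hc hreach hpart using fun c => s.exists_ray hS m c
    refine ⟨s.root m, s.root_spec m, R, fun c => ⟨(hR c).mono (hsub m c), hc c, ?_, ?_⟩⟩
    · exact ((s.reach m c).mono le_sup_left).trans ((hreach c).mono (hsub m c))
    · intro c' n n' hcc heq
      obtain ⟨i, hi, h⟩ := hpart c n
      obtain ⟨i', hi', h'⟩ := hpart c' n'
      rcases le_total i i' with hle | hle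
      · exact s.part_disjoint hS hcc hi hle h (heq ▸ h')
      · exact s.part_disjoint hS hcc.symm hi' hle h' (heq ▸ h)

end Stages

end Dir

namespace Dir

variable {G : SimpleGraph V} {d : Dir G} {k : ℕ} {W : ℕ → Set V} {lab : ℕ → Fin k → V}
  {ι : Type*}

theorem exists_eventually_eq {α β : Type*} [Finite β] (𝒰 : Ultrafilter α) (f : α → β) :
    ∃ b, ∀ᶠ a in 𝒰, f a = b := by
  obtain ⟨b, hb⟩ := Ultrafilter.eq_pure_of_finite (𝒰.map f)
  refine ⟨b, ?_⟩
  have : {b} ∈ 𝒰.map f := by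
    rw [hb]
    exact rfl
  exact this

theorem pat_comp (e : ι → ℕ → V) (φ : ℕ → ℕ) (j j' : ℕ) :
    pat (W ∘ φ) (lab ∘ φ) e j j' = pat W lab e (φ j) (φ j') := by
  have : bd (lab ∘ φ) j j' = bd lab (φ j) (φ j') := by
    funext x
    simp only [bd, Function.comp_apply, apply_ite φ]
  unfold pat
  rw [this]
  rfl

/-- A finite graph touching `U` which attaches a root to tails in `U` of some of the bundles. -/
structure Gadget (G : SimpleGraph V) (Rt : V → Prop) (U : Set V) {n : ℕ}
    (E : Fin n → ι → ℕ → V) where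
  K : SimpleGraph V
  p : ι → Fin n
  t : ι → ℕ
  root : V
  root_spec : Rt root
  le : K ≤ G
  finite : K.edgeSet.Finite
  touch : ∀ u v, K.Adj u v → u ∈ U ∨ v ∈ U
  disj : ∀ x c, Disjoint K (rayGraph (E x c))
  reach : ∀ c, K.Reachable root (E (p c) c (t c))
  tail_mem : ∀ c, ∀ n ≥ t c, E (p c) c n ∈ U

theorem System.eventually_notMem (hS : d.System k W lab) (v : V) :
    ∀ᶠ j in (Filter.hyperfilter ℕ : Filter ℕ), v ∉ W j := by
  obtain ⟨J, hJ⟩ := hS.notMem v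
  exact Nat.hyperfilter_le_atTop (Filter.eventually_atTop.2 ⟨J, hJ⟩)

theorem exists_stages [Fintype ι] [Nonempty ι] {I : Type*} (hS : d.System k W lab)
    (𝒰 : Ultrafilter I) (e : I → ι → ℕ → V) (hB : ∀ᶠ i in 𝒰, d.Bundle (e i))
    (hlarge : ∀ P ∈ 𝒰, ∀ n, ∃ F : Fin n → I, (∀ x, F x ∈ P) ∧
      ∀ x y c c', x ≠ y → Disjoint (rayGraph (e (F x) c)) (rayGraph (e (F y) c')))
    (Rt : V → Prop)
    (hgad : ∀ j n, 0 < n → ∀ E : Fin n → ι → ℕ → V, (∀ x, d.Bundle (E x)) →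
      Nonempty (Gadget G Rt (W j) E)) :
    ∃ φ : ℕ → ℕ, StrictMono φ ∧ Nonempty (Stages d (W ∘ φ) (lab ∘ φ) ι Rt) := by
  have h1 : ∀ i, ∃ τ, ∀ᶠ j in (Filter.hyperfilter ℕ : Filter ℕ),
      ∀ᶠ j' in (Filter.hyperfilter ℕ : Filter ℕ), pat W lab (e i) j j' = τ := by
    intro i
    choose τ hτ using fun j => exists_eventually_eq (Filter.hyperfilter ℕ) (pat W lab (e i) j)
    obtain ⟨σ, hσ⟩ := exists_eventually_eq (Filter.hyperfilter ℕ) τ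
    refine ⟨σ, hσ.mono fun j hj => ?_⟩
    rw [← hj]
    exact hτ j
  choose τi hτi using h1
  obtain ⟨τ, hτ⟩ := exists_eventually_eq 𝒰 τi
  choose F hF hFd using fun a => hlarge _ (hB.and hτ) (a + Fintype.card ι)
  have hEB : ∀ a x, d.Bundle (e (F a x)) := fun a x => (hF a x).1
  have hEτ : ∀ a x, ∀ᶠ j in (Filter.hyperfilter ℕ : Filter ℕ),
      ∀ᶠ j' in (Filter.hyperfilter ℕ : Filter ℕ), pat W lab (e (F a x)) j j' = τ := by
    intro a x
    have := hτi (F a x)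
    rwa [show τi (F a x) = τ from (hF a x).2] at this
  have hg := fun m j => hgad j (m + Fintype.card ι) (by have := Fintype.card_pos (α := ι); omega)
    (fun x => e (F m x)) (hEB m)
  let g := fun m j => (hg m j).some
  obtain ⟨j₀, hj₀⟩ : ∃ j₀, ∀ a ∈ Set.Iic 0, ∀ x, ∀ᶠ j' in (Filter.hyperfilter ℕ : Filter ℕ),
      pat W lab (e (F a x)) j₀ j' = τ := by
    refine Filter.Eventually.exists (f := (Filter.hyperfilter ℕ : Filter ℕ)) ?_
    rw [Filter.eventually_all_finite (Set.finite_Iic 0)]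
    exact fun a _ => Filter.eventually_all.2 (hEτ a)
  obtain ⟨φ, -, hP, hR⟩ := exists_seq_of_step
    (fun m j => ∀ a ∈ Set.Iic m, ∀ x, ∀ᶠ j' in (Filter.hyperfilter ℕ : Filter ℕ),
      pat W lab (e (F a x)) j j' = τ)
    (fun m j j' => j < j' ∧ (∀ a ∈ Set.Iic m, ∀ x, pat W lab (e (F a x)) j j' = τ) ∧
      (∀ s ∈ (g m j).K.edgeSet, ∀ v ∈ s, v ∉ W j') ∧
      ∀ c, e (F m ((g m j).p c)) c ((g m j).t c) ∉ W j' ∧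
        e (F m ((g m j).p c)) c ((g m j).t c + 1) ∉ W j') hj₀ (by
    intro m j hj
    refine Filter.Eventually.exists (f := (Filter.hyperfilter ℕ : Filter ℕ)) ?_
    refine Filter.Eventually.and ?_ (.and ?_ (.and ?_ (.and ?_ ?_)))
    · rw [Filter.eventually_all_finite (Set.finite_Iic _)]
      exact fun a _ => Filter.eventually_all.2 (hEτ a)
    · exact Nat.hyperfilter_le_atTop (Filter.eventually_gt_atTop j)
    · rw [Filter.eventually_all_finite (Set.finite_Iic _)]
      exact fun a ha => Filter.eventually_all.2 (hj a ha)
    · rw [Filter.eventually_all_finite (g m j).finite]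
      intro s hs
      induction s with
      | h u v =>
        filter_upwards [hS.eventually_notMem u, hS.eventually_notMem v] with j' hu hv w hw
        rcases Sym2.mem_iff.1 hw with rfl | rfl <;> assumption
    · exact Filter.eventually_all.2 fun c => (hS.eventually_notMem _).and (hS.eventually_notMem _))
  have hmono : StrictMono φ := strictMono_nat_of_lt_succ fun m => (hR m).1
  refine ⟨φ, hmono, ⟨{
    τ := τ
    E := fun a x => e (F a x)
    bundle := hEB
    disj := fun a i i' c c' h => hFd a i i' c c' h
    pat_eq := fun a b i hab => by
      rw [pat_comp]
      exact (hR b).2.1 a hab i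
    K := fun a => (g a (φ a)).K
    p := fun a => (g a (φ a)).p
    t := fun a => (g a (φ a)).t
    root := fun a => (g a (φ a)).root
    root_spec := fun a => (g a (φ a)).root_spec
    K_le := fun a => (g a (φ a)).le
    K_adj := fun a u v h => ⟨(g a (φ a)).touch u v h, (hR a).2.2.1 s(u, v) h u (by simp),
      (hR a).2.2.1 s(u, v) h v (by simp)⟩
    K_disj := fun a i c => (g a (φ a)).disj i c
    reach := fun a c => (g a (φ a)).reach c
    tail_mem := fun a c => (g a (φ a)).tail_mem c
    start := fun a c => (hR a).2.2.2 c }⟩⟩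

theorem exists_fan_of_gadgets [Fintype ι] [Nonempty ι] {I : Type*} (hS : d.System k W lab)
    (𝒰 : Ultrafilter I) (e : I → ι → ℕ → V) (hB : ∀ᶠ i in 𝒰, d.Bundle (e i))
    (hlarge : ∀ P ∈ 𝒰, ∀ n, ∃ F : Fin n → I, (∀ x, F x ∈ P) ∧
      ∀ x y c c', x ≠ y → Disjoint (rayGraph (e (F x) c)) (rayGraph (e (F y) c')))
    (Rt : V → Prop)
    (hgad : ∀ j n, 0 < n → ∀ E : Fin n → ι → ℕ → V, (∀ x, d.Bundle (E x)) →
      Nonempty (Gadget G Rt (W j) E)) :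
    ∃ H : ℕ → SimpleGraph V, (∀ m, H m ≤ G) ∧
    (Pairwise fun i j => Disjoint (H i) (H j)) ∧
    (∀ m u v, (H m).Adj u v → u ∈ W 0 ∨ v ∈ W 0) ∧
    ∀ m, ∃ r, Rt r ∧ ∃ R : ι → ℕ → V, ∀ c, IsRay (H m) (R c) ∧ d.Conv (R c) ∧
      (H m).Reachable r (R c 0) ∧ ∀ c' n n', c ≠ c' → R c n ≠ R c' n' := by
  obtain ⟨φ, hφ, ⟨s⟩⟩ := exists_stages hS 𝒰 e hB hlarge Rt hgad
  obtain ⟨H, h1, h2, h3, h4⟩ := s.exists_fan (hS.comp hφ)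
  have := hS.anti (Nat.zero_le (φ 0))
  exact ⟨H, h1, h2, fun m u v h => (h3 m u v h).imp (@this _) (@this _), h4⟩

end Dir

/-! ### Fans and chains -/

/-- Edges of `G` meeting `U`. -/
def touching (G : SimpleGraph V) (U : Set V) : SimpleGraph V where
  Adj u v := G.Adj u v ∧ (u ∈ U ∨ v ∈ U)
  symm := ⟨fun _ _ h => ⟨h.1.symm, h.2.symm⟩⟩
  loopless := ⟨fun _ h => h.1.ne rfl⟩

theorem touching_le (G : SimpleGraph V) (U : Set V) : touching G U ≤ G := fun _ _ h => h.1

theorem disjoint_touching_restr {G : SimpleGraph V} {U X : Set V} (h : Disjoint U X) :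
    Disjoint (touching G U) (restr G X) := by
  rw [SimpleGraph.disjoint_left]
  rintro u v ⟨-, h1⟩ ⟨-, h2, h3⟩
  exact h1.elim (fun h1 => Set.disjoint_left.1 h h1 h2) fun h1 => Set.disjoint_left.1 h h1 h3

/-- `x` and `y` are joined in `A` avoiding any given finite set of edges. -/
def Links (A : SimpleGraph V) (x y : V) : Prop :=
  ∀ F : Set (Sym2 V), F.Finite → ∃ C, (C ≤ A ∧ C.Reachable x y) ∧ C.edgeSet.Finite ∧
    Disjoint C.edgeSet F

namespace Dir

variable {G : SimpleGraph V} {d d' : Dir G}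

/-- Infinitely many edge-disjoint connections in `A` from `x` to the direction `d`. -/
def Fan (d : Dir G) (A : SimpleGraph V) (x : V) : Prop :=
  ∃ H : ℕ → SimpleGraph V, (∀ m, H m ≤ A) ∧ (Pairwise fun i j => Disjoint (H i) (H j)) ∧
    ∀ m, ∃ R, IsRay (H m) R ∧ d.Conv R ∧ (H m).Reachable x (R 0)

/-- A sequence of vertices starting in `x` and converging to `d` such that consecutive vertices are
joined by infinitely many edge-disjoint connected graphs in `A`, in a locally finite manner. -/
def Chain (d : Dir G) (A : SimpleGraph V) (x : V) : Prop :=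
  ∃ (u : ℕ → V) (N : V → ℕ), u 0 = x ∧ d.Conv u ∧ ∀ n, ∀ F : Set (Sym2 V), F.Finite →
    ∃ C, (C ≤ A ∧ C.Reachable (u n) (u (n + 1)) ∧
      ∀ v w, C.Adj v w → C.Reachable (u n) v ∧ n < N v) ∧ C.edgeSet.Finite ∧ Disjoint C.edgeSet F

theorem Conv.infinite_range {u : ℕ → V} (hu : d.Conv u) : (Set.range u).Infinite := by
  intro hfin
  obtain ⟨N, hN⟩ := hu _ hfin
  exact d.disj (hN N le_rfl) ⟨N, rfl⟩

/-- Rays converging to separated directions and starting in the same component yield a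
double ray. -/
theorem exists_doubleRay_of_conv {S : Set V} (hS : S.Finite) (hd : Disjoint (d.ω S) (d'.ω S))
    {H : SimpleGraph V} {f g : ℕ → V} (hf : IsRay H f) (hg : IsRay H g) (hfc : d.Conv f)
    (hgc : d'.Conv g) (h : H.Reachable (f 0) (g 0)) : ∃ D, IsDoubleRay H D := by
  obtain ⟨s, hs⟩ := hfc S hS
  obtain ⟨t, ht⟩ := hgc S hS
  have hr : ∀ {f : ℕ → V}, IsRay H f → ∀ s, H.Reachable (f 0) (f s) := fun hf s =>
    (ray_reachable hf (X := Set.univ) (Nat.zero_le s) (by simp)).mono (restr_le _ _)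
  refine exists_doubleRay_of_rays (hf.tail s) (hg.tail t) (fun m n hmn => ?_)
    ((hr hf s).symm.trans (h.trans (hr hg t)))
  exact Set.disjoint_left.1 hd (hs (s + m) (by omega)) (hmn ▸ ht (t + n) (by omega))

theorem Fan.mono {A A' : SimpleGraph V} {x : V} (h : d.Fan A x) (hA : A ≤ A') : d.Fan A' x := by
  obtain ⟨H, h1, h2⟩ := h
  exact ⟨H, fun m => (h1 m).trans hA, h2⟩

theorem Fan.hasInf {S : Set V} (hS : S.Finite) (hd : Disjoint (d.ω S) (d'.ω S))
    {A A' : SimpleGraph V} (hA : A ≤ G) (hA' : A' ≤ G) (hAA : Disjoint A A') {x : V}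
    (h : d.Fan A x) (h' : d'.Fan A' x) : HasInf G := by
  obtain ⟨H, h1, h2, h3⟩ := h
  obtain ⟨H', h1', h2', h3'⟩ := h'
  refine hasInf_of_disjoint (fun m => H m ⊔ H' m)
    (fun m => sup_le ((h1 m).trans hA) ((h1' m).trans hA')) ?_ ?_
  · intro i j hij
    have h4 := hAA.mono (h1 i) (h1' j)
    have h5 := hAA.mono (h1 j) (h1' i)
    exact disjoint_sup_left.2 ⟨disjoint_sup_right.2 ⟨h2 hij, h4⟩,
      disjoint_sup_right.2 ⟨h5.symm, h2' hij⟩⟩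
  · intro m
    obtain ⟨R, hR, hc, hr⟩ := h3 m
    obtain ⟨R', hR', hc', hr'⟩ := h3' m
    exact exists_doubleRay_of_conv hS hd (hR.mono le_sup_left) (hR'.mono le_sup_right) hc hc'
      ((hr.mono le_sup_left).symm.trans (hr'.mono le_sup_right))

theorem Fan.prepend {A A' : SimpleGraph V} (hAA : Disjoint A A') {x y : V} (h : d.Fan A y)
    (hl : Links A' x y) : d.Fan (A ⊔ A') x := by
  obtain ⟨H, h1, h2, h3⟩ := h
  obtain ⟨C, hC, -, hd⟩ := exists_disjoint_seq (fun _ C => C ≤ A' ∧ C.Reachable x y)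
    (fun _ => hl)
  refine ⟨fun m => H m ⊔ C m, fun m => sup_le_sup (h1 m) (hC m).1, ?_, ?_⟩
  · intro i j hij
    have h4 := hAA.mono (h1 i) (hC j).1
    have h5 := hAA.mono (h1 j) (hC i).1
    exact disjoint_sup_left.2 ⟨disjoint_sup_right.2 ⟨h2 hij, h4⟩,
      disjoint_sup_right.2 ⟨h5.symm, hd hij⟩⟩
  · intro m
    obtain ⟨R, hR, hc, hr⟩ := h3 m
    exact ⟨R, hR.mono le_sup_left, hc, ((hC m).2.mono le_sup_right).trans (hr.mono le_sup_left)⟩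

theorem exists_ray_of_links {u : ℕ → V} {N : V → ℕ} (hu : d.Conv u) {C : ℕ → SimpleGraph V}
    (hCG : ∀ n, C n ≤ G)
    (hC : ∀ n, (C n).Reachable (u n) (u (n + 1)) ∧
      ∀ v w, (C n).Adj v w → (C n).Reachable (u n) v ∧ n < N v)
    (hfin : ∀ n, (C n).edgeSet.Finite) :
    ∃ f, IsRay (⨆ n, C n) f ∧ f 0 = u 0 ∧ d.Conv f := by
  obtain ⟨f, hf, hf0, hI⟩ := exists_ray_of_chain C hfin (fun v => by
    refine (Set.finite_Iio (N v)).subset ?_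
    rintro i ⟨w, hw⟩
    exact ((hC i).2 v w hw).2) u (fun n => (hC n).1) hu.infinite_range
  refine ⟨f, hf, hf0, fun S hS => ?_⟩
  obtain ⟨J, hJ⟩ := hu S hS
  obtain ⟨M, hM⟩ := (hS.image N).bddAbove
  obtain ⟨n₀, hn₀⟩ := hI (J + M)
  refine ⟨n₀, fun n hn => ?_⟩
  obtain ⟨i, hi, h⟩ := hn₀ n hn
  refine reachable_induct ((hC i).2 _ _ h).1 (hJ i (by omega)) fun a b hab ha => ?_
  refine d.closed ha (hCG i hab) fun hb => ?_
  have h1 := ((hC i).2 b a hab.symm).2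
  have h2 := hM ⟨b, hb, rfl⟩
  omega

theorem Chain.fan {A : SimpleGraph V} (hA : A ≤ G) {x : V} (h : d.Chain A x) : d.Fan A x := by
  obtain ⟨u, N, rfl, hu, h⟩ := h
  obtain ⟨C, h1, h2, h3⟩ := exists_disjoint_family (ι := ℕ × ℕ) _ fun t => h t.2
  refine ⟨fun m => ⨆ n, C (m, n), fun m => iSup_le fun n => (h1 (m, n)).1, ?_, ?_⟩
  · intro i j hij
    refine disjoint_iSup_iff.2 fun n => (disjoint_iSup_iff.2 fun n' => ?_).symm
    exact h3 (by simp [Ne.symm hij])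
  · intro m
    obtain ⟨f, hf, hf0, hc⟩ := exists_ray_of_links hu (fun n => (h1 (m, n)).1.trans hA)
      (fun n => (h1 (m, n)).2) fun n => h2 (m, n)
    exact ⟨f, hf, hc, hf0 ▸ Reachable.refl _⟩

theorem Chain.hasInf {S : Set V} (hS : S.Finite) (hd : Disjoint (d.ω S) (d'.ω S)) {x y : V}
    (h : d.Chain G x) (h' : d'.Chain G y) (hl : Links G x y) : HasInf G := by
  obtain ⟨u, N, rfl, hu, h⟩ := h
  obtain ⟨u', N', rfl, hu', h'⟩ := h'
  obtain ⟨C, h1, h2, h3⟩ := exists_disjoint_family (ι := ℕ × (Unit ⊕ ℕ ⊕ ℕ))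
    (fun t C => match t with
      | (_, .inl _) => C ≤ G ∧ C.Reachable (u 0) (u' 0)
      | (_, .inr (.inl n)) => C ≤ G ∧ C.Reachable (u n) (u (n + 1)) ∧
          ∀ v w, C.Adj v w → C.Reachable (u n) v ∧ n < N v
      | (_, .inr (.inr n)) => C ≤ G ∧ C.Reachable (u' n) (u' (n + 1)) ∧
          ∀ v w, C.Adj v w → C.Reachable (u' n) v ∧ n < N' v) (by
      rintro ⟨m, _ | n | n⟩
      · exact hl
      · exact h n
      · exact h' n)
  have hle : ∀ m t, C (m, t) ≤ G := by
    rintro m (_ | n | n)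
    · exact (h1 (m, .inl ())).1
    · exact (h1 (m, .inr (.inl n))).1
    · exact (h1 (m, .inr (.inr n))).1
  refine hasInf_of_disjoint (fun m => ⨆ t, C (m, t)) (fun m => iSup_le (hle m)) ?_ ?_
  · intro i j hij
    refine disjoint_iSup_iff.2 fun n => (disjoint_iSup_iff.2 fun n' => ?_).symm
    exact h3 (by simp [Ne.symm hij])
  · intro m
    obtain ⟨f, hf, hf0, hc⟩ := exists_ray_of_links hu (fun n => hle m (.inr (.inl n)))
      (fun n => (h1 (m, .inr (.inl n))).2) fun n => h2 _
    obtain ⟨f', hf', hf0', hc'⟩ := exists_ray_of_links hu' (fun n => hle m (.inr (.inr n)))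
      (fun n => (h1 (m, .inr (.inr n))).2) fun n => h2 _
    refine exists_doubleRay_of_conv hS hd (hf.mono (iSup_le fun n => le_iSup (fun t => C (m, t)) (.inr (.inl n))))
      (hf'.mono (iSup_le fun n => le_iSup (fun t => C (m, t)) (.inr (.inr n)))) hc hc' ?_
    rw [hf0, hf0']
    exact (h1 (m, .inl ())).2.mono (le_iSup (fun t => C (m, t)) (Sum.inl ()))

end Dir

/-! ### Rays with a common first vertex -/

theorem restr_edgeSet_finite (G : SimpleGraph V) {X : Set V} (hX : X.Finite) :
    (restr G X).edgeSet.Finite := by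
  refine ((hX.prod hX).image fun q => s(q.1, q.2)).subset ?_
  intro e he
  induction e with
  | h u v => exact ⟨(u, v), ⟨he.2.1, he.2.2⟩, rfl⟩

theorem isRay_rayGraph {A : SimpleGraph V} {f : ℕ → V} (hf : IsRay A f) : IsRay (rayGraph f) f :=
  ⟨hf.1, rayGraph_adj hf⟩

theorem exists_segment {A : SimpleGraph V} {f : ℕ → V} (hf : IsRay A f) {s t : ℕ} (hst : s ≤ t) :
    ∃ C, C ≤ rayGraph f ∧ C.edgeSet.Finite ∧ C.Reachable (f s) (f t) ∧
      ∀ v w, C.Adj v w → C.Reachable (f s) v ∧ ∃ m, s ≤ m ∧ m ≤ t ∧ f m = v := by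
  refine ⟨restr (rayGraph f) (f '' Set.Icc s t), restr_le _ _,
    restr_edgeSet_finite _ ((Set.finite_Icc s t).image f),
    ray_reachable (isRay_rayGraph hf) hst fun n h1 h2 => ⟨n, ⟨h1, h2⟩, rfl⟩, ?_⟩
  rintro v w ⟨-, ⟨m, ⟨h1, h2⟩, rfl⟩, -⟩
  exact ⟨ray_reachable (isRay_rayGraph hf) h1 fun n h3 h4 => ⟨n, ⟨h3, h4.trans h2⟩, rfl⟩,
    m, h1, h2, rfl⟩

namespace Dir

variable {G : SimpleGraph V} {d : Dir G}

theorem exists_isolating_seq [Countable V] {S₀ : Set V} (hS₀ : S₀.Finite) :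
    ∃ S : ℕ → Set V, (∀ n, S₀ ⊆ S n) ∧ (∀ n, (S n).Finite) ∧ Monotone S ∧
      (∀ T : Set V, T.Finite → ∃ n, T ⊆ S n) ∧
      ∀ n, ∀ x ∈ S n, x ∉ d.Δ → ∀ w ∈ d.ω (S (n + 1)), ¬ G.Adj x w := by
  classical
  obtain ⟨f, hf⟩ := exists_injective_nat V
  have hT : ∀ x, ∃ T : Set V, T.Finite ∧ (x ∉ d.Δ → x ∉ T ∧ x ∉ d.ω T) := by
    intro x
    by_cases hx : x ∈ d.Δ
    · exact ⟨∅, Set.finite_empty, fun h => absurd hx h⟩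
    · simp only [Δ, Set.mem_ofPred_eq, not_forall] at hx
      obtain ⟨T, hT, h1, h2⟩ := hx
      exact ⟨T, hT, fun _ => ⟨h1, h2⟩⟩
  choose T hT hx using hT
  have hfin : ∀ n, {v | f v ≤ n}.Finite := fun n => (Set.finite_Iic n).preimage hf.injOn
  obtain ⟨S, h0, h1, h2⟩ := exists_seq_of_step (fun _ (S : Set V) => S.Finite)
    (fun n S S' => S ⊆ S' ∧ {v | f v ≤ n} ⊆ S' ∧ ∀ x ∈ S, T x ⊆ S') hS₀ (fun n S hS =>
      ⟨S ∪ {v | f v ≤ n} ∪ ⋃ x ∈ S, T x, (hS.union (hfin n)).union (hS.biUnion fun x _ => hT x),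
        fun v hv => Or.inl (Or.inl hv), fun v hv => Or.inl (Or.inr hv),
        fun x hxS v hv => Or.inr (Set.mem_biUnion hxS hv)⟩)
  have hmono : Monotone S := monotone_nat_of_le_succ fun n => (h2 n).1
  refine ⟨S, fun n => h0 ▸ hmono (Nat.zero_le n), h1, hmono, fun X hX => ?_, ?_⟩
  · obtain ⟨M, hM⟩ := (hX.image f).bddAbove
    exact ⟨M + 1, fun v hv => (h2 M).2.1 (hM ⟨v, hv, rfl⟩)⟩
  · intro n x hxS hxΔ w hw hadj
    exact (hx x hxΔ).2 (d.closed (d.anti ((h2 n).2.2 x hxS) hw) hadj.symm (hx x hxΔ).1)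

theorem exists_entry {f : ℕ → V} (hf : IsRay G f) {S : Set V} (h0 : f 0 ∉ d.ω S)
    (h : ∃ n, f n ∈ d.ω S) : ∃ t, f t ∈ S ∧ f (t + 1) ∈ d.ω S ∧ ∀ t' ≤ t, f t' ∉ d.ω S := by
  classical
  have h1 := Nat.find_spec h
  have h2 := fun m => Nat.find_min h (m := m)
  obtain ⟨t, ht⟩ : ∃ t, Nat.find h = t + 1 := Nat.exists_eq_succ_of_ne_zero fun h' =>
    h0 (h' ▸ h1)
  rw [ht] at h1 h2
  refine ⟨t, ?_, h1, fun t' ht' => h2 t' (by omega)⟩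
  by_contra hS
  exact h2 t (by omega) (d.closed h1 (hf.2 t).symm hS)

theorem chain_or_dominating [Countable V] {I : Type*} (𝒰 : Ultrafilter I) (B : I → ℕ → V)
    {A : SimpleGraph V} (hA : A ≤ G) {x : V} {S₀ : Set V} (hS₀ : S₀.Finite)
    (hB : ∀ᶠ i in 𝒰, IsRay A (B i) ∧ B i 0 = x)
    (hconv : ∀ S : Set V, S.Finite → ∀ᶠ i in 𝒰, ∃ n, B i n ∈ d.ω S)
    (havoid : ∀ P ∈ 𝒰, ∀ F : Set (Sym2 V), F.Finite →
      ∃ i ∈ P, Disjoint (rayGraph (B i)).edgeSet F) (hx : x ∉ d.ω S₀) :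
    (∃ S : Set V, S.Finite ∧ S₀ ⊆ S ∧ ∃ z ∈ d.Δ,
      ∀ᶠ i in 𝒰, ∃ T, B i T = z ∧ ∀ t ≤ T, B i t ∉ d.ω S) ∨ d.Chain A x := by
  classical
  obtain ⟨S, hSS₀, hS, hmono, hex, hiso⟩ := exists_isolating_seq (d := d) hS₀
  let Entry : I → ℕ → ℕ → Prop := fun i n t =>
    B i (t + 1) ∈ d.ω (S n) ∧ ∀ t' ≤ t, B i t' ∉ d.ω (S n)
  have hentry : ∀ n, ∃ e ∈ S n, ∀ᶠ i in 𝒰, ∃ t, Entry i n t ∧ B i t = e := by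
    intro n
    rw [← Ultrafilter.eventually_exists_mem_iff (hS n)]
    filter_upwards [hB, hconv (S n) (hS n)] with i ⟨hi, hi0⟩ hc
    obtain ⟨t, h1, h2⟩ := exists_entry (hi.mono hA)
      (fun h => hx (hi0 ▸ d.anti (hSS₀ n) h)) hc
    exact ⟨_, h1, t, h2, rfl⟩
  choose e heS he using hentry
  by_cases hdom : ∃ n, e n ∈ d.Δ
  · obtain ⟨n, hn⟩ := hdom
    refine Or.inl ⟨S n, hS n, hSS₀ n, e n, hn, ?_⟩
    filter_upwards [he n] with i ⟨t, h1, h2⟩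
    exact ⟨t, h2, h1.2⟩
  push Not at hdom
  right
  have hentry_mono : ∀ {i m n t t'}, m ≤ n → Entry i m t → Entry i n t' → t ≤ t' := by
    intro i m n t t' hmn h h'
    by_contra hlt
    exact h.2 (t' + 1) (by omega) (d.anti (hmono hmn) h'.1)
  have hinside : ∀ m n, m < n → e n ∈ d.ω (S m) := by
    intro m n hmn
    obtain ⟨i, ⟨hi, -⟩, t, ht, hte⟩ := (hB.and (he n)).exists
    have hadj := hte ▸ hA (hi.2 t)
    refine d.closed (d.anti (hmono hmn.le) ht.1) hadj.symm fun h => ?_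
    exact hiso m _ h (hdom n) _ (d.anti (hmono hmn) ht.1) hadj
  have hne : ∀ m n, m < n → e n ≠ e m := fun m n hmn h => d.disj (hinside m n hmn) (h ▸ heS m)
  obtain ⟨f, hf⟩ := exists_injective_nat V
  let Q : V → ℕ → I → Prop := fun v n i => ∃ t, Entry i n t ∧ B i t = e n ∧ ∃ m ≤ t, B i m = v
  let nv : V → ℕ := fun v => if h : ∃ n, ∀ᶠ i in 𝒰, Q v n i then h.choose else 0
  have hnv : ∀ v, (∃ n, ∀ᶠ i in 𝒰, Q v n i) → ∀ᶠ i in 𝒰, Q v (nv v) i := by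
    intro v h
    simp only [nv, dif_pos h]
    exact h.choose_spec
  have hgood : ∀ n v, ∀ᶠ i in 𝒰, Q v (nv v) i ∨ ¬ Q v n i := by
    intro n v
    by_cases h : ∃ n, ∀ᶠ i in 𝒰, Q v n i
    · exact (hnv v h).mono fun i hi => Or.inl hi
    · rw [not_exists] at h
      exact (Ultrafilter.eventually_not.2 (h n)).mono fun i hi => Or.inr hi
  have hgood' : ∀ n, ∀ᶠ i in 𝒰, ∀ v ∈ {v | f v ≤ n}, Q v (nv v) i ∨ ¬ Q v n i := by
    intro n
    exact (Filter.eventually_all_finite ((Set.finite_Iic n).preimage hf.injOn)).2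
      fun v _ => hgood n v
  refine ⟨fun n => n.casesOn x e, fun v => max (f v + 1) (nv v + 2), rfl, ?_, ?_⟩
  · intro T hT
    obtain ⟨m, hm⟩ := hex T hT
    refine ⟨m + 2, fun n hn => ?_⟩
    obtain ⟨n, rfl⟩ : ∃ n', n = n' + 1 := ⟨n - 1, by omega⟩
    exact d.anti hm (hinside m n (by omega))
  · intro n F hF
    have hsucc : ∃ P ∈ 𝒰, ∀ i ∈ P, ∃ s t, s ≤ t ∧ IsRay A (B i) ∧
        B i s = Nat.casesOn n x e ∧ B i t = e n ∧
        ∀ v, (∃ m, s ≤ m ∧ m ≤ t ∧ B i m = v) → n < max (f v + 1) (nv v + 2) := by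
      rcases n with _ | n
      · refine ⟨_, hB.and (he 0), ?_⟩
        rintro i ⟨⟨hi, hi0⟩, t, -, ht⟩
        exact ⟨0, t, Nat.zero_le t, hi, hi0, ht, fun v _ => by simp⟩
      · refine ⟨_, (hB.and (he n)).and ((he (n + 1)).and (hgood' (n + 1))), ?_⟩
        rintro i ⟨⟨⟨hi, hi0⟩, s, hs, hse⟩, ⟨t, ht, hte⟩, hg⟩
        refine ⟨s, t, hentry_mono (Nat.le_succ n) hs ht, hi, hse, hte, ?_⟩
        rintro v ⟨m, hsm, hmt, hmv⟩
        by_contra hlt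
        rw [not_lt, max_le_iff] at hlt
        rcases hg v (show f v ≤ n + 1 by omega) with ⟨t', ht', hte', m', hm', hmv'⟩ | hg
        · have hmm : m = m' := hi.1 (hmv.trans hmv'.symm)
          have h1 := hentry_mono (show nv v ≤ n by omega) ht' hs
          have h2 : t' = s := by omega
          exact hne (nv v) n (by omega) (hse.symm.trans (h2 ▸ hte'))
        · exact hg ⟨t, ht, hte, m, hmt, hmv⟩
    obtain ⟨P, hP, h⟩ := hsucc
    obtain ⟨i, hi, hd⟩ := havoid P hP F hF
    obtain ⟨s, t, hst, hray, hs, ht, hN⟩ := h i hi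
    obtain ⟨C, h1, h2, h3, h4⟩ := exists_segment hray hst
    rw [hs] at h4
    rw [hs, ht] at h3
    refine ⟨C, ⟨h1.trans (rayGraph_le hray), h3, fun v w h => ⟨(h4 v w h).1,
      hN v (h4 v w h).2⟩⟩, h2, hd.mono_left ?_⟩
    exact edgeSet_mono h1

end Dir

namespace Dir

variable {G : SimpleGraph V} {d : Dir G} {k : ℕ} {W : ℕ → Set V} {lab : ℕ → Fin k → V}
  {ι : Type*}

/-! ### Attaching bundles -/

theorem System.exists_deep (hS : d.System k W lab) [Finite ι] {n : ℕ} {E : Fin n → ι → ℕ → V}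
    (hE : ∀ x, d.Bundle (E x)) (j : ℕ) :
    ∃ b ≥ j, ∀ x c t, E x c t ∈ W b → ∀ t' ≥ t, E x c t' ∈ W j := by
  choose N hN using fun x c => hS.conv_mem ((hE x).conv c) j
  have : ∀ᶠ b in Filter.atTop, ∀ x c, ∀ t ∈ Set.Iio (N x c), E x c t ∉ W b := by
    refine Filter.eventually_all.2 fun x => Filter.eventually_all.2 fun c => ?_
    refine (Filter.eventually_all_finite (Set.finite_Iio _)).2 fun t _ => ?_
    exact Filter.eventually_atTop.2 (hS.notMem _)
  obtain ⟨b, hb, hbj⟩ := (this.and (Filter.eventually_ge_atTop j)).exists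
  refine ⟨b, hbj, fun x c t ht t' htt' => hN x c t' ?_⟩
  by_contra hlt
  exact hb x c t (show t < N x c by omega) ht

theorem System.nonempty_gadget_unit (hS : d.System k W lab) {z : V} (hz : z ∈ d.Δ) (j n : ℕ)
    (hn : 0 < n) (E : Fin n → Unit → ℕ → V) (hE : ∀ x, d.Bundle (E x)) :
    Nonempty (Gadget G (· = z) (W j) E) := by
  obtain ⟨b, hbj, hb⟩ := hS.exists_deep hE j
  obtain ⟨T, hT, hΔT, hWT⟩ := hS.eq b
  obtain ⟨w, hw, hzw⟩ := exists_adj hT (hz (T \ {z}) hT.sdiff fun h => h.2 rfl)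
  obtain ⟨N, hN⟩ := hS.conv_mem ((hE ⟨0, hn⟩).conv ()) b
  have hN := hN N le_rfl
  rw [← hWT] at hw
  have hreach : (restr G (W b ∪ {z})).Reachable z (E ⟨0, hn⟩ () N) := by
    have h1 : (restr G (W b ∪ {z})).Adj z w := ⟨hzw, Or.inr rfl, Or.inl hw⟩
    refine h1.reachable.trans (Reachable.mono (restr_mono le_rfl Set.subset_union_left) ?_)
    rw [hWT] at hw hN ⊢
    exact d.conn hw hN
  obtain ⟨a', rfl, b', ⟨hb', x, t, rfl⟩, p, hp, -, h2⟩ := exists_path_between _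
    (A := {z}) (B := {v | v ∈ W b ∧ ∃ x t, v = E x () t}) rfl ⟨hN, _, _, rfl⟩ hreach
  have hsup := support_subset_restr p (Or.inr rfl)
  exact ⟨{
    K := restr G {v | v ∈ p.support}
    p := fun _ => x
    t := fun _ => t
    root := a'
    root_spec := rfl
    le := restr_le _ _
    finite := restr_edgeSet_finite _ p.support.finite_toSet
    touch := fun u v h => by
      rcases hsup u h.2.1 with hu | rfl
      · exact Or.inl (hS.anti hbj hu)
      rcases hsup v h.2.2 with hv | rfl
      · exact Or.inr (hS.anti hbj hv)
      · exact absurd rfl h.1.ne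
    disj := fun x c => by
      rw [SimpleGraph.disjoint_left]
      intro u v h h'
      have key : ∀ m, E x c m ∈ p.support → E x c m = E _ () t := fun m hm =>
        h2 _ hm ⟨(hsup _ hm).resolve_right fun h => (hE x).notMem c m (h ▸ hz), x, m, rfl⟩
      obtain ⟨m, ⟨rfl, rfl⟩ | ⟨rfl, rfl⟩⟩ := adj_of_rayGraph h'
      · exact h.1.ne ((key _ h.2.1).trans (key _ h.2.2).symm)
      · exact h.1.ne ((key _ h.2.1).trans (key _ h.2.2).symm)
    reach := fun c => (reachable_restr_of_walk p fun v hv => hv).mono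
      (restr_mono (restr_le _ _) le_rfl)
    tail_mem := fun c => hb x c t hb' }⟩

theorem System.nonempty_gadget_bool (hS : d.System k W lab) (j n : ℕ)
    (hn : 0 < n) (E : Fin n → Bool → ℕ → V) (hE : ∀ x, d.Bundle (E x)) :
    Nonempty (Gadget G (fun _ => True) (W j) E) := by
  obtain ⟨b, hbj, hb⟩ := hS.exists_deep hE j
  obtain ⟨T, hT, hΔT, hWT⟩ := hS.eq b
  choose N hN using fun c => hS.conv_mem ((hE ⟨0, hn⟩).conv c) b
  have hN := fun c => hN c (N c) le_rfl
  have hreach : (restr G (W b)).Reachable (E ⟨0, hn⟩ false (N false))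
      (E ⟨0, hn⟩ true (N true)) := by
    rw [hWT] at hN ⊢
    exact d.conn (hN _) (hN _)
  obtain ⟨a', ⟨ha', x, t, rfl⟩, b', ⟨hb', x', t', rfl⟩, p, hp, h1, h2⟩ := exists_path_between _
    (A := {v | v ∈ W b ∧ ∃ x t, v = E x false t}) (B := {v | v ∈ W b ∧ ∃ x t, v = E x true t})
    ⟨hN _, _, _, rfl⟩ ⟨hN _, _, _, rfl⟩ hreach
  have hsup := support_subset_restr p ha'
  exact ⟨{
    K := restr G {v | v ∈ p.support}
    p := fun c => if c then x' else x
    t := fun c => if c then t' else t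
    root := E x false t
    root_spec := trivial
    le := restr_le _ _
    finite := restr_edgeSet_finite _ p.support.finite_toSet
    touch := fun u v h => Or.inl (hS.anti hbj (hsup u h.2.1))
    disj := fun y c => by
      rw [SimpleGraph.disjoint_left]
      intro u v h h'
      have key : ∀ m m', E y c m ∈ p.support → E y c m' ∈ p.support → E y c m = E y c m' := by
        intro m m' hm hm'
        cases c
        · exact (h1 _ hm ⟨hsup _ hm, y, m, rfl⟩).trans (h1 _ hm' ⟨hsup _ hm', y, m', rfl⟩).symm
        · exact (h2 _ hm ⟨hsup _ hm, y, m, rfl⟩).trans (h2 _ hm' ⟨hsup _ hm', y, m', rfl⟩).symm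
      obtain ⟨m, ⟨rfl, rfl⟩ | ⟨rfl, rfl⟩⟩ := adj_of_rayGraph h'
      · exact h.1.ne (key _ _ h.2.1 h.2.2)
      · exact h.1.ne (key _ _ h.2.1 h.2.2)
    reach := fun c => by
      cases c
      · exact Reachable.refl _
      · exact (reachable_restr_of_walk p fun v hv => hv).mono (restr_mono (restr_le _ _) le_rfl)
    tail_mem := fun c => by
      cases c
      · exact hb x false t ha'
      · exact hb x' true t' hb' }⟩

theorem rayGraph_tail_le {A : SimpleGraph V} {f : ℕ → V} (hf : IsRay A f) (s : ℕ) :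
    rayGraph (fun n => f (s + n)) ≤ rayGraph f :=
  rayGraph_le ((isRay_rayGraph hf).tail s)

theorem fan_of_dominating [Countable V] (hΔ : d.Δ.Finite) (hG : ¬ HasInf G) {I : Type*}
    (𝒰 : Ultrafilter I) (e : I → ℕ → V) (he : ∀ᶠ i in 𝒰, IsRay G (e i) ∧ d.Conv (e i))
    (hlarge : ∀ P ∈ 𝒰, ∀ n, ∃ F : Fin n → I, (∀ x, F x ∈ P) ∧
      ∀ x y, x ≠ y → Disjoint (rayGraph (e (F x))) (rayGraph (e (F y))))
    {z : V} (hz : z ∈ d.Δ) {S : Set V} (hS : S.Finite) : d.Fan (touching G (d.ω S)) z := by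
  obtain ⟨k, W, lab, hW⟩ := exists_system hΔ hG
  obtain ⟨J, hJ⟩ := hW.sub S hS
  replace hW := hW.comp (φ := fun n => J + n) fun a b h => Nat.add_lt_add_left h J
  have hN : ∀ i, ∃ N, IsRay G (e i) → ∀ n ≥ N, e i n ∉ d.Δ := by
    intro i
    by_cases hi : IsRay G (e i)
    · obtain ⟨N, hN⟩ := hi.eventually_notMem hΔ
      exact ⟨N, fun _ => hN⟩
    · exact ⟨0, fun h => absurd h hi⟩
  choose N hN using hN
  obtain ⟨H, h1, h2, h3, h4⟩ := exists_fan_of_gadgets hW 𝒰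
    (fun i (_ : Unit) n => e i (N i + n))
    (he.mono fun i hi => ⟨fun _ => hi.1.tail _, fun _ => hi.2.tail _,
      fun _ n => hN i hi.1 _ (by omega), fun c c' _ _ h => absurd rfl h⟩)
    (fun P hP n => by
      obtain ⟨F, hF, hFd⟩ := hlarge _ (he.and hP) n
      exact ⟨F, fun x => (hF x).2, fun x y _ _ hxy => (hFd x y hxy).mono
        (rayGraph_tail_le (hF x).1.1 _) (rayGraph_tail_le (hF y).1.1 _)⟩)
    (· = z) (fun j n hn E hE => hW.nonempty_gadget_unit hz j n hn E hE)
  refine ⟨H, fun m u v h => ⟨h1 m h, ?_⟩, h2, fun m => ?_⟩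
  · exact (h3 m u v h).imp (@hJ (J + 0) (by omega) _) (@hJ (J + 0) (by omega) _)
  · obtain ⟨r, rfl, R, hR⟩ := h4 m
    exact ⟨R (), (hR ()).1, (hR ()).2.1, (hR ()).2.2.1⟩

theorem hasInf_of_bundles [Countable V] (hΔ : d.Δ.Finite) {I : Type*}
    (𝒰 : Ultrafilter I) (e : I → Bool → ℕ → V) (he : ∀ᶠ i in 𝒰, d.Bundle (e i))
    (hlarge : ∀ P ∈ 𝒰, ∀ n, ∃ F : Fin n → I, (∀ x, F x ∈ P) ∧
      ∀ x y c c', x ≠ y → Disjoint (rayGraph (e (F x) c)) (rayGraph (e (F y) c'))) :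
    HasInf G := by
  by_contra hG
  obtain ⟨k, W, lab, hW⟩ := exists_system hΔ hG
  obtain ⟨H, h1, h2, -, h4⟩ := exists_fan_of_gadgets hW 𝒰 e he hlarge (fun _ => True)
    hW.nonempty_gadget_bool
  refine hG (hasInf_of_disjoint H h1 h2 fun m => ?_)
  obtain ⟨r, -, R, hR⟩ := h4 m
  exact exists_doubleRay_of_rays (hR false).1 (hR true).1
    (fun n n' => (hR false).2.2.2 true n n' (by simp))
    ((hR false).2.2.1.symm.trans (hR true).2.2.1)

end Dir

/-! ### Large families of double rays -/

section
variable {G : SimpleGraph V} {D : ℤ → V}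

theorem isRay_drFwd (hD : IsDoubleRay G D) : IsRay G (drFwd D) :=
  ⟨fun a b h => by simpa using hD.1 h, fun n => by simpa [drFwd] using hD.2 n⟩

theorem isDoubleRay_shift (hD : IsDoubleRay G D) (c : ℤ) : IsDoubleRay G fun n => D (c + n) :=
  ⟨fun a b h => by simpa using hD.1 h, fun n => by simpa [add_assoc] using hD.2 (c + n)⟩

theorem isDoubleRay_neg (hD : IsDoubleRay G D) : IsDoubleRay G fun n => D (-n) :=
  ⟨fun a b h => by simpa using hD.1 h, fun n => by
    have := (hD.2 (-(n + 1))).symm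
    rwa [show -(n + 1) + 1 = -n by ring] at this⟩

theorem drEdges_shift (D : ℤ → V) (c : ℤ) : drEdges (fun n => D (c + n)) ⊆ drEdges D := by
  rintro _ ⟨n, rfl⟩
  exact ⟨c + n, by simp only [add_assoc]⟩

theorem drEdges_neg (D : ℤ → V) : drEdges (fun n => D (-n)) ⊆ drEdges D := by
  rintro _ ⟨n, rfl⟩
  exact ⟨-(n + 1), by rw [show -(n + 1) + 1 = -n by ring, Sym2.eq_swap]⟩

theorem rayGraph_drFwd (D : ℤ → V) : (rayGraph (drFwd D)).edgeSet ⊆ drEdges D := by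
  intro e he
  induction e with
  | h u v =>
    obtain ⟨m, ⟨rfl, rfl⟩ | ⟨rfl, rfl⟩⟩ := adj_of_rayGraph he
    · exact ⟨m, by simp [drFwd]⟩
    · exact ⟨m, by simp [drFwd]⟩

end

/-- A family of double rays all of whose large parts contain arbitrarily many disjoint ones. -/
structure Family (G : SimpleGraph V) {I : Type*} (𝒰 : Ultrafilter I) (D : I → ℤ → V) : Prop where
  ray : ∀ i, IsDoubleRay G (D i)
  large : ∀ P ∈ 𝒰, ∀ n, ∃ F : Fin n → I, (∀ x, F x ∈ P) ∧
    ∀ x y, x ≠ y → Disjoint (drEdges (D (F x))) (drEdges (D (F y)))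

namespace Family

variable {G : SimpleGraph V} {I : Type*} {𝒰 : Ultrafilter I} {D : I → ℤ → V}

theorem of_subset (h : Family G 𝒰 D) {D' : I → ℤ → V} (hD' : ∀ i, IsDoubleRay G (D' i))
    (hs : ∀ i, drEdges (D' i) ⊆ drEdges (D i)) : Family G 𝒰 D' := by
  refine ⟨hD', fun P hP n => ?_⟩
  obtain ⟨F, h1, h2⟩ := h.large P hP n
  exact ⟨F, h1, fun x y hxy => (h2 x y hxy).mono (hs _) (hs _)⟩

theorem shift (h : Family G 𝒰 D) (c : I → ℤ) : Family G 𝒰 fun i n => D i (c i + n) :=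
  h.of_subset (fun i => isDoubleRay_shift (h.ray i) _) fun _ => drEdges_shift _ _

theorem neg (h : Family G 𝒰 D) : Family G 𝒰 fun i n => D i (-n) :=
  h.of_subset (fun i => isDoubleRay_neg (h.ray i)) fun _ => drEdges_neg _

theorem avoid (h : Family G 𝒰 D) {P : Set I} (hP : P ∈ 𝒰) {F : Set (Sym2 V)} (hF : F.Finite) :
    ∃ i ∈ P, Disjoint (drEdges (D i)) F := by
  by_contra! hcon
  obtain ⟨E, h1, h2⟩ := h.large P hP (hF.toFinset.card + 1)
  have h3 : ∀ x, ∃ s ∈ hF.toFinset, s ∈ drEdges (D (E x)) := fun x => by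
    obtain ⟨s, hs, hs'⟩ := Set.not_disjoint_iff.1 (hcon _ (h1 x))
    exact ⟨s, by simpa using hs', hs⟩
  choose s hs hs' using h3
  obtain ⟨x, -, y, -, hxy, h4⟩ := Finset.exists_ne_map_eq_of_card_lt_of_maps_to
    (s := Finset.univ) (t := hF.toFinset) (by simp) (f := s) (fun x _ => hs x)
  exact Set.disjoint_left.1 (h2 x y hxy) (hs' x) (h4 ▸ hs' y)

theorem large_rays (h : Family G 𝒰 D) (P : Set I) (hP : P ∈ 𝒰) (n : ℕ) :
    ∃ F : Fin n → I, (∀ x, F x ∈ P) ∧ ∀ x y, x ≠ y →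
      Disjoint (rayGraph (drFwd (D (F x)))) (rayGraph (drFwd (D (F y)))) := by
  obtain ⟨F, h1, h2⟩ := h.large P hP n
  exact ⟨F, h1, fun x y hxy => disjoint_edgeSet.1
    ((h2 x y hxy).mono (rayGraph_drFwd _) (rayGraph_drFwd _))⟩

theorem avoid_ray (h : Family G 𝒰 D) (P : Set I) (hP : P ∈ 𝒰) (F : Set (Sym2 V)) (hF : F.Finite) :
    ∃ i ∈ P, Disjoint (rayGraph (drFwd (D i))).edgeSet F := by
  obtain ⟨i, hi, hd⟩ := h.avoid hP hF
  exact ⟨i, hi, hd.mono_left (rayGraph_drFwd _)⟩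

end Family

/-- A set of indices containing arbitrarily many disjoint double rays. -/
def Large {I : Type*} (D : I → ℤ → V) (P : Set I) : Prop :=
  ∀ n, ∃ F : Fin n → I, (∀ x, F x ∈ P) ∧
    ∀ x y, x ≠ y → Disjoint (drEdges (D (F x))) (drEdges (D (F y)))

theorem Large.union {I : Type*} {D : I → ℤ → V} {P Q : Set I} (h : Large D (P ∪ Q)) :
    Large D P ∨ Large D Q := by
  classical
  by_contra! hcon
  simp only [Large, not_forall] at hcon
  obtain ⟨⟨n, hn⟩, m, hm⟩ := hcon
  obtain ⟨F, h1, h2⟩ := h (n + m)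
  let A : Finset (Fin (n + m)) := Finset.univ.filter fun x => F x ∈ P
  have hA : A.card + Aᶜ.card = n + m := by simp [Finset.card_add_card_compl]
  rcases le_or_gt n A.card with h3 | h3
  · refine hn ⟨F ∘ A.orderEmbOfCardLe h3, fun x => ?_, fun x y hxy => h2 _ _ (by simpa using hxy)⟩
    simpa [A] using A.orderEmbOfCardLe_mem h3 x
  · have h4 : m ≤ Aᶜ.card := by omega
    refine hm ⟨F ∘ Aᶜ.orderEmbOfCardLe h4, fun x => ?_,
      fun x y hxy => h2 _ _ (by simpa using hxy)⟩
    have h5 : F (Aᶜ.orderEmbOfCardLe h4 x) ∉ P := by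
      simpa [A] using Aᶜ.orderEmbOfCardLe_mem h4 x
    exact (h1 _).resolve_left h5

theorem Large.mono {I : Type*} {D : I → ℤ → V} {P Q : Set I} (h : Large D P) (hPQ : P ⊆ Q) :
    Large D Q := by
  intro n
  obtain ⟨F, h1, h2⟩ := h n
  exact ⟨F, fun x => hPQ (h1 x), h2⟩

theorem exists_family (G : SimpleGraph V)
    (h : ∀ k : ℕ, ∃ F : Fin k → ℤ → V, (∀ i, IsDoubleRay G (F i)) ∧
      Pairwise fun i j => Disjoint (drEdges (F i)) (drEdges (F j))) :
    ∃ 𝒰 : Ultrafilter {D : ℤ → V // IsDoubleRay G D}, Family G 𝒰 Subtype.val := by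
  let D : {D : ℤ → V // IsDoubleRay G D} → ℤ → V := Subtype.val
  have huniv : Large D Set.univ := by
    intro n
    obtain ⟨F, h1, h2⟩ := h n
    exact ⟨fun x => ⟨F x, h1 x⟩, fun _ => trivial, fun x y hxy => h2 hxy⟩
  let ℱ : Filter {D : ℤ → V // IsDoubleRay G D} := {
    sets := {P | ¬ Large D Pᶜ}
    univ_sets := by
      intro h
      obtain ⟨F, hF, -⟩ := h 1
      exact hF 0 trivial
    sets_of_superset := fun {P Q} hP hPQ hQ => hP (hQ.mono (Set.compl_subset_compl.2 hPQ))
    inter_sets := fun {P Q} hP hQ h => by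
      rw [Set.compl_inter] at h
      exact h.union.elim hP hQ }
  have hne : ℱ.NeBot := by
    refine ⟨fun h => ?_⟩
    have : (∅ : Set _) ∈ ℱ := by
      rw [h]
      exact Filter.mem_bot
    exact this (by simpa using huniv)
  refine ⟨Ultrafilter.of ℱ, fun i => i.2, fun P hP => ?_⟩
  by_contra hcon
  have : Pᶜ ∈ ℱ := show ¬ Large D Pᶜᶜ by rwa [compl_compl]
  exact Ultrafilter.compl_notMem_iff.2 hP (Ultrafilter.of_le ℱ this)

/-! ### The direction of a family of tails -/

/-- The component of `a` in the complement of `S`. -/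
def comp (G : SimpleGraph V) (S : Set V) (a : V) : Set V := {v | (restr G Sᶜ).Reachable a v}

theorem comp_closed {S : Set V} {a v w : V} (ha : a ∉ S) (hv : v ∈ comp G S a) (hvw : G.Adj v w)
    (hw : w ∉ S) : w ∈ comp G S a :=
  Reachable.trans hv
    (show (restr G Sᶜ).Adj v w from ⟨hvw, mem_of_reachable_restr hv ha, hw⟩).reachable

theorem comp_conn {S : Set V} {a v w : V} (hv : v ∈ comp G S a) (hw : w ∈ comp G S a) :
    (restr G (comp G S a)).Reachable v w := by
  classical
  have key : ∀ v ∈ comp G S a, (restr G (comp G S a)).Reachable a v := by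
    rintro v ⟨p⟩
    exact (reachable_restr_of_walk p fun u hu => (p.takeUntil u hu).reachable).mono
      (restr_mono (restr_le _ _) le_rfl)
  exact (key v hv).symm.trans (key w hw)

theorem comp_eq_of_mem {S : Set V} {a b v : V} (ha : v ∈ comp G S a) (hb : v ∈ comp G S b) :
    comp G S a = comp G S b := by
  have h : (restr G Sᶜ).Reachable a b := Reachable.trans ha (Reachable.symm hb)
  ext w
  exact ⟨fun hw => h.symm.trans hw, fun hw => h.trans hw⟩

theorem drEdges_disjoint_of_range {D D' : ℤ → V} {K K' : Set V} (hK : ∀ n, D n ∈ K)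
    (hK' : ∀ n, D' n ∈ K') (h : Disjoint K K') : Disjoint (drEdges D) (drEdges D') := by
  rw [Set.disjoint_left]
  rintro _ ⟨n, rfl⟩ ⟨m, hm⟩
  rcases Sym2.eq_iff.1 hm with h1 | h1
  · exact Set.disjoint_left.1 h (hK n) (h1.1 ▸ hK' m)
  · exact Set.disjoint_left.1 h (hK n) (h1.1 ▸ hK' (m + 1))

/-- Infinitely many components containing tails of double rays. -/
theorem hasInf_of_components {S : Set V} (hS : S.Finite) (D : ℕ → ℤ → V)
    (hD : ∀ n, IsDoubleRay G (D n)) (K : ℕ → Set V) (hKd : ∀ i j, i ≠ j → Disjoint (K i) (K j))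
    (hKS : ∀ i, Disjoint (K i) S)
    (hKc : ∀ i v w, v ∈ K i → G.Adj v w → w ∉ S → w ∈ K i)
    (hKr : ∀ i v w, v ∈ K i → w ∈ K i → (restr G (K i)).Reachable v w)
    (N : ℕ → ℕ) (hN : ∀ i, ∀ n ≥ N i, D i (n : ℤ) ∈ K i) : HasInf G := by
  classical
  have hex : ∀ {P : ℕ → Prop}, (∀ᶠ n in (Filter.hyperfilter ℕ : Filter ℕ), P n) →
      ∃ φ : ℕ → ℕ, StrictMono φ ∧ ∀ n, P (φ n) := fun h =>
    Filter.extraction_of_frequently_atTop (h.frequently.filter_mono Nat.hyperfilter_le_atTop)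
  by_cases hall : ∀ᶠ n in (Filter.hyperfilter ℕ : Filter ℕ), ∀ m, D n m ∈ K n
  · obtain ⟨φ, hφ, h⟩ := hex hall
    exact ⟨fun n => D (φ n), fun n => hD _, fun i j hij =>
      drEdges_disjoint_of_range (h i) (h j) (hKd _ _ (hφ.injective.ne hij))⟩
  have hsome : ∀ᶠ n in (Filter.hyperfilter ℕ : Filter ℕ), ∃ s ∈ S, ∃ w ∈ K n, G.Adj s w := by
    refine (Ultrafilter.eventually_not.2 hall).mono fun n hn => ?_
    by_contra! hcon
    refine hn fun m => ?_
    have h1 : ∀ t : ℕ, D n (N n - t) ∈ K n := by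
      intro t
      induction t with
      | zero => simpa using hN n (N n) le_rfl
      | succ t ih =>
        have h2 := (hD n).2 ((N n : ℤ) - (t + 1 : ℕ))
        rw [show (N n : ℤ) - (t + 1 : ℕ) + 1 = N n - t by push_cast; ring] at h2
        exact hKc n _ _ ih h2.symm fun h3 => hcon _ h3 _ ih h2
    rcases le_total (N n : ℤ) m with h | h
    · obtain ⟨m, rfl⟩ := Int.eq_ofNat_of_zero_le (a := m) (by omega)
      exact hN n m (by exact_mod_cast h)
    · have := h1 ((N n : ℤ) - m).toNat
      rwa [Int.toNat_of_nonneg (by omega), show (N n : ℤ) - (N n - m) = m by ring] at this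
  obtain ⟨s, hs, h⟩ := (Ultrafilter.eventually_exists_mem_iff hS).1 hsome
  obtain ⟨φ, hφ, h⟩ := hex h
  choose w hw hsw using h
  have hsK : ∀ i, s ∉ K i := fun i hi => Set.disjoint_left.1 (hKS i) hi hs
  refine hasInf_of_disjoint (fun m => restr G (K (φ (2 * m)) ∪ K (φ (2 * m + 1)) ∪ {s}))
    (fun m => restr_le _ _) ?_ ?_
  · intro i j hij
    rw [SimpleGraph.disjoint_left]
    have key : ∀ u, u ∈ K (φ (2 * i)) ∪ K (φ (2 * i + 1)) ∪ {s} →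
        u ∈ K (φ (2 * j)) ∪ K (φ (2 * j + 1)) ∪ {s} → u = s := by
      have hd : ∀ a b, a ≠ b → ∀ u, u ∈ K (φ a) → u ∉ K (φ b) := fun a b hab u h1 h2 =>
        Set.disjoint_left.1 (hKd _ _ (hφ.injective.ne hab)) h1 h2
      rintro u ((h1 | h1) | h1) ((h2 | h2) | h2)
      all_goals first
        | exact h1
        | exact h2
        | exact absurd h2 (hd _ _ (by omega) u h1)
    rintro u v ⟨h1, h2, h3⟩ ⟨-, h4, h5⟩
    exact h1.ne ((key u h2 h4).trans (key v h3 h5).symm)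
  · intro m
    have hR : ∀ a, K (φ a) ⊆ K (φ (2 * m)) ∪ K (φ (2 * m + 1)) ∪ {s} →
        IsRay (restr G (K (φ (2 * m)) ∪ K (φ (2 * m + 1)) ∪ {s}))
          (fun n => drFwd (D (φ a)) (N (φ a) + n)) ∧
        (restr G (K (φ (2 * m)) ∪ K (φ (2 * m + 1)) ∪ {s})).Reachable s
          (drFwd (D (φ a)) (N (φ a) + 0)) := by
      intro a ha
      refine ⟨((isRay_drFwd (hD _)).tail _).restr fun n => ha (hN _ _ (by omega)), ?_⟩
      have h1 : (restr G (K (φ (2 * m)) ∪ K (φ (2 * m + 1)) ∪ {s})).Adj s (w a) :=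
        ⟨hsw a, Or.inr rfl, ha (hw a)⟩
      exact h1.reachable.trans ((hKr _ _ _ (hw a) (hN _ _ (by omega))).mono
        (restr_mono le_rfl ha))
    obtain ⟨h1, h2⟩ := hR (2 * m) fun v hv => Or.inl (Or.inl hv)
    obtain ⟨h3, h4⟩ := hR (2 * m + 1) fun v hv => Or.inl (Or.inr hv)
    refine exists_doubleRay_of_rays h1 h3 (fun n n' hnn => ?_) (h2.symm.trans h4)
    have hne : φ (2 * m) ≠ φ (2 * m + 1) := hφ.injective.ne (by omega)
    have h5 : drFwd (D (φ (2 * m))) (N (φ (2 * m)) + n) ∈ K (φ (2 * m)) := hN _ _ (by omega)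
    rw [hnn] at h5
    exact Set.disjoint_left.1 (hKd _ _ hne) h5 (hN _ (N (φ (2 * m + 1)) + n') (by omega))

theorem exists_component {I : Type*} (𝒰 : Ultrafilter I) (D : I → ℤ → V)
    (hD : ∀ i, IsDoubleRay G (D i)) (hG : ¬ HasInf G) {S : Set V} (hS : S.Finite) :
    ∃ a ∉ S, ∀ᶠ i in 𝒰, ∃ N, ∀ n ≥ N, drFwd (D i) n ∈ comp G S a := by
  classical
  choose N hN using fun i => (isRay_drFwd (hD i)).eventually_notMem hS
  let κ : I → Set V := fun i => comp G S (drFwd (D i) (N i))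
  have hκ : ∀ i, ∀ n ≥ N i, drFwd (D i) n ∈ κ i := fun i n hn =>
    ray_reachable (isRay_drFwd (hD i)) hn fun m hm _ => hN i m hm
  by_cases hfin : (Set.range κ).Finite
  · have := hfin.to_subtype
    obtain ⟨⟨_, i₀, rfl⟩, hb⟩ := Dir.exists_eventually_eq 𝒰 (Set.rangeFactorization κ)
    refine ⟨_, hN i₀ _ le_rfl, hb.mono fun i hi => ⟨N i, fun n hn => ?_⟩⟩
    have h : κ i = κ i₀ := congrArg Subtype.val hi
    exact h.subset (hκ i n hn)
  · refine absurd ?_ hG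
    let b := Set.Infinite.natEmbedding _ hfin
    choose i hi using fun n => (b n).2
    refine hasInf_of_components hS (fun n => D (i n)) (fun n => hD _) (fun n => κ (i n)) ?_ ?_ ?_
      ?_ (fun n => N (i n)) (fun n => hκ _)
    · intro m n hmn
      rw [Set.disjoint_left]
      intro v hv hv'
      have h : κ (i m) = κ (i n) := comp_eq_of_mem hv hv'
      rw [hi, hi] at h
      exact hmn (b.injective (Subtype.ext h))
    · exact fun n => Set.disjoint_left.2 fun v hv =>
        mem_of_reachable_restr hv (hN (i n) _ le_rfl)
    · exact fun n v w hv hvw hw => comp_closed (hN (i n) _ le_rfl) hv hvw hw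
    · exact fun n v w hv hw => comp_conn hv hw

theorem exists_dir {I : Type*} (𝒰 : Ultrafilter I) (D : I → ℤ → V)
    (hD : ∀ i, IsDoubleRay G (D i)) (hG : ¬ HasInf G) :
    ∃ d : Dir G, ∀ S : Set V, S.Finite → ∀ᶠ i in 𝒰, ∃ N, ∀ n ≥ N, drFwd (D i) n ∈ d.ω S := by
  classical
  have hex : ∀ S : Set V, ∃ a, S.Finite →
      a ∉ S ∧ ∀ᶠ i in 𝒰, ∃ N, ∀ n ≥ N, drFwd (D i) n ∈ comp G S a := by
    intro S
    by_cases hS : S.Finite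
    · obtain ⟨a, h⟩ := exists_component 𝒰 D hD hG hS
      exact ⟨a, fun _ => h⟩
    · obtain ⟨a, -⟩ := Set.Infinite.nonempty hS
      exact ⟨a, fun h => absurd h hS⟩
  choose a ha using hex
  have ha' := fun S hS => (ha S hS).2
  replace ha := fun S hS => (ha S hS).1
  refine ⟨{
    ω := fun S => if S.Finite then comp G S (a S) else ∅
    disj := ?_
    closed := ?_
    conn := ?_
    anti := ?_
    nonempty := ?_ }, ?_⟩
  · intro S v hv
    split_ifs at hv with hS
    swap
    · exact absurd hv (Set.notMem_empty _)
    exact mem_of_reachable_restr hv (ha S hS)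
  · intro S v w hv hvw hw
    split_ifs at hv ⊢ with hS
    swap
    · exact absurd hv (Set.notMem_empty _)
    exact comp_closed (ha S hS) hv hvw hw
  · intro S v w hv hw
    split_ifs at hv hw ⊢ with hS
    swap
    · exact absurd hv (Set.notMem_empty _)
    exact comp_conn hv hw
  · intro S T hST v hv
    split_ifs at hv with hT
    swap
    · exact absurd hv (Set.notMem_empty _)
    rw [if_pos (hT.subset hST)]
    obtain ⟨i, ⟨N, hN⟩, N', hN'⟩ := ((ha' S (hT.subset hST)).and (ha' T hT)).exists
    have h1 := hN (max N N') (le_max_left _ _)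
    have h2 := hN' (max N N') (le_max_right _ _)
    exact Reachable.trans h1 ((Reachable.trans (Reachable.symm h2) hv).mono
      (restr_mono le_rfl (Set.compl_subset_compl.2 hST)))
  · intro S hS
    rw [if_pos hS]
    exact ⟨_, Reachable.refl _⟩
  · intro S hS
    simpa only [if_pos hS] using ha' S hS

/-! ### Families of double rays between directions -/

theorem exists_segment_of_doubleRay {D : ℤ → V} (hD : IsDoubleRay G D) (a b : ℤ) :
    ∃ C, C ≤ G ∧ C.edgeSet ⊆ drEdges D ∧ C.edgeSet.Finite ∧ C.Reachable (D a) (D b) := by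
  wlog h : a ≤ b generalizing a b
  · obtain ⟨C, h1, h2, h3, h4⟩ := this b a (le_of_not_ge h)
    exact ⟨C, h1, h2, h3, h4.symm⟩
  obtain ⟨n, rfl⟩ := Int.le.dest h
  have hray := isRay_drFwd (isDoubleRay_shift hD a)
  obtain ⟨C, h1, h2, h3, -⟩ := exists_segment hray (Nat.zero_le n)
  refine ⟨C, h1.trans (rayGraph_le hray), (edgeSet_mono h1).trans
    ((rayGraph_drFwd _).trans (drEdges_shift D a)), h2, ?_⟩
  simpa [drFwd] using h3

namespace Dir

variable {d d' : Dir G}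

theorem ω_eq_of_mem {S : Set V} {v : V} (h : v ∈ d.ω S) (h' : v ∈ d'.ω S) : d.ω S = d'.ω S := by
  have key : ∀ {d d' : Dir G}, v ∈ d.ω S → v ∈ d'.ω S → d.ω S ⊆ d'.ω S := fun h h' w hw =>
    reachable_induct (Dir.conn _ h hw) h' fun a b hab ha =>
      Dir.closed _ ha hab.1 (Dir.disj _ hab.2.2)
  exact (key h h').antisymm (key h' h)

variable {I : Type*} {𝒰 : Ultrafilter I} {D : I → ℤ → V}

/-- The forward tails of the family lie in the components of the direction. -/
def Toward (d : Dir G) (𝒰 : Ultrafilter I) (D : I → ℤ → V) : Prop :=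
  ∀ S : Set V, S.Finite → ∀ᶠ i in 𝒰, ∃ N, ∀ n ≥ N, drFwd (D i) n ∈ d.ω S

theorem Toward.shift (h : d.Toward 𝒰 D) (c : I → ℤ) : d.Toward 𝒰 fun i n => D i (c i + n) := by
  intro S hS
  filter_upwards [h S hS] with i ⟨N, hN⟩
  refine ⟨N + (c i).natAbs, fun n hn => ?_⟩
  have := hN (c i + n).toNat (by omega)
  rwa [drFwd, Int.toNat_of_nonneg (by omega)] at this

theorem Toward.conv (h : d.Toward 𝒰 D) (hD : Family G 𝒰 D) (hG : ¬ HasInf G) :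
    ∀ᶠ i in 𝒰, d.Conv (drFwd (D i)) := by
  have h1 : ∃ S : Set V, S.Finite ∧ ∀ f, IsRay G f → (∀ n, f n ∈ d.ω S) → d.Conv f := by
    by_contra! hcon
    exact hG (hasInf_of_not_conv fun S hS => hcon S hS)
  obtain ⟨S, hS, h1⟩ := h1
  filter_upwards [h S hS] with i ⟨N, hN⟩ T hT
  obtain ⟨M, hM⟩ := h1 _ ((isRay_drFwd (hD.ray i)).tail N) (fun n => hN _ (by omega)) T hT
  refine ⟨N + M, fun n hn => ?_⟩
  have : drFwd (D i) (N + (n - N)) ∈ d.ω T := hM (n - N) (by omega)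
  rwa [show N + (n - N) = n by omega] at this

/-- The case of two equal directions. -/
theorem hasInf_of_eq [Countable V] (hD : Family G 𝒰 D) (h : d.Toward 𝒰 D)
    (h' : d.Toward 𝒰 fun i n => D i (-n)) : HasInf G := by
  by_contra hG
  have hΔ : d.Δ.Finite := by
    by_contra hΔ
    exact hG (hasInf_of_infinite_dominating hΔ)
  choose N hN using fun i => (isRay_drFwd (hD.ray i)).eventually_notMem hΔ
  choose N' hN' using fun i => (isRay_drFwd (hD.neg.ray i)).eventually_notMem hΔ
  have hray : ∀ i (c : Bool), IsRay G fun n =>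
      drFwd (if c then fun n => D i (-n) else D i) (N i + N' i + 1 + n) := by
    intro i c
    cases c
    · exact (isRay_drFwd (hD.ray i)).tail _
    · exact (isRay_drFwd (hD.neg.ray i)).tail _
  refine hG (hasInf_of_bundles hΔ 𝒰
    (fun i c n => drFwd (if c then fun n => D i (-n) else D i) (N i + N' i + 1 + n)) ?_ ?_)
  · filter_upwards [h.conv hD hG, h'.conv hD.neg hG] with i hi hi'
    refine ⟨hray i, fun c => ?_, fun c n => ?_, fun c c' m n hcc heq => ?_⟩
    · cases c
      · exact hi.tail _
      · exact hi'.tail _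
    · cases c
      · exact hN i _ (by omega)
      · exact hN' i _ (by omega)
    · cases c <;> cases c'
      · exact hcc rfl
      · have := (hD.ray i).1 heq
        omega
      · have := (hD.ray i).1 heq
        omega
      · exact hcc rfl
  · intro P hP n
    obtain ⟨F, h1, h2⟩ := hD.large P hP n
    have key : ∀ i (c : Bool), (rayGraph fun n =>
        drFwd (if c then fun n => D i (-n) else D i) (N i + N' i + 1 + n)).edgeSet ⊆
        drEdges (D i) := by
      intro i c
      cases c
      · exact (edgeSet_mono (rayGraph_tail_le (isRay_drFwd (hD.ray i)) _)).trans
          (rayGraph_drFwd _)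
      · exact (edgeSet_mono (rayGraph_tail_le (isRay_drFwd (hD.neg.ray i)) _)).trans
          ((rayGraph_drFwd _).trans (drEdges_neg _))
    exact ⟨F, h1, fun x y c c' hxy => disjoint_edgeSet.1 ((h2 x y hxy).mono (key _ c) (key _ c'))⟩

/-- Almost all members pass through one dominating vertex before reaching the direction. -/
def Early (d : Dir G) (𝒰 : Ultrafilter I) (D : I → ℤ → V) (S₀ : Set V) : Prop :=
  ∃ S : Set V, S.Finite ∧ S₀ ⊆ S ∧ ∃ z ∈ d.Δ,
    ∀ᶠ i in 𝒰, ∃ n, D i n = z ∧ ∀ m ≤ n, D i m ∉ d.ω S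

section Separated
variable [Countable V] (hD : Family G 𝒰 D) (h : d.Toward 𝒰 D)
  (h' : d'.Toward 𝒰 fun i n => D i (-n)) {S₀ : Set V} (hS₀ : S₀.Finite)
  (hd : Disjoint (d.ω S₀) (d'.ω S₀))
include hD h h' hS₀ hd

theorem chain_of_not_early (hE : ¬ d.Early 𝒰 D S₀) :
    ∃ x, d.Chain G x ∧ ∀ᶠ i in 𝒰, ∃ n, D i n = x := by
  have h1 : ∀ᶠ i in 𝒰, ∃ x ∈ S₀, ∃ n, D i n = x ∧ ∀ m ≤ n, D i m ∉ d.ω S₀ := by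
    filter_upwards [h S₀ hS₀, h' S₀ hS₀] with i ⟨N, hN⟩ ⟨N', hN'⟩
    obtain ⟨n, hn, hmin⟩ := Int.exists_least_of_bdd (P := fun n => D i n ∈ d.ω S₀)
      ⟨-N', fun m hm => by
        by_contra hlt
        have := hN' (-m).toNat (by omega)
        rw [drFwd, Int.toNat_of_nonneg (by omega), neg_neg] at this
        exact Set.disjoint_left.1 hd hm this⟩ ⟨N, hN N le_rfl⟩
    have h2 : ∀ m ≤ n - 1, D i m ∉ d.ω S₀ := fun m hm hm' => by
      have := hmin m hm'
      omega
    have h3 := (hD.ray i).2 (n - 1)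
    rw [sub_add_cancel] at h3
    refine ⟨D i (n - 1), ?_, n - 1, rfl, h2⟩
    by_contra hS
    exact h2 _ le_rfl (d.closed hn h3.symm hS)
  obtain ⟨x, hx, h2⟩ := (Ultrafilter.eventually_exists_mem_iff hS₀).1 h1
  have h3 : ∀ i, ∃ c, (∃ n, D i n = x ∧ ∀ m ≤ n, D i m ∉ d.ω S₀) →
      D i c = x ∧ ∀ m ≤ c, D i m ∉ d.ω S₀ := by
    intro i
    by_cases hi : ∃ n, D i n = x ∧ ∀ m ≤ n, D i m ∉ d.ω S₀
    · exact ⟨_, fun _ => hi.choose_spec⟩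
    · exact ⟨0, fun h => absurd h hi⟩
  choose c hc using h3
  have hDc := hD.shift c
  rcases chain_or_dominating (d := d) 𝒰 (fun i => drFwd fun n => D i (c i + n)) le_rfl hS₀
    (x := x) (h2.mono fun i hi => ⟨isRay_drFwd (hDc.ray i), by simpa [drFwd] using (hc i hi).1⟩)
    (fun S hS => (h.shift c S hS).mono fun i ⟨N, hN⟩ => ⟨N, hN N le_rfl⟩)
    hDc.avoid_ray (by
      obtain ⟨i, n, hn, hn'⟩ := h2.exists
      exact hn ▸ hn' n le_rfl) with ⟨S, hS, hSS, z, hz, h4⟩ | h4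
  · refine absurd ⟨S, hS, hSS, z, hz, ?_⟩ hE
    filter_upwards [h2, h4] with i hi ⟨T, hT, hT'⟩
    refine ⟨c i + T, hT, fun m hm hm' => ?_⟩
    rcases le_total m (c i) with hle | hle
    · exact (hc i hi).2 m hle (d.anti hSS hm')
    · obtain ⟨t, rfl⟩ := Int.le.dest hle
      exact hT' t (by omega) hm'
  · exact ⟨x, h4, h2.mono fun i ⟨n, hn, _⟩ => ⟨n, hn⟩⟩

theorem hasInf_of_early (hE : d.Early 𝒰 D S₀) : HasInf G := by
  by_contra hG
  obtain ⟨S, hS, hSS, z, hz, h2⟩ := hE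
  have hfin : ∀ d : Dir G, d.Δ.Finite := fun d => by
    by_contra hΔ
    exact hG (hasInf_of_infinite_dominating hΔ)
  have h3 : ∀ i, ∃ c, (∃ n, D i n = z ∧ ∀ m ≤ n, D i m ∉ d.ω S) →
      D i c = z ∧ ∀ m ≤ c, D i m ∉ d.ω S := by
    intro i
    by_cases hi : ∃ n, D i n = z ∧ ∀ m ≤ n, D i m ∉ d.ω S
    · exact ⟨_, fun _ => hi.choose_spec⟩
    · exact ⟨0, fun h => absurd h hi⟩
  choose c hc using h3
  have hfan : d.Fan (touching G (d.ω S)) z := fan_of_dominating (hfin d) hG 𝒰 _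
    (((h.shift c).conv (hD.shift c) hG).mono fun i hi =>
      ⟨isRay_drFwd ((hD.shift c).ray i), hi⟩) (hD.shift c).large_rays hz hS
  have hD' : Family G 𝒰 fun i n => D i (-(-c i + n)) := hD.neg.shift fun i => -c i
  have hto : d'.Toward 𝒰 fun i n => D i (-(-c i + n)) := h'.shift fun i => -c i
  have hB0 : ∀ᶠ i in 𝒰, drFwd (fun n => D i (-(-c i + n))) 0 = z ∧
      ∀ n, drFwd (fun n => D i (-(-c i + n))) n ∉ d.ω S := by
    filter_upwards [h2] with i hi
    exact ⟨by simpa [drFwd] using (hc i hi).1, fun n => (hc i hi).2 _ (by omega)⟩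
  have hfan' : d'.Fan (restr G (d.ω S)ᶜ) z := by
    rcases chain_or_dominating (d := d') 𝒰 (fun i => drFwd fun n => D i (-(-c i + n)))
      (restr_le G (d.ω S)ᶜ) (hS₀.union (Set.finite_singleton z)) (x := z)
      (hB0.mono fun i hi => ⟨(isRay_drFwd (hD'.ray i)).restr hi.2, hi.1⟩)
      (fun S hS => (hto S hS).mono fun i ⟨N, hN⟩ => ⟨N, hN N le_rfl⟩)
      hD'.avoid_ray (fun h => d'.disj h (Or.inr rfl)) with ⟨S', hS', hSS', z', hz', h4⟩ | h4
    · have hl : Links (restr G (d.ω S ∪ d'.ω S')ᶜ) z z' := by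
        intro F hF
        obtain ⟨i, ⟨⟨hi0, hi⟩, T, hT, hT'⟩, hiF⟩ := hD'.avoid_ray _ (hB0.and h4) F hF
        have hray := isRay_drFwd (hD'.ray i)
        obtain ⟨C, hC1, hC2, hC3, hC4⟩ := exists_segment hray (Nat.zero_le T)
        rw [hi0, hT] at hC3
        have key : ∀ v w, C.Adj v w → v ∈ (d.ω S ∪ d'.ω S')ᶜ := by
          intro v w hvw
          obtain ⟨-, m, -, hm, rfl⟩ := hC4 v w hvw
          exact fun hv => hv.elim (hi m) (hT' m hm)
        exact ⟨C, ⟨fun v w hvw => ⟨rayGraph_le hray (hC1 hvw), key _ _ hvw, key _ _ hvw.symm⟩,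
          hC3⟩, hC2, hiF.mono_left (edgeSet_mono hC1)⟩
      have hf : d'.Fan (touching G (d'.ω S')) z' := fan_of_dominating (hfin d') hG 𝒰 _
        ((hto.conv hD' hG).mono fun i hi => ⟨isRay_drFwd (hD'.ray i), hi⟩) hD'.large_rays hz' hS'
      refine (hf.prepend (disjoint_touching_restr
        (Set.disjoint_compl_right_iff_subset.2 Set.subset_union_right)) hl).mono (sup_le ?_
          (restr_mono le_rfl (Set.compl_subset_compl.2 Set.subset_union_left)))
      have key : ∀ {u v}, u ∈ d'.ω S' → G.Adj u v → u ∉ d.ω S ∧ v ∉ d.ω S := by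
        intro u v hu huv
        have hu' : u ∈ d'.ω S₀ := d'.anti (Set.subset_union_left.trans hSS') hu
        have hu'' : u ∉ d.ω S₀ := fun h => Set.disjoint_left.1 hd h hu'
        exact ⟨fun h => hu'' (d.anti hSS h), fun h =>
          hu'' (d.closed (d.anti hSS h) huv.symm (d'.disj hu'))⟩
      rintro u v ⟨huv, hu | hv⟩
      · exact ⟨huv, key hu huv⟩
      · exact ⟨huv, (key hv huv.symm).symm⟩
    · exact h4.fan (restr_le _ _)
  exact hG (hfan.hasInf hS₀ hd (touching_le _ _) (restr_le _ _)
    (disjoint_touching_restr disjoint_compl_right) hfan')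

end Separated

theorem hasInf_of_separated [Countable V] (hD : Family G 𝒰 D) (h : d.Toward 𝒰 D)
    (h' : d'.Toward 𝒰 fun i n => D i (-n)) {S₀ : Set V} (hS₀ : S₀.Finite)
    (hd : Disjoint (d.ω S₀) (d'.ω S₀)) : HasInf G := by
  have hneg : d.Toward 𝒰 fun i n => D i (- -n) := by simpa only [neg_neg] using h
  by_cases hE : d.Early 𝒰 D S₀
  · exact hasInf_of_early hD h h' hS₀ hd hE
  by_cases hE' : d'.Early 𝒰 (fun i n => D i (-n)) S₀
  · exact hasInf_of_early hD.neg h' hneg hS₀ hd.symm hE'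
  obtain ⟨x, hx, hxD⟩ := chain_of_not_early hD h h' hS₀ hd hE
  obtain ⟨y, hy, hyD⟩ := chain_of_not_early hD.neg h' hneg hS₀ hd.symm hE'
  refine hx.hasInf hS₀ hd hy fun F hF => ?_
  obtain ⟨i, ⟨⟨a, rfl⟩, b, rfl⟩, hi⟩ := hD.avoid (hxD.and hyD) hF
  obtain ⟨C, h1, h2, h3, h4⟩ := exists_segment_of_doubleRay (hD.ray i) a (-b)
  exact ⟨C, ⟨h1, h4⟩, h3, hi.mono_left h2⟩

end Dir

theorem hasInf_of_family [Countable V] {I : Type*} {𝒰 : Ultrafilter I} {D : I → ℤ → V}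
    (hD : Family G 𝒰 D) : HasInf G := by
  by_contra hG
  obtain ⟨d, h⟩ := exists_dir 𝒰 D hD.ray hG
  obtain ⟨d', h'⟩ := exists_dir 𝒰 _ hD.neg.ray hG
  by_cases heq : ∀ S : Set V, S.Finite → d.ω S = d'.ω S
  · exact hG (Dir.hasInf_of_eq (d := d) hD h fun S hS => by simpa only [heq S hS] using h' S hS)
  · push Not at heq
    obtain ⟨S, hS, hne⟩ := heq
    exact hG (Dir.hasInf_of_separated hD h h' hS (Set.disjoint_left.2 fun v hv hv' =>
      hne (Dir.ω_eq_of_mem hv hv')))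

theorem HasInf.of_comap {W : Type*} {H : SimpleGraph W} (φ : W → V) (hφ : Function.Injective φ)
    (hadj : ∀ a b, H.Adj a b → G.Adj (φ a) (φ b)) (h : HasInf H) : HasInf G := by
  obtain ⟨F, h1, h2⟩ := h
  refine ⟨fun i n => φ (F i n), fun i => ⟨hφ.comp (h1 i).1, fun n => hadj _ _ ((h1 i).2 n)⟩,
    fun i j hij => ?_⟩
  have key : ∀ i, drEdges (fun n => φ (F i n)) = Sym2.map φ '' drEdges (F i) := by
    intro i
    ext e
    constructor
    · rintro ⟨n, rfl⟩
      exact ⟨_, ⟨n, rfl⟩, rfl⟩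
    · rintro ⟨_, ⟨n, rfl⟩, rfl⟩
      exact ⟨n, rfl⟩
  show Disjoint (drEdges _) (drEdges _)
  rw [key, key]
  exact (Set.disjoint_image_iff (Sym2.map.injective hφ)).2 (h2 hij)

theorem hasInf_of_forall (h : ∀ k : ℕ, ∃ F : Fin k → ℤ → V, (∀ i, IsDoubleRay G (F i)) ∧
      Pairwise fun i j => Disjoint (drEdges (F i)) (drEdges (F j))) : HasInf G := by
  choose F h1 h2 using h
  let X : Set V := ⋃ k, ⋃ i, Set.range (F k i)
  have hX : ∀ k i n, F k i n ∈ X := fun k i n =>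
    Set.mem_iUnion.2 ⟨k, Set.mem_iUnion.2 ⟨i, n, rfl⟩⟩
  have hc : Countable X := (Set.countable_iUnion fun k => Set.countable_iUnion fun i =>
    Set.countable_range _).to_subtype
  obtain ⟨𝒰, hD⟩ := exists_family (G.induce X) fun k => by
    refine ⟨fun i n => ⟨F k i n, hX k i n⟩, fun i => ⟨fun a b hab => (h1 k i).1
      (congrArg Subtype.val hab), (h1 k i).2⟩, fun i j hij => ?_⟩
    refine Set.disjoint_left.2 ?_
    rintro _ ⟨n, rfl⟩ ⟨m, hm⟩
    exact Set.disjoint_left.1 (h2 k hij) ⟨n, rfl⟩ ⟨m, congrArg (Sym2.map Subtype.val) hm⟩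
  exact (hasInf_of_family hD).of_comap Subtype.val Subtype.val_injective fun _ _ h => h

end DoubleRay

/-- Any graph containing `k` pairwise edge-disjoint double rays for every `k`
contains infinitely many pairwise edge-disjoint double rays. -/
theorem stmt_0 (G : SimpleGraph V)
    (h : ∀ k : ℕ, ∃ F : Fin k → ℤ → V, (∀ i, IsDoubleRay G (F i)) ∧
      Pairwise fun i j => Disjoint (drEdges (F i)) (drEdges (F j))) :
    ∃ F : ℕ → ℤ → V, (∀ i, IsDoubleRay G (F i)) ∧
      Pairwise fun i j => Disjoint (drEdges (F i)) (drEdges (F j)) :=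
  DoubleRay.hasInf_of_forall h
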